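/- arXiv:1410.7087 — 4 statements merged into one kernel-verified Lean document; each statement's English description precedes it below -/
import Mathlib

section
/- For all integers m ≥ ℓ ≥ 8 and all integers k with 2 ≤ k ≤ ℓm/2, setting s = min(2k, ℓ²), we have p_k(ℓ,m) − p_{k−1}(ℓ,m) > 0.004 · 2^{√s} / s^{9/4}. -/
/-- `p k l m`: the number of partitions of `k` fitting in an `l × m` rectangle,
i.e. with at most `l` parts, each part of size at most `m`. Equivalently, the
coefficient of `q^k` in the Gaussian binomial coefficient `C(l+m, m)_q`. -/
def p (k l m : ℕ) : ℕ :=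
  Fintype.card {π : Nat.Partition k // π.parts.card ≤ l ∧ ∀ x ∈ π.parts, x ≤ m}


namespace PP
open Polynomial

/-- multisets of card `l`, sum `k`, entries at most `m` -/
def A (l m k : ℕ) : Set (Multiset ℕ) := {T | T.card = l ∧ T.sum = k ∧ ∀ x ∈ T, x ≤ m}

lemma A_finite (l m k : ℕ) : (A l m k).Finite := by
  refine ((Multiset.powerset (l • Multiset.range (m+1))).toFinset.finite_toSet).subset ?_
  rintro T ⟨h1, h2, h3⟩
  simp only [Multiset.mem_toFinset, SetLike.mem_coe, Multiset.mem_powerset]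
  rw [Multiset.le_iff_count]
  intro a
  by_cases ha : a ∈ T
  · have := h3 a ha
    rw [Multiset.count_nsmul]
    have h4 : Multiset.count a (Multiset.range (m+1)) = 1 :=
      Multiset.count_eq_one_of_mem (Multiset.nodup_range _) (by simp; omega)
    rw [h4, mul_one, ← h1]
    exact Multiset.count_le_card _ _
  · rw [Multiset.count_eq_zero_of_notMem ha]; omega

noncomputable def gp : ℕ → ℕ → ℤ[X]
  | 0, _ => 1
  | (_+1), 0 => 1
  | (l+1), (m+1) => gp (l+1) m + X^(m+1) * gp l (m+1)

lemma gp_zero_left (m : ℕ) : gp 0 m = 1 := by unfold gp; rfl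
lemma gp_zero_right (l : ℕ) : gp l 0 = 1 := by cases l <;> (unfold gp; rfl)
lemma gp_succ (l m : ℕ) : gp (l+1) (m+1) = gp (l+1) m + X^(m+1) * gp l (m+1) := by
  rw [gp]

lemma gp_succ'_aux : ∀ N l m : ℕ, l + m ≤ N →
    gp (l+1) (m+1) = gp l (m+1) + X^(l+1) * gp (l+1) m := by
  intro N
  induction N with
  | zero =>
    intro l m h
    obtain ⟨rfl, rfl⟩ : l = 0 ∧ m = 0 := by omega
    simp [gp_succ, gp_zero_left, gp_zero_right]
  | succ N ih =>
    intro l m h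
    rcases l with _ | l <;> rcases m with _ | m
    · simp [gp_succ, gp_zero_left, gp_zero_right]
    · have e1 := ih 0 m (by omega)
      have e2 := gp_succ 0 m
      have e3 := gp_succ 0 (m+1)
      simp only [gp_zero_left] at *
      linear_combination e3 + e1 - X * e2
    · have e1 := ih l 0 (by omega)
      have e2 := gp_succ l 0
      have e3 := gp_succ (l+1) 0
      simp only [gp_zero_right] at *
      linear_combination e3 - e2 + X * e1
    · have e1 := ih (l+1) m (by omega)
      have e2 := ih l (m+1) (by omega)
      have e3 := gp_succ (l+1) (m+1)
      have e4 := gp_succ l (m+1)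
      have e5 := gp_succ (l+1) m
      linear_combination e3 + e1 + X^(m+2) * e2 - e4 - X^(l+2)*e5

lemma gp_succ' (l m : ℕ) :
    gp (l+1) (m+1) = gp l (m+1) + X^(l+1) * gp (l+1) m := gp_succ'_aux _ l m le_rfl

lemma gp_comm : ∀ N l m : ℕ, l + m ≤ N → gp l m = gp m l := by
  intro N
  induction N with
  | zero =>
    intro l m h
    obtain ⟨rfl, rfl⟩ : l = 0 ∧ m = 0 := by omega
    rfl
  | succ N ih =>
    intro l m h
    rcases l with _ | l
    · simp [gp_zero_left, gp_zero_right]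
    rcases m with _ | m
    · simp [gp_zero_left, gp_zero_right]
    rw [gp_succ, gp_succ', ih (l+1) m (by omega), ih l (m+1) (by omega)]

noncomputable def cnt (l m k : ℕ) : ℕ := (A l m k).ncard

lemma A_succ (l m k : ℕ) : A (l+1) (m+1) k = A (l+1) m k ∪
    (fun T => (m+1) ::ₘ T) '' {T | k = T.sum + (m+1) ∧ T.card = l ∧ ∀ x ∈ T, x ≤ m+1} := by
  ext T
  constructor
  · rintro ⟨h1, h2, h3⟩
    by_cases h : (m+1) ∈ T
    · right
      obtain ⟨T', rfl⟩ := Multiset.exists_cons_of_mem h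
      refine ⟨T', ⟨?_, ?_, ?_⟩, rfl⟩
      · rw [← h2]; simp; ring
      · simpa using h1
      · intro x hx; exact h3 x (by simp [hx])
    · left
      refine ⟨h1, h2, fun x hx => ?_⟩
      have := h3 x hx
      have : x ≠ m+1 := fun e => h (e ▸ hx)
      omega
  · rintro (⟨h1, h2, h3⟩ | ⟨T', ⟨h1, h2, h3⟩, rfl⟩)
    · exact ⟨h1, h2, fun x hx => (h3 x hx).trans (by omega)⟩
    · refine ⟨by simp [h2], by simp [h1]; ring, ?_⟩
      intro x hx
      simp only [Multiset.mem_cons] at hx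
      rcases hx with rfl | hx
      · rfl
      · exact h3 x hx

lemma cnt_succ (l m k : ℕ) : cnt (l+1) (m+1) k = cnt (l+1) m k +
    if m+1 ≤ k then cnt l (m+1) (k-(m+1)) else 0 := by
  unfold cnt
  rw [A_succ, Set.ncard_union_eq ?_ (A_finite _ _ _) ?_]
  · congr 1
    rw [Set.ncard_image_of_injective _ (fun a b h => by simpa using h)]
    split_ifs with h
    · congr 1
      ext T
      simp only [A, Set.mem_ofPred_eq]
      constructor
      · rintro ⟨h1, h2, h3⟩; exact ⟨h2, by omega, h3⟩
      · rintro ⟨h1, h2, h3⟩; exact ⟨by omega, h1, h3⟩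
    · convert Set.ncard_empty (α := Multiset ℕ)
      ext T
      simp only [Set.mem_ofPred_eq, Set.mem_empty_iff_false, iff_false]
      rintro ⟨h1, h2, h3⟩; omega
  · rw [Set.disjoint_left]
    rintro T ⟨h1, h2, h3⟩ ⟨T', ⟨h1, h2, h3'⟩, rfl⟩
    have := h3 (m+1) (by simp)
    omega
  · have := A_finite (l+1) (m+1) k
    rw [A_succ] at this
    exact this.subset Set.subset_union_right

lemma cnt_zero_left (m k : ℕ) : cnt 0 m k = if k = 0 then 1 else 0 := by
  unfold cnt
  split_ifs with h
  · convert Set.ncard_singleton (0 : Multiset ℕ)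
    ext T
    simp only [A, Set.mem_ofPred_eq, Multiset.card_eq_zero, Set.mem_singleton_iff]
    constructor
    · exact fun h => h.1
    · rintro rfl; simp [h]
  · convert Set.ncard_empty (α := Multiset ℕ)
    ext T
    simp only [A, Set.mem_ofPred_eq, Multiset.card_eq_zero, Set.mem_empty_iff_false, iff_false]
    rintro ⟨rfl, h2, h3⟩
    simp at h2; omega

lemma cnt_zero_right (l k : ℕ) : cnt l 0 k = if k = 0 then 1 else 0 := by
  unfold cnt
  split_ifs with h
  · convert Set.ncard_singleton (Multiset.replicate l 0)
    ext T
    simp only [A, Set.mem_ofPred_eq, Set.mem_singleton_iff, Multiset.eq_replicate]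
    constructor
    · exact fun h => ⟨h.1, fun b hb => by have := h.2.2 b hb; omega⟩
    · rintro ⟨h1, h2⟩
      refine ⟨h1, ?_, fun x hx => by rw [h2 x hx]⟩
      rw [Multiset.eq_replicate.2 ⟨h1, h2⟩]; simp [h]
  · convert Set.ncard_empty (α := Multiset ℕ)
    ext T
    simp only [A, Set.mem_ofPred_eq, Set.mem_empty_iff_false, iff_false]
    rintro ⟨h1, h2, h3⟩
    apply h
    rw [← h2, Multiset.sum_eq_zero]
    intro x hx; have := h3 x hx; omega

lemma cnt_eq : ∀ N l m : ℕ, l + m ≤ N → ∀ k, (cnt l m k : ℤ) = (gp l m).coeff k := by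
  intro N
  induction N with
  | zero =>
    intro l m h k
    obtain ⟨rfl, rfl⟩ : l = 0 ∧ m = 0 := by omega
    rw [cnt_zero_left, gp_zero_left, Polynomial.coeff_one]; push_cast; rfl
  | succ N ih =>
    intro l m h k
    rcases l with _ | l
    · rw [cnt_zero_left, gp_zero_left, Polynomial.coeff_one]; push_cast; rfl
    rcases m with _ | m
    · rw [cnt_zero_right, gp_zero_right, Polynomial.coeff_one]; push_cast; rfl
    rw [cnt_succ, gp_succ, Polynomial.coeff_add, Polynomial.coeff_X_pow_mul',
      ← ih (l+1) m (by omega)]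
    split_ifs
    · rw [← ih l (m+1) (by omega)]; push_cast; rfl
    · simp

lemma cnt_coeff (l m k : ℕ) : (cnt l m k : ℤ) = (gp l m).coeff k := cnt_eq _ l m le_rfl k

lemma cnt_comm (l m k : ℕ) : cnt l m k = cnt m l k := by
  have : (cnt l m k : ℤ) = cnt m l k := by
    rw [cnt_coeff, cnt_coeff, gp_comm _ l m le_rfl]
  exact_mod_cast this

lemma p_eq (k l m : ℕ) : p k l m = cnt l m k := by
  unfold p cnt
  rw [← Nat.card_eq_fintype_card, ← Nat.card_coe_set_eq]
  have hfz : ∀ s : Multiset ℕ, (s.filter (fun x => x ≠ 0)) + Multiset.replicate (s.card - (s.filter (fun x => x ≠ 0)).card) 0 = s := by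
    intro s
    conv_rhs => rw [← Multiset.filter_add_not (fun x => x ≠ 0) s]
    congr 1
    symm
    rw [Multiset.eq_replicate]
    constructor
    · have := congrArg Multiset.card (Multiset.filter_add_not (fun x => x ≠ 0) s)
      rw [Multiset.card_add] at this
      omega
    · intro b hb; simpa using (Multiset.mem_filter.1 hb).2
  refine Nat.card_congr (Equiv.ofBijective (fun π => ⟨π.1.parts + Multiset.replicate (l - π.1.parts.card) 0, ?_, ?_, ?_⟩) ⟨?_, ?_⟩)
  · have := π.2.1; simp; omega
  · simp [π.1.parts_sum]
  · intro x hx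
    rw [Multiset.mem_add, Multiset.mem_replicate] at hx
    rcases hx with hx | hx
    · exact π.2.2 x hx
    · omega
  · rintro ⟨π, h1, h2⟩ ⟨π', h1', h2'⟩ h
    have h := congrArg Subtype.val h
    have := congrArg (Multiset.filter (fun x => x ≠ 0)) h
    simp only at this
    have key : ∀ (π : Nat.Partition k) (n : ℕ), Multiset.filter (fun x => x ≠ 0) (π.parts + Multiset.replicate n 0) = π.parts := by
      intro π n
      rw [Multiset.filter_add, Multiset.filter_eq_self.2, Multiset.filter_eq_nil.2, add_zero]
      · intro a ha; simpa using (Multiset.mem_replicate.1 ha).2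
      · intro a ha; exact (π.parts_pos ha).ne'
    rw [key, key] at this
    simpa using Nat.Partition.ext this
  · rintro ⟨T, h1, h2, h3⟩
    refine ⟨⟨⟨T.filter (fun x => x ≠ 0), ?_, ?_⟩, ?_, ?_⟩, ?_⟩
    · intro i hi; have := (Multiset.mem_filter.1 hi).2; omega
    · have := congrArg Multiset.sum (hfz T)
      simpa [h2] using this
    · rw [← h1]; exact Multiset.card_le_card (Multiset.filter_le _ _)
    · intro x hx; exact h3 x (Multiset.mem_filter.1 hx).1
    · apply Subtype.ext
      simp only
      have := hfz T
      rwa [h1] at this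

lemma A_empty (l m k : ℕ) (h : l * m < k) : A l m k = ∅ := by
  ext T
  simp only [A, Set.mem_ofPred_eq, Set.mem_empty_iff_false, iff_false]
  rintro ⟨h1, h2, h3⟩
  have := Multiset.sum_le_card_nsmul T m h3
  rw [h1, h2, smul_eq_mul] at this
  omega

lemma cnt_big (l m k : ℕ) (h : l * m < k) : cnt l m k = 0 := by
  unfold cnt; rw [A_empty l m k h]; simp

lemma sum_map_sub (m : ℕ) (T : Multiset ℕ) (h : ∀ x ∈ T, x ≤ m) :
    (T.map (fun x => m - x)).sum + T.sum = T.card * m := by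
  induction T using Multiset.induction_on with
  | empty => simp
  | cons a T ih =>
    have h1 := ih (fun x hx => h x (by simp [hx]))
    have h2 := h a (by simp)
    simp only [Multiset.map_cons, Multiset.sum_cons, Multiset.card_cons]
    have : (T.card + 1) * m = T.card * m + m := by ring
    omega

lemma cnt_symm (l m k : ℕ) (h : k ≤ l * m) : cnt l m k = cnt l m (l*m - k) := by
  have key : ∀ k, k ≤ l * m → Set.MapsTo (fun T : Multiset ℕ => T.map (fun x => m - x)) (A l m k) (A l m (l*m-k)) := by
    rintro k hk T ⟨h1, h2, h3⟩
    refine ⟨by simpa using h1, ?_, ?_⟩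
    · have := sum_map_sub m T h3
      rw [h1, h2] at this
      simp only
      omega
    · intro x hx
      simp only [Multiset.mem_map] at hx
      obtain ⟨y, _, rfl⟩ := hx
      omega
  have inv : ∀ k, ∀ T ∈ A l m k, (T.map (fun x => m - x)).map (fun x => m - x) = T := by
    rintro k T ⟨h1, h2, h3⟩
    rw [Multiset.map_map]
    conv_rhs => rw [← Multiset.map_id T]
    apply Multiset.map_congr rfl
    intro x hx
    have := h3 x hx
    simp; omega
  have le : ∀ k, k ≤ l * m → cnt l m k ≤ cnt l m (l*m-k) := by
    intro k hk
    refine Set.ncard_le_ncard_of_injOn _ (key k hk) ?_ (A_finite _ _ _)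
    intro T hT T' hT' e
    have := congrArg (Multiset.map (fun x => m - x)) e
    simp only at this
    rwa [inv k T hT, inv k T' hT'] at this
  apply le_antisymm (le k h)
  have := le (l*m-k) (by omega)
  rwa [show l*m - (l*m-k) = k by omega] at this

lemma cnt_zero (l m : ℕ) : cnt l m 0 = 1 := by
  unfold cnt
  convert Set.ncard_singleton (Multiset.replicate l 0)
  ext T
  simp only [A, Set.mem_ofPred_eq, Set.mem_singleton_iff, Multiset.eq_replicate]
  constructor
  · rintro ⟨h1, h2, h3⟩
    exact ⟨h1, fun b hb => Multiset.sum_eq_zero_iff.1 h2 b hb⟩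
  · rintro ⟨h1, h2⟩
    exact ⟨h1, Multiset.sum_eq_zero_iff.2 h2, fun x hx => by rw [h2 x hx]; omega⟩

lemma gp_deg (l m : ℕ) : (gp l m).natDegree < l * m + 1 := by
  rw [Nat.lt_succ_iff, Polynomial.natDegree_le_iff_coeff_eq_zero]
  intro N hN
  rw [← cnt_coeff, cnt_big _ _ _ hN]; rfl

lemma gp_eval (l m : ℕ) (B : ℕ) :
    (gp l m).eval (B : ℤ) = ((∑ k ∈ Finset.range (l*m+1), cnt l m k * B^k : ℕ) : ℤ) := by
  rw [Polynomial.eval_eq_sum_range' (gp_deg l m)]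
  push_cast
  exact Finset.sum_congr rfl (fun k _ => by rw [cnt_coeff])

lemma gp_eval_one : ∀ N l m, l + m ≤ N → (gp l m).eval (1 : ℤ) = ((l+m).choose l : ℕ) := by
  intro N
  induction N with
  | zero =>
    intro l m h
    obtain ⟨rfl, rfl⟩ : l = 0 ∧ m = 0 := by omega
    simp [gp_zero_left]
  | succ N ih =>
    intro l m h
    rcases l with _ | l
    · simp [gp_zero_left]
    rcases m with _ | m
    · simp [gp_zero_right]
    rw [gp_succ']
    simp only [eval_add, eval_mul, eval_pow, eval_X, one_pow, one_mul]
    rw [ih _ _ (by omega), ih _ _ (by omega)]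
    rw [show l + 1 + (m+1) = (l + (m+1)) + 1 by ring, Nat.choose_succ_succ, show l + 1 + m = l + (m+1) by ring]
    push_cast; rfl

lemma cnt_sum (l m : ℕ) : ∑ k ∈ Finset.range (l*m+1), cnt l m k = (l+m).choose l := by
  have h1 := gp_eval l m 1
  have h2 := gp_eval_one _ l m le_rfl
  push_cast at h1
  rw [h2] at h1
  simp only [one_pow, mul_one] at h1
  exact_mod_cast h1.symm

lemma gp_ratio (l m : ℕ) : (X^(l+1) - 1) * gp (l+1) m = (X^(m+l+1) - 1) * gp l m := by
  rcases m with _ | m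
  · simp [gp_zero_right]
  · have e1 := gp_succ l m
    have e2 := gp_succ' l m
    linear_combination X^(l+1) * e1 - e2

def gev (B m : ℕ) : ℕ → ℕ
  | 0 => 1
  | l+1 => gev B m l * (B^(m+l+1) - 1) / (B^(l+1) - 1)

lemma gev_eq (B m l : ℕ) (hB : 2 ≤ B) :
    gev B m l = ∑ k ∈ Finset.range (l*m+1), cnt l m k * B^k := by
  have : (gev B m l : ℤ) = (gp l m).eval (B : ℤ) := by
    induction l with
    | zero => simp [gev, gp_zero_left]
    | succ l ih =>
      have h := congrArg (eval (B : ℤ)) (gp_ratio l m)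
      simp only [eval_mul, eval_sub, eval_pow, eval_X, eval_one] at h
      rw [← ih, gp_eval] at h
      rw [gp_eval]
      have p1 : 1 < B^(l+1) := Nat.one_lt_pow (by omega) (by omega)
      have p2 : 1 ≤ B^(m+l+1) := Nat.one_le_pow _ _ (by omega)
      rw [gev]
      norm_cast
      apply Nat.div_eq_of_eq_mul_right (by omega)
      zify [p1.le, p2]
      push_cast at h
      linarith
  rw [gp_eval] at this
  exact_mod_cast this

lemma digit (B : ℕ) (hB : 2 ≤ B) : ∀ (k N : ℕ) (c : ℕ → ℕ), k < N → (∀ i, c i < B) →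
    (∑ i ∈ Finset.range N, c i * B^i) / B^k % B = c k := by
  intro k
  induction k with
  | zero =>
    intro N c hk hc
    obtain ⟨N, rfl⟩ : ∃ M, N = M + 1 := ⟨N - 1, by omega⟩
    rw [Finset.sum_range_succ']
    simp only [pow_succ, ← mul_assoc, ← Finset.sum_mul]
    simp [Nat.mod_eq_of_lt (hc 0)]
  | succ k ih =>
    intro N c hk hc
    obtain ⟨N, rfl⟩ : ∃ M, N = M + 1 := ⟨N - 1, by omega⟩
    rw [Finset.sum_range_succ']
    simp only [pow_succ, ← mul_assoc, ← Finset.sum_mul]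
    rw [mul_comm (B^k) B, ← Nat.div_div_eq_div_mul]
    have : (((∑ i ∈ Finset.range N, c (i + 1) * B ^ i) * B + c 0 * B ^ 0) / B) = ∑ i ∈ Finset.range N, c (i + 1) * B ^ i := by
      rw [pow_zero, mul_one, add_comm, Nat.add_mul_div_right _ _ (by omega), Nat.div_eq_of_lt (hc 0), zero_add]
    rw [this]
    exact ih N (fun i => c (i+1)) (by omega) (fun i => hc _)

lemma cnt_le (l m k : ℕ) : cnt l m k ≤ (l+m).choose l := by
  by_cases h : k ≤ l * m
  · rw [← cnt_sum]
    exact Finset.single_le_sum (f := fun k => cnt l m k) (fun _ _ => Nat.zero_le _) (Finset.mem_range.2 (by omega))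
  · rw [cnt_big _ _ _ (by omega)]; omega

lemma cnt_digit (B l m k : ℕ) (hB : 2 ≤ B) (hC : (l+m).choose l < B) (hk : k ≤ l * m) :
    cnt l m k = gev B m l / B^k % B := by
  rw [gev_eq B m l hB, digit B hB k _ _ (by omega) (fun i => (cnt_le l m i).trans_lt hC)]

end PP

namespace PP
open MvPolynomial
open scoped Pointwise

lemma der_monomial_mem {σ : Type*} (c : σ → ℚ) (g : σ → σ) (s : σ →₀ ℕ) (a : ℚ) (T : Set (σ →₀ ℕ))
    (h : ∀ i ∈ s.support, c i ≠ 0 → s - Finsupp.single i 1 + Finsupp.single (g i) 1 ∈ T) :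
    mkDerivation ℚ (fun i => c i • (X (g i) : MvPolynomial σ ℚ)) (monomial s a) ∈
      restrictSupport ℚ T := by
  rw [mkDerivation_monomial]
  apply Submodule.smul_mem
  apply Submodule.sum_mem
  intro i hi
  simp only [smul_eq_mul, mul_smul_comm]
  by_cases hc : c i = 0
  · rw [hc, zero_smul]; exact Submodule.zero_mem _
  apply Submodule.smul_mem
  rw [X, monomial_mul, monomial_mem_restrictSupport]
  left
  exact h i hi hc

lemma der_mem {σ : Type*} (c : σ → ℚ) (g : σ → σ) (T T' : Set (σ →₀ ℕ))
    (h : ∀ s ∈ T, ∀ i ∈ s.support, c i ≠ 0 → s - Finsupp.single i 1 + Finsupp.single (g i) 1 ∈ T')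
    (f : MvPolynomial σ ℚ) (hf : f ∈ restrictSupport ℚ T) :
    mkDerivation ℚ (fun i => c i • (X (g i) : MvPolynomial σ ℚ)) f ∈
      restrictSupport ℚ T' := by
  rw [restrictSupport_eq_span] at hf
  induction hf using Submodule.span_induction with
  | mem x hx =>
    obtain ⟨s, hs, rfl⟩ := hx
    exact der_monomial_mem c g s 1 T' (h s hs)
  | zero => simp
  | add x y _ _ hx hy => rw [map_add]; exact Submodule.add_mem _ hx hy
  | smul a x _ hx => rw [Derivation.map_smul]; exact Submodule.smul_mem _ _ hx

lemma der_diag {σ : Type*} (c : σ → ℚ) (T : Set (σ →₀ ℕ)) (r : ℚ)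
    (h : ∀ s ∈ T, s.sum (fun i k => (k : ℚ) * c i) = r)
    (f : MvPolynomial σ ℚ) (hf : f ∈ restrictSupport ℚ T) :
    mkDerivation ℚ (fun i => c i • (X i : MvPolynomial σ ℚ)) f = r • f := by
  rw [restrictSupport_eq_span] at hf
  induction hf using Submodule.span_induction with
  | mem x hx =>
    obtain ⟨s, hs, rfl⟩ := hx
    simp only [mkDerivation_monomial, one_smul]
    rw [← h s hs, Finsupp.sum, Finsupp.sum, Finset.sum_smul]
    apply Finset.sum_congr rfl
    intro i hi
    have : Finsupp.single i 1 ≤ s := by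
      rw [Finsupp.single_le_iff]; have := Finsupp.mem_support_iff.1 hi; omega
    rw [smul_eq_mul, mul_smul_comm, X, monomial_mul, tsub_add_cancel_of_le this, smul_monomial, smul_monomial]
    simp [mul_comm]
  | zero => simp
  | add x y _ _ hx hy => rw [map_add, hx, hy, smul_add]
  | smul a x _ hx => rw [Derivation.map_smul, hx, smul_comm]

/-- weight of an exponent vector -/
noncomputable def wt : (ℕ →₀ ℕ) →+ ℕ := Finsupp.weight (fun i : ℕ => i)

lemma wt_single (i n : ℕ) : wt (Finsupp.single i n) = n * i := by
  unfold wt; rw [Finsupp.weight_single]; simp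

def Ms (l m k : ℕ) : Set (ℕ →₀ ℕ) :=
  {s | s.degree = l ∧ wt s = k ∧ ∀ i ∈ s.support, i ≤ m}

lemma Ms_toMultiset (l m k : ℕ) (s : ℕ →₀ ℕ) : s ∈ Ms l m k ↔ Finsupp.toMultiset s ∈ A l m k := by
  unfold Ms A
  simp only [Set.mem_ofPred_eq, Finsupp.card_toMultiset, Finsupp.mem_toMultiset]
  have h1 : s.degree = s.sum fun _ => id := rfl
  have h2 : (Finsupp.toMultiset s).sum = wt s := by
    rw [Finsupp.toMultiset_apply, Finsupp.sum, Multiset.sum_sum]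
    unfold wt
    rw [Finsupp.weight_apply, Finsupp.sum]
    apply Finset.sum_congr rfl
    intro x _
    rw [Multiset.sum_nsmul, Multiset.sum_singleton]
  rw [h1, h2]

lemma toMS_inj : Function.Injective (Finsupp.toMultiset : (ℕ →₀ ℕ) → Multiset ℕ) :=
  Multiset.toFinsupp.symm.injective

lemma Ms_ncard (l m k : ℕ) : (Ms l m k).ncard = cnt l m k := by
  unfold cnt
  have : A l m k = Finsupp.toMultiset '' Ms l m k := by
    ext T
    constructor
    · intro hT
      refine ⟨Multiset.toFinsupp T, ?_, by simp⟩
      rw [Ms_toMultiset]; simpa using hT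
    · rintro ⟨s, hs, rfl⟩
      exact (Ms_toMultiset l m k s).1 hs
  rw [this, Set.ncard_image_of_injective _ toMS_inj]

lemma Ms_finite (l m k : ℕ) : (Ms l m k).Finite := by
  refine Set.Finite.of_injOn (f := Finsupp.toMultiset) (fun s hs => (Ms_toMultiset l m k s).1 hs)
    toMS_inj.injOn (A_finite l m k)

lemma Ms_move (l m k k' : ℕ) (s : ℕ →₀ ℕ) (hs : s ∈ Ms l m k) (i j : ℕ) (hi : i ∈ s.support)
    (hj : j ≤ m) (hk : k + j = k' + i) :
    s - Finsupp.single i 1 + Finsupp.single j 1 ∈ Ms l m k' := by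
  obtain ⟨h1, h2, h3⟩ := hs
  have hle : Finsupp.single i 1 ≤ s := by
    rw [Finsupp.single_le_iff]; have := Finsupp.mem_support_iff.1 hi; omega
  have e := tsub_add_cancel_of_le hle
  have e1 := congrArg Finsupp.degree e
  have e2 := congrArg wt e
  rw [map_add, Finsupp.degree_single] at e1
  rw [map_add, wt_single] at e2
  refine ⟨?_, ?_, ?_⟩
  · rw [map_add, Finsupp.degree_single]; omega
  · rw [map_add, wt_single]; omega
  · intro x hx
    rcases Finset.mem_union.1 (Finsupp.support_add hx) with h | h
    · exact h3 x (Finsupp.support_tsub h)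
    · have := Finsupp.support_single_subset h
      rw [Finset.mem_singleton] at this; omega

abbrev S := MvPolynomial ℕ ℚ
noncomputable def D : Derivation ℚ S S := mkDerivation ℚ (fun i : ℕ => (i : ℚ) • (X (i-1) : S))
noncomputable def U (m : ℕ) : Derivation ℚ S S :=
  mkDerivation ℚ (fun i : ℕ => ((m : ℚ) - i) • (X (i+1) : S))
noncomputable def R (l m k : ℕ) : Submodule ℚ S := restrictSupport ℚ (Ms l m k)

instance fd_R (l m k : ℕ) : FiniteDimensional ℚ (R l m k) := by
  have := (Ms_finite l m k).to_subtype
  exact Module.Finite.of_basis (basisRestrictSupport ℚ (Ms l m k))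

lemma finrank_R (l m k : ℕ) : Module.finrank ℚ (R l m k) = cnt l m k := by
  rw [← Ms_ncard, ← Nat.card_coe_set_eq]
  exact Module.finrank_eq_nat_card_basis (basisRestrictSupport ℚ (Ms l m k))

lemma D_X (i : ℕ) : D (X i) = (i : ℚ) • (X (i-1) : S) := by unfold D; rw [mkDerivation_X]
lemma U_X (m i : ℕ) : U m (X i) = ((m : ℚ) - i) • (X (i+1) : S) := by unfold U; rw [mkDerivation_X]

lemma D_mem (l m k : ℕ) (f : S) (hf : f ∈ R l m (k+1)) : D f ∈ R l m k := by
  refine der_mem (fun i : ℕ => (i : ℚ)) (fun i => i - 1) _ _ ?_ f hf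
  intro s hs i hi hc
  have : i ≠ 0 := by rintro rfl; simp at hc
  have := hs.2.2 i hi
  exact Ms_move l m (k+1) k s hs i (i-1) hi (by omega) (by omega)

lemma wt_ge (s : ℕ →₀ ℕ) (i : ℕ) (hi : i ∈ s.support) : i ≤ wt s := by
  have hle : Finsupp.single i 1 ≤ s := by
    rw [Finsupp.single_le_iff]; have := Finsupp.mem_support_iff.1 hi; omega
  have e := congrArg wt (tsub_add_cancel_of_le hle)
  rw [map_add, wt_single] at e; omega

lemma D_zero (l m : ℕ) (f : S) (hf : f ∈ R l m 0) : D f = 0 := by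
  have : D f ∈ restrictSupport ℚ (∅ : Set (ℕ →₀ ℕ)) := by
    refine der_mem (fun i : ℕ => (i : ℚ)) (fun i => i - 1) _ _ ?_ f hf
    intro s hs i hi hc
    have h1 : i ≠ 0 := by rintro rfl; simp at hc
    have h2 := wt_ge s i hi
    rw [hs.2.1] at h2
    omega
  rw [mem_restrictSupport_iff] at this
  simpa using this

lemma U_mem (l m k : ℕ) (f : S) (hf : f ∈ R l m k) : U m f ∈ R l m (k+1) := by
  refine der_mem (fun i : ℕ => ((m : ℚ) - i)) (fun i => i + 1) _ _ ?_ f hf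
  intro s hs i hi hc
  have : i ≠ m := by rintro rfl; simp at hc
  have := hs.2.2 i hi
  exact Ms_move l m k (k+1) s hs i (i+1) hi (by omega) (by omega)

lemma comm_DU (m : ℕ) : ⁅D, U m⁆ = mkDerivation ℚ (fun i : ℕ => ((m : ℚ) - 2 * i) • (X i : S)) := by
  apply MvPolynomial.derivation_ext
  intro i
  rw [Derivation.commutator_apply, mkDerivation_X, U_X, D_X, Derivation.map_smul, Derivation.map_smul,
    D_X, U_X]
  rcases i with _ | i
  · simp
  · simp only [Nat.add_sub_cancel]
    rw [smul_smul, smul_smul, ← sub_smul]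
    congr 1
    push_cast; ring

lemma DU (l m k : ℕ) (f : S) (hf : f ∈ R l m k) :
    D (U m f) = U m (D f) + ((l : ℚ) * m - 2 * k) • f := by
  have h1 : ⁅D, U m⁆ f = ((l : ℚ) * m - 2 * k) • f := by
    rw [comm_DU]
    apply der_diag _ (Ms l m k) _ ?_ f hf
    rintro s ⟨h1, h2, h3⟩
    rw [← h1, ← h2]
    unfold wt
    rw [Finsupp.weight_apply, Finsupp.degree_apply]
    simp only [Finsupp.sum]
    push_cast
    rw [Finset.sum_mul, Finset.mul_sum, ← Finset.sum_sub_distrib]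
    apply Finset.sum_congr rfl
    intro i _
    simp only [smul_eq_mul]; push_cast; ring
  rw [Derivation.commutator_apply] at h1
  rw [← h1]; abel

lemma DU_inj (l m : ℕ) : ∀ w : ℕ, 2 * w < l * m → ∀ c : ℚ, 0 ≤ c → ∀ v ∈ R l m w,
    D (U m v) + c • v = 0 → v = 0 := by
  intro w
  induction w with
  | zero =>
    intro hw c hc v hv h
    rw [DU l m 0 v hv, D_zero l m v hv, map_zero, zero_add, ← add_smul] at h
    rcases smul_eq_zero.1 h with h | h
    · have : (0 : ℚ) < l * m := by exact_mod_cast (by omega : 0 < l * m)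
      push_cast at h
      linarith
    · exact h
  | succ w ih =>
    intro hw c hc v hv h
    rw [DU l m _ v hv, add_assoc, ← add_smul] at h
    have hp : (0 : ℚ) < l * m - 2 * (w+1 : ℕ) := by
      have : ((2 * (w+1) : ℕ) : ℚ) < (l * m : ℕ) := by exact_mod_cast hw
      push_cast at this ⊢; linarith
    have h2 := congrArg D h
    rw [map_add, Derivation.map_smul, map_zero] at h2
    have h3 := ih (by omega) _ (by linarith) _ (D_mem l m w v hv) h2
    rw [h3, map_zero, zero_add] at h
    rcases smul_eq_zero.1 h with h | h
    · linarith
    · exact h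

lemma D_surj (l m w : ℕ) (hw : 2 * w < l * m) :
    (R l m (w+1)).map (D : S →ₗ[ℚ] S) = R l m w := by
  apply le_antisymm
  · rintro _ ⟨f, hf, rfl⟩
    exact D_mem l m w f hf
  · have hmem : ∀ v ∈ R l m w, ((D : S →ₗ[ℚ] S) ∘ₗ (U m : S →ₗ[ℚ] S)) v ∈ R l m w := by
      intro v hv
      exact D_mem l m w _ (U_mem l m w v hv)
    have hinj : Function.Injective (((D : S →ₗ[ℚ] S) ∘ₗ (U m : S →ₗ[ℚ] S)).restrict hmem) := by
      rw [← LinearMap.ker_eq_bot, LinearMap.ker_eq_bot']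
      rintro ⟨v, hv⟩ h
      have h := congrArg Subtype.val h
      have h' : D (U m v) = 0 := h
      apply Subtype.ext
      exact DU_inj l m w hw 0 le_rfl v hv (by rw [h', zero_smul, add_zero])
    have hsurj := LinearMap.surjective_of_injective hinj
    intro v hv
    obtain ⟨⟨u, hu⟩, h⟩ := hsurj ⟨v, hv⟩
    have h := congrArg Subtype.val h
    exact ⟨U m u, U_mem l m w u hu, h⟩

/-- kernel piece -/
noncomputable def K (l m k : ℕ) : Submodule ℚ S := R l m k ⊓ LinearMap.ker (D : S →ₗ[ℚ] S)

noncomputable def d (l m k : ℕ) : ℕ := Module.finrank ℚ (K l m k)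

instance fd_K (l m k : ℕ) : FiniteDimensional ℚ (K l m k) :=
  Submodule.finiteDimensional_inf_left _ _

lemma rank_nullity {V W : Type*} [AddCommGroup V] [Module ℚ V] [AddCommGroup W] [Module ℚ W]
    (f : V →ₗ[ℚ] W) (P : Submodule ℚ V) [FiniteDimensional ℚ P] :
    Module.finrank ℚ (P.map f) + Module.finrank ℚ (P ⊓ LinearMap.ker f : Submodule ℚ V) = Module.finrank ℚ P := by
  have h := LinearMap.finrank_range_add_finrank_ker (f.domRestrict P)
  rw [LinearMap.range_domRestrict] at h
  rw [← h]
  congr 1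
  have e : LinearMap.ker (f.domRestrict P) = (LinearMap.ker f).comap P.subtype := by
    rw [LinearMap.ker_domRestrict]
  rw [e, ← Submodule.map_comap_subtype]
  exact (LinearEquiv.finrank_eq (Submodule.equivMapOfInjective P.subtype P.injective_subtype _)).symm

lemma d_zero (l m : ℕ) : d l m 0 = 1 := by
  unfold d
  have : K l m 0 = R l m 0 := by
    unfold K
    rw [inf_eq_left]
    intro f hf
    exact D_zero l m f hf
  rw [this, finrank_R, cnt_zero]

lemma d_eq (l m k : ℕ) (h : 2 * k < l * m) : cnt l m k + d l m (k+1) = cnt l m (k+1) := by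
  have := rank_nullity (D : S →ₗ[ℚ] S) (R l m (k+1))
  rw [D_surj l m k h, finrank_R, finrank_R] at this
  exact this

lemma R_mul (l1 l2 m k1 k2 : ℕ) (f g : S) (hf : f ∈ R l1 m k1) (hg : g ∈ R l2 m k2) :
    f * g ∈ R (l1+l2) m (k1+k2) := by
  have h1 : f * g ∈ restrictSupport ℚ (Ms l1 m k1 + Ms l2 m k2) := by
    rw [restrictSupport_add]; exact Submodule.mul_mem_mul hf hg
  refine restrictSupport_mono ℚ ?_ h1
  rintro _ ⟨s, hs, t, ht, rfl⟩
  refine ⟨by simp only [map_add]; rw [hs.1, ht.1], by simp only [map_add]; rw [hs.2.1, ht.2.1], ?_⟩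
  intro i hi
  rcases Finset.mem_union.1 (Finsupp.support_add hi) with h | h
  · exact hs.2.2 i h
  · exact ht.2.2 i h

lemma d_mul (l1 l2 m k1 k2 : ℕ) (h : 1 ≤ d l2 m k2) : d l1 m k1 ≤ d (l1+l2) m (k1+k2) := by
  have hne : K l2 m k2 ≠ ⊥ := by
    intro e
    unfold d at h
    rw [e] at h; simp at h
  obtain ⟨g, hg, hg0⟩ := Submodule.exists_mem_ne_zero_of_ne_bot hne
  unfold d
  have hinj : Function.Injective (LinearMap.mulRight ℚ g) := by
    intro a b hab
    exact mul_right_cancel₀ hg0 hab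
  rw [(LinearEquiv.finrank_eq (Submodule.equivMapOfInjective (LinearMap.mulRight ℚ g) hinj (K l1 m k1)))]
  apply Submodule.finrank_mono
  rintro _ ⟨f, hf, rfl⟩
  refine ⟨R_mul _ _ _ _ _ _ _ hf.1 hg.1, ?_⟩
  have hf2 : D f = 0 := hf.2
  have hg2 : D g = 0 := hg.2
  simp only [LinearMap.mulRight_apply]
  change D (f * g) = 0
  rw [Derivation.leibniz, hf2, hg2]; simp

lemma d_comm (l m k : ℕ) (h : 2 * k ≤ l * m) : d l m k = d m l k := by
  rcases k with _ | k
  · rw [d_zero, d_zero]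
  · have h1 := d_eq l m k (by omega)
    have h2 := d_eq m l k (by rw [mul_comm m l]; omega)
    rw [cnt_comm m l, cnt_comm m l] at h2
    omega

lemma d_mul' (l m1 m2 k1 k2 : ℕ) (h : 1 ≤ d l m2 k2) (h1 : 2 * k1 ≤ l * m1) (h2 : 2 * k2 ≤ l * m2) :
    d l m1 k1 ≤ d l (m1+m2) (k1+k2) := by
  rw [d_comm l m1 k1 h1, d_comm l (m1+m2) (k1+k2) (by nlinarith)]
  apply d_mul
  rwa [← d_comm l m2 k2 h2]

end PP

namespace PP

def allb : ℕ → (ℕ → Bool) → Bool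
  | 0, _ => true
  | n+1, f => f n && allb n f

lemma allb_spec (n : ℕ) (f : ℕ → Bool) (h : allb n f = true) : ∀ i < n, f i = true := by
  induction n with
  | zero => intro i hi; omega
  | succ n ih =>
    simp only [allb, Bool.and_eq_true] at h
    intro i hi
    rcases Nat.lt_succ_iff_lt_or_eq.1 hi with h' | rfl
    · exact ih h.2 i h'
    · exact h.1

def chkX (B X K : ℕ) : Bool := allb (K-1) (fun i => Nat.blt (X / B^(i+1) % B) (X / B^(i+2) % B))

lemma base_check : allb 8 (fun i => allb 8 (fun j =>
    chkX (2^28) (gev (2^28) (8+j) (8+i)) ((8+i)*(8+j)/2))) = true := by decide +kernel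

lemma base_d (l m k : ℕ) (hl : 8 ≤ l) (hl' : l < 16) (hm : 8 ≤ m) (hm' : m < 16) (hk : 2 ≤ k)
    (hk' : 2 * k ≤ l * m) : 1 ≤ d l m k := by
  have h1 := allb_spec _ _ (allb_spec _ _ base_check (l-8) (by omega)) (m-8) (by omega)
  simp only [show 8 + (l-8) = l by omega, show 8 + (m-8) = m by omega] at h1
  have h2 := allb_spec _ _ h1 (k-2) (by omega)
  have hC : (l+m).choose l < 2^28 := by
    calc (l+m).choose l ≤ (30).choose l := Nat.choose_le_choose _ (by omega)
      _ ≤ (30).choose 15 := Nat.choose_le_middle l 30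
      _ < 2^28 := by decide +kernel
  simp only [show k - 2 + 1 = k - 1 by omega, show k - 2 + 2 = k by omega] at h2
  rw [← cnt_digit _ l m (k-1) (by norm_num) hC (by omega), ← cnt_digit _ l m k (by norm_num) hC (by omega)] at h2
  have h3 : cnt l m (k-1) < cnt l m k := by simpa using h2
  have h4 := d_eq l m (k-1) (by omega)
  rw [show k - 1 + 1 = k by omega] at h4
  omega

lemma d_pos_aux (m : ℕ) (hm : 8 ≤ m)
    (hb : ∀ l, 8 ≤ l → l < 16 → ∀ k, k ≠ 1 → 2 * k ≤ l * m → 1 ≤ d l m k) :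
    ∀ l, 8 ≤ l → ∀ k, k ≠ 1 → 2 * k ≤ l * m → 1 ≤ d l m k := by
  intro l
  induction l using Nat.strong_induction_on with
  | _ l ih =>
    intro hl k hk hk'
    by_cases h16 : l < 16
    · exact hb l hl h16 k hk hk'
    obtain ⟨l, rfl⟩ : ∃ l', l = 8 + l' := ⟨l - 8, by omega⟩
    have key : ∃ k1 k2, k = k1 + k2 ∧ k1 ≠ 1 ∧ k2 ≠ 1 ∧ 2 * k1 ≤ 8 * m ∧ 2 * k2 ≤ l * m := by
      have e : (8 + l) * m = 8 * m + l * m := by ring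
      have : 8 * 8 ≤ l * m := Nat.mul_le_mul (by omega) hm
      by_cases h1 : k ≤ 4 * m
      · exact ⟨k, 0, by omega, hk, by omega, by omega, by omega⟩
      · by_cases h2 : k = 4 * m + 1
        · exact ⟨4*m-1, 2, by omega, by omega, by omega, by omega, by omega⟩
        · exact ⟨4*m, k-4*m, by omega, by omega, by omega, by omega, by omega⟩
    obtain ⟨k1, k2, rfl, h1, h2, h3, h4⟩ := key
    exact (hb 8 le_rfl (by omega) k1 h1 h3).trans (d_mul 8 l m k1 k2 (ih l (by omega) (by omega) k2 h2 h4))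

lemma d_pos (l m k : ℕ) (hl : 8 ≤ l) (hm : 8 ≤ m) (hk : k ≠ 1) (hk' : 2 * k ≤ l * m) :
    1 ≤ d l m k := by
  have hb : ∀ m, 8 ≤ m → m < 16 → ∀ l, 8 ≤ l → ∀ k, k ≠ 1 → 2 * k ≤ l * m → 1 ≤ d l m k := by
    intro m hm hm'
    apply d_pos_aux m hm
    intro l hl hl' k hk hk'
    rcases k with _ | k
    · rw [d_zero]
    · exact base_d l m _ hl hl' hm hm' (by omega) hk'
  have := d_pos_aux l hl (fun m hm hm' k hk hk' => by
    have := hb m hm hm' l hl k hk (by linarith [mul_comm l m])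
    rwa [d_comm m l k hk']) m hm k hk (by linarith [mul_comm l m])
  rwa [d_comm l m k hk']

end PP

namespace PP

lemma reduce (l m k l1 m1 K : ℕ) (he : 2 ∣ l1) (hK : 2 * K = l1 * m1) (h1 : 8 ≤ l1) (h2 : 8 ≤ m1)
    (hl : l1 + 8 ≤ l) (hm : m1 + 8 ≤ m) (hk : K + 2 ≤ k) (hk' : 2 * k ≤ l * m) :
    d l1 m1 K ≤ d l m k := by
  obtain ⟨l2, rfl⟩ : ∃ l2, l = l1 + l2 := ⟨l - l1, by omega⟩
  obtain ⟨m2, rfl⟩ : ∃ m2, m = m1 + m2 := ⟨m - m1, by omega⟩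
  obtain ⟨h, rfl⟩ := he
  have key : ∃ k2 k3, k = K + k2 + k3 ∧ k2 ≠ 1 ∧ k3 ≠ 1 ∧ 2 * k2 ≤ (2*h) * m2 ∧ 2 * k3 ≤ l2 * (m1+m2) := by
    have e : (2 * h + l2) * (m1 + m2) = 2*h * m1 + 2 * (h * m2) + l2 * (m1+m2) := by ring
    have e2 : 2 * h * m2 = 2 * (h * m2) := by ring
    have e3 : 8 * 8 ≤ l2 * (m1+m2) := Nat.mul_le_mul (by omega) (by omega)
    have e4 : 4 * 8 ≤ h * m2 := Nat.mul_le_mul (by omega) (by omega)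
    rw [e2]
    generalize h * m2 = a at *
    by_cases c1 : k ≤ K + a
    · exact ⟨k - K, 0, by omega, by omega, by omega, by omega, by omega⟩
    · by_cases c2 : k = K + a + 1
      · exact ⟨a - 1, 2, by omega, by omega, by omega, by omega, by omega⟩
      · exact ⟨a, k - K - a, by omega, by omega, by omega, by omega, by omega⟩
  obtain ⟨k2, k3, rfl, n2, n3, b2, b3⟩ := key
  calc d (2*h) m1 K ≤ d (2*h) (m1+m2) (K+k2) :=
        d_mul' _ _ _ _ _ (d_pos _ _ _ h1 (by omega) n2 b2) (by omega) b2
    _ ≤ _ := d_mul _ _ _ _ _ (d_pos _ _ _ (by omega) (by omega) n3 b3)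

lemma inv_check (B l m k v : ℕ) (hB : 2 ≤ B) (hC : (l+m).choose l < B) (hk : 2 * (k+1) ≤ l * m)
    (h : Nat.ble (gev B m l / B^k % B + v) (gev B m l / B^(k+1) % B) = true) : v ≤ d l m (k+1) := by
  rw [← cnt_digit _ l m k hB hC (by omega), ← cnt_digit _ l m (k+1) hB hC (by omega)] at h
  have h3 : cnt l m k + v ≤ cnt l m (k+1) := by simpa using h
  have h4 := d_eq l m k (by omega)
  omega

lemma inv22 : 5161550 ≤ d 22 22 242 :=
  inv_check (2^44) 22 22 241 _ (by norm_num) (by decide +kernel) (by norm_num) (by decide +kernel)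

lemma inv48 : 493244980606178642629 ≤ d 48 48 1152 :=
  inv_check (2^96) 48 48 1151 _ (by norm_num) (by decide +kernel) (by norm_num) (by decide +kernel)

lemma inv98 : 10^49 ≤ d 98 98 4802 :=
  inv_check (2^200) 98 98 4801 _ (by norm_num) (by decide +kernel) (by norm_num) (by decide +kernel)

lemma K_lt (n k l1 m1 K : ℕ) (hn : 30 ≤ n) (hk : (n-1)^2 < 2 * k) (hK : 2 * K = l1 * m1)
    (hl : l1 + 8 ≤ n) (hm : m1 + 8 ≤ n) : K + 2 ≤ k := by
  obtain ⟨a, rfl⟩ : ∃ a, n = a + 8 := ⟨n - 8, by omega⟩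
  have h1 : l1 * m1 ≤ a * a := Nat.mul_le_mul (by omega) (by omega)
  rw [show a + 8 - 1 = a + 7 by omega] at hk
  have : (a+7)^2 = a * a + 14 * a + 49 := by ring
  omega

def chkn (lo v i : ℕ) : Bool := Nat.blt (2^(i+lo)) (1250 * (i+lo-1)^4 * v)

lemma chkn_spec (lo hi v : ℕ) (h : allb (hi-lo) (chkn lo v) = true) (n : ℕ) (h1 : lo ≤ n) (h2 : n < hi) :
    2^n < 1250 * (n-1)^4 * v := by
  have := allb_spec _ _ h (n-lo) (by omega)
  unfold chkn at this
  rw [show n - lo + lo = n by omega] at this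
  simpa using this

lemma star_lo (n m k : ℕ) (hn : 30 ≤ n) (hn' : n < 168) (hm : n ≤ m) (hk : (n-1)^2 < 2 * k)
    (hk' : 2 * k ≤ n * m) : 2^n < 1250 * (n-1)^4 * d n m k := by
  rcases lt_or_ge n 56 with h | h
  · have h0 := reduce n m k 22 22 242 (by norm_num) (by norm_num) (by norm_num) (by norm_num) (by omega) (by omega)
      (K_lt n k 22 22 242 hn hk (by norm_num) (by omega) (by omega)) hk'
    exact (chkn_spec 30 56 5161550 (by decide +kernel) n hn h).trans_le (Nat.mul_le_mul le_rfl (inv22.trans h0))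
  rcases lt_or_ge n 106 with h' | h'
  · have h0 := reduce n m k 48 48 1152 (by norm_num) (by norm_num) (by norm_num) (by norm_num) (by omega) (by omega)
      (K_lt n k 48 48 1152 hn hk (by norm_num) (by omega) (by omega)) hk'
    exact (chkn_spec 56 106 493244980606178642629 (by decide +kernel) n h h').trans_le (Nat.mul_le_mul le_rfl (inv48.trans h0))
  · have h0 := reduce n m k 98 98 4802 (by norm_num) (by norm_num) (by norm_num) (by norm_num) (by omega) (by omega)
      (K_lt n k 98 98 4802 hn hk (by norm_num) (by omega) (by omega)) hk'
    exact (chkn_spec 106 168 (10^49) (by decide +kernel) n h' hn').trans_le (Nat.mul_le_mul le_rfl (inv98.trans h0))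

lemma choose_step (β : ℕ) (hβ : 1 ≤ β) : 36 * (7*β).choose (2*β) ≤ (7*(β+1)).choose (2*(β+1)) := by
  -- use factorial formula
  have h1 : (7*β).choose (2*β) * (2*β).factorial * (5*β).factorial = (7*β).factorial := by
    have := Nat.choose_mul_factorial_mul_factorial (n := 7*β) (k := 2*β) (by omega)
    rwa [show 7*β - 2*β = 5*β by omega] at this
  have h2 : (7*(β+1)).choose (2*(β+1)) * (2*(β+1)).factorial * (5*(β+1)).factorial = (7*(β+1)).factorial := by
    have := Nat.choose_mul_factorial_mul_factorial (n := 7*(β+1)) (k := 2*(β+1)) (by omega)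
    rwa [show 7*(β+1) - 2*(β+1) = 5*(β+1) by omega] at this
  generalize (7*β).choose (2*β) = c1 at *
  generalize (7*(β+1)).choose (2*(β+1)) = c2 at *
  rw [show 7*(β+1) = 7*β+7 by ring, show 2*(β+1) = 2*β+2 by ring, show 5*(β+1) = 5*β+5 by ring] at h2
  simp only [Nat.factorial_succ, show 7*β+7 = 7*β+6+1 by ring, show 7*β+6 = 7*β+5+1 by ring,
    show 7*β+5 = 7*β+4+1 by ring, show 7*β+4 = 7*β+3+1 by ring, show 7*β+3 = 7*β+2+1 by ring,
    show 7*β+2 = 7*β+1+1 by ring, show 2*β+2 = 2*β+1+1 by ring, show 5*β+5 = 5*β+4+1 by ring,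
    show 5*β+4 = 5*β+3+1 by ring, show 5*β+3 = 5*β+2+1 by ring, show 5*β+2 = 5*β+1+1 by ring] at h2
  rw [← h1] at h2
  have f1 := Nat.factorial_pos (2*β)
  have f2 := Nat.factorial_pos (5*β)
  generalize (2*β).factorial = f at *
  generalize (5*β).factorial = g at *
  have h3 : c2 * ((2*β+2)*(2*β+1)*((5*β+5)*(5*β+4)*(5*β+3)*(5*β+2)*(5*β+1))) =
     c1 * ((7*β+7)*(7*β+6)*(7*β+5)*(7*β+4)*(7*β+3)*(7*β+2)*(7*β+1)) := by
    have : (f * g) * (c2 * ((2*β+2)*(2*β+1)*((5*β+5)*(5*β+4)*(5*β+3)*(5*β+2)*(5*β+1)))) =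
      (f * g) * (c1 * ((7*β+7)*(7*β+6)*(7*β+5)*(7*β+4)*(7*β+3)*(7*β+2)*(7*β+1))) := by
      linarith [h2]
    exact Nat.eq_of_mul_eq_mul_left (Nat.mul_pos f1 f2) this
  have h4 : 36 * ((2*β+2)*(2*β+1)*((5*β+5)*(5*β+4)*(5*β+3)*(5*β+2)*(5*β+1))) ≤
      ((7*β+7)*(7*β+6)*(7*β+5)*(7*β+4)*(7*β+3)*(7*β+2)*(7*β+1)) := by
    obtain ⟨x, rfl⟩ : ∃ x, β = x + 1 := ⟨β - 1, by omega⟩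
    rw [← Nat.sub_eq_zero_iff_le]
    ring_nf
    omega
  have h5 : 0 < (2*β+2)*(2*β+1)*((5*β+5)*(5*β+4)*(5*β+3)*(5*β+2)*(5*β+1)) := by positivity
  have h6 : (36 * c1) * ((2*β+2)*(2*β+1)*((5*β+5)*(5*β+4)*(5*β+3)*(5*β+2)*(5*β+1))) ≤
      c2 * ((2*β+2)*(2*β+1)*((5*β+5)*(5*β+4)*(5*β+3)*(5*β+2)*(5*β+1))) := by
    rw [h3]; calc _ = c1 * (36 * ((2*β+2)*(2*β+1)*((5*β+5)*(5*β+4)*(5*β+3)*(5*β+2)*(5*β+1)))) := by ring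
      _ ≤ _ := Nat.mul_le_mul le_rfl h4
  exact Nat.le_of_mul_le_mul_right h6 h5

lemma asym (β : ℕ) (hβ : 15 ≤ β) :
    2^(10*β+28) * (10*β^2+6*β+1)^3 < 1250 * (10*β)^4 * ((7*β).choose (2*β))^2 := by
  induction β, hβ using Nat.le_induction with
  | base => decide +kernel
  | succ β hβ ih =>
    have h1 := choose_step β (by omega)
    have h2 : 1024 * ((10*(β+1)^2+6*(β+1)+1)^3 * β^4) ≤ 1296 * ((10*β^2+6*β+1)^3 * (β+1)^4) := by
      obtain ⟨x, rfl⟩ : ∃ x, β = x + 15 := ⟨β - 15, by omega⟩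
      rw [← Nat.sub_eq_zero_iff_le]
      ring_nf
      omega
    have h3 : 1296 * ((7*β).choose (2*β))^2 ≤ ((7*(β+1)).choose (2*(β+1)))^2 := by
      calc _ = (36 * (7*β).choose (2*β))^2 := by ring
        _ ≤ _ := Nat.pow_le_pow_left h1 2
    generalize (7*β).choose (2*β) = c1 at *
    generalize (7*(β+1)).choose (2*(β+1)) = c2 at *
    have hp : 0 < β^4 := by positivity
    have hq : 0 < (β+1)^4 := by positivity
    apply Nat.lt_of_mul_lt_mul_right (a := β^4)
    calc 2^(10*(β+1)+28) * (10*(β+1)^2+6*(β+1)+1)^3 * β^4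
        = 2^(10*β+28) * (1024 * ((10*(β+1)^2+6*(β+1)+1)^3 * β^4)) := by
          rw [show 10*(β+1)+28 = (10*β+28)+10 by ring, pow_add]; ring
      _ ≤ 2^(10*β+28) * (1296 * ((10*β^2+6*β+1)^3 * (β+1)^4)) := Nat.mul_le_mul le_rfl h2
      _ = (1296 * (β+1)^4) * (2^(10*β+28) * (10*β^2+6*β+1)^3) := by ring
      _ < (1296 * (β+1)^4) * (1250 * (10*β)^4 * c1^2) := Nat.mul_lt_mul_of_pos_left ih (by positivity)
      _ = (1250 * (10*β)^4 * (β+1)^4) * (1296 * c1^2) := by ring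
      _ ≤ (1250 * (10*β)^4 * (β+1)^4) * c2^2 := Nat.mul_le_mul le_rfl h3
      _ = _ := by ring

def PartE : Prop := ∀ b c : ℕ, 1 ≤ b → 1 ≤ c →
  ((b+4*c).choose b)^2 ≤ 2 * (b*(4*c)+1)^3 * d (5*b) (8*c+4) (5*b*(4*c+2))

lemma star_hi (hE : PartE) (n m k : ℕ) (hn' : 168 ≤ n) (hm : n ≤ m) (hk : (n-1)^2 < 2 * k)
    (hk' : 2 * k ≤ n * m) : 2^n < 1250 * (n-1)^4 * d n m k := by
  obtain ⟨β, hβ⟩ : ∃ β, β = (n-18)/10 := ⟨_, rfl⟩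
  obtain ⟨c, hc⟩ : ∃ c, c = (5*β+3)/4 := ⟨_, rfl⟩
  have b1 : 10 * β + 18 ≤ n := by omega
  have b2 : n ≤ 10 * β + 27 := by omega
  have c1 : 5 * β ≤ 4 * c := by omega
  have c2 : 4 * c ≤ 5 * β + 3 := by omega
  have hβ' : 15 ≤ β := by omega
  have h0 := hE (2*β) c (by omega) (by omega)
  have h1 := reduce n m k (5*(2*β)) (8*c+4) (5*(2*β)*(4*c+2)) ⟨5*β, by ring⟩ (by ring) (by omega) (by omega)
    (by omega) (by omega) (K_lt n k (5*(2*β)) (8*c+4) _ (by omega) hk (by ring) (by omega) (by omega)) hk'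
  have h2 := asym β hβ'
  have h3 : (7*β).choose (2*β) ≤ (2*β+4*c).choose (2*β) := Nat.choose_le_choose _ (by omega)
  have h4 : 2*β*(4*c)+1 ≤ 10*β^2+6*β+1 := by nlinarith
  have hw0 : 0 < 10*β^2+6*β+1 := by positivity
  generalize d n m k = v at *
  generalize d (5*(2*β)) (8*c+4) (5*(2*β)*(4*c+2)) = u at *
  generalize (7*β).choose (2*β) = x at *
  generalize (2*β+4*c).choose (2*β) = y at *
  generalize 2*β*(4*c)+1 = z at *
  generalize 10*β^2+6*β+1 = w at *
  have hw : 0 < 2 * w^3 := by positivity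
  apply Nat.lt_of_mul_lt_mul_right (a := 2 * w^3)
  calc 2^n * (2 * w^3) ≤ 2^(10*β+27) * (2*w^3) :=
        Nat.mul_le_mul (Nat.pow_le_pow_right (by norm_num) b2) le_rfl
    _ = 2^(10*β+28) * w^3 := by rw [show 10*β+28 = 10*β+27+1 by ring, pow_succ]; ring
    _ < 1250 * (10*β)^4 * x^2 := h2
    _ ≤ 1250 * (10*β)^4 * (2 * z^3 * u) := Nat.mul_le_mul le_rfl ((Nat.pow_le_pow_left h3 2).trans h0)
    _ ≤ 1250 * (n-1)^4 * (2 * w^3 * v) := by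
      apply Nat.mul_le_mul (Nat.mul_le_mul le_rfl (Nat.pow_le_pow_left (by omega) 4))
      exact Nat.mul_le_mul (Nat.mul_le_mul le_rfl (Nat.pow_le_pow_left h4 3)) h1
    _ = _ := by ring

lemma small_n : allb 28 (fun i => Nat.blt (2^(i+2)) (1250 * (i+1)^4) && (Nat.ble 24 i || Nat.blt (2^(i+2)) (250 * (i+1)^4))) = true := by
  decide +kernel

lemma final (hE : PartE) (l m k : ℕ) (hl : 8 ≤ l) (hlm : l ≤ m) (hk2 : 2 ≤ k) (hk : 2 * k ≤ l * m) :
    (p k l m : ℝ) - p (k - 1) l m >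
      0.004 * 2 ^ Real.sqrt (min (2 * (k : ℝ)) ((l : ℝ) ^ 2)) /
        (min (2 * (k : ℝ)) ((l : ℝ) ^ 2)) ^ ((9 : ℝ) / 4) := by
  have hd : (p k l m : ℝ) - p (k - 1) l m = d l m k := by
    have := d_eq l m (k-1) (by omega)
    rw [show k - 1 + 1 = k by omega] at this
    rw [p_eq, p_eq, ← this]; push_cast; ring
  rw [hd]
  have hd1 : 1 ≤ d l m k := d_pos l m k hl (by omega) (by omega) hk
  obtain ⟨s, hs⟩ : ∃ s : ℕ, s = min (2*k) (l^2) := ⟨_, rfl⟩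
  have hsR : min (2 * (k : ℝ)) ((l : ℝ) ^ 2) = (s : ℝ) := by rw [hs]; push_cast; rfl
  rw [hsR]
  have hs4 : 4 ≤ s := by rw [hs]; apply le_min; omega; nlinarith
  -- choose n
  have hn : ∃ n, 2 ≤ n ∧ (n-1)^2 < s ∧ s ≤ n^2 ∧ (30 ≤ n → 2^n < 1250 * (n-1)^4 * d l m k) := by
    have star : ∀ n m k, 30 ≤ n → n ≤ m → (n-1)^2 < 2 * k → 2 * k ≤ n * m → 2^n < 1250 * (n-1)^4 * d n m k := by
      intro n m k h1 h2 h3 h4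
      rcases lt_or_ge n 168 with h | h
      · exact star_lo n m k h1 h h2 h3 h4
      · exact star_hi hE n m k h h2 h3 h4
    rcases le_or_gt (l^2) (2*k) with h | h
    · have hsl : s = l^2 := by omega
      have hlt : (l-1)^2 < l^2 := Nat.pow_lt_pow_left (by omega) (by norm_num)
      exact ⟨l, by omega, by omega, by omega, fun h30 => star l m k h30 hlm (by omega) hk⟩
    · have hsl : s = 2*k := by omega
      obtain ⟨r, hr⟩ : ∃ r, r = Nat.sqrt (s-1) := ⟨_, rfl⟩
      have r1 : r^2 ≤ s - 1 := by rw [hr]; exact Nat.sqrt_le' _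
      have r2 : s - 1 < (r+1)^2 := by rw [hr]; exact Nat.lt_succ_sqrt' _
      have hr1 : 1 ≤ r := by
        by_contra h; have : r = 0 := by omega
        subst this; omega
      have hrl : r + 1 ≤ l := by
        by_contra h'
        have : l^2 ≤ r^2 := Nat.pow_le_pow_left (by omega) 2
        omega
      refine ⟨r+1, by omega, by simp only [Nat.add_sub_cancel]; omega, by omega, fun h30 => ?_⟩
      have hkk : 2 * k ≤ (r+1)*(r+1) := by rw [← sq]; omega
      have hst := star (r+1) (r+1) k h30 le_rfl (by simp only [Nat.add_sub_cancel]; omega) hkk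
      refine hst.trans_le (Nat.mul_le_mul le_rfl ?_)
      obtain ⟨l2, rfl⟩ : ∃ l2, l = (r+1)+l2 := ⟨l-(r+1), by omega⟩
      obtain ⟨m2, rfl⟩ : ∃ m2, m = (r+1)+m2 := ⟨m-(r+1), by omega⟩
      calc d (r+1) (r+1) k ≤ d (r+1) ((r+1)+m2) (k+0) :=
            d_mul' _ _ _ _ _ (by rw [d_zero]) hkk (by omega)
        _ ≤ d ((r+1)+l2) ((r+1)+m2) (k+0+0) := d_mul _ _ _ _ _ (by rw [d_zero])
  obtain ⟨n, hn2, hn1, hns, hst⟩ := hn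
  obtain ⟨a, rfl⟩ : ∃ a, n = a + 1 := ⟨n-1, by omega⟩
  simp only [Nat.add_sub_cancel] at *
  have ha : 1 ≤ a := by omega
  have haR : (1:ℝ) ≤ a := by exact_mod_cast ha
  have hnum : (2:ℝ) ^ Real.sqrt s ≤ 2^(a+1) := by
    rw [← Real.rpow_natCast 2 (a+1)]
    apply Real.rpow_le_rpow_of_exponent_le (by norm_num)
    apply Real.sqrt_le_iff.2
    exact ⟨by positivity, by exact_mod_cast hns⟩
  have hden : (a:ℝ)^4 * Real.sqrt a ≤ (s:ℝ)^((9:ℝ)/4) := by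
    have e1 : (a:ℝ)^4 * Real.sqrt a = ((a:ℝ)^2)^((9:ℝ)/4) := by
      rw [← Real.rpow_natCast (a:ℝ) 2, ← Real.rpow_mul (by positivity), Real.sqrt_eq_rpow,
        ← Real.rpow_natCast (a:ℝ) 4, ← Real.rpow_add (by positivity)]
      norm_num
    rw [e1]
    apply Real.rpow_le_rpow (by positivity) _ (by norm_num)
    exact_mod_cast hn1.le
  have hsq : 0 < Real.sqrt a := Real.sqrt_pos.2 (by linarith)
  have hpos : 0 < (s:ℝ)^((9:ℝ)/4) := lt_of_lt_of_le (by positivity) hden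
  rw [gt_iff_lt, div_lt_iff₀ hpos]
  have hdR : (1:ℝ) ≤ d l m k := by exact_mod_cast hd1
  have goal2 : (2:ℝ)^(a+1) < 250 * ((d l m k : ℝ) * ((a:ℝ)^4 * Real.sqrt a)) := by
    have hs1 : 1 ≤ Real.sqrt a := by rw [Real.one_le_sqrt]; exact haR
    by_cases h25 : a ≤ 24
    · have h := allb_spec _ _ small_n (a-1) (by omega)
      rw [show a - 1 + 2 = a + 1 by omega, show a - 1 + 1 = a by omega] at h
      have h' : 2^(a+1) < 250 * a^4 := by
        simp only [Bool.and_eq_true, Bool.or_eq_true, Nat.blt_eq, Nat.ble_eq] at h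
        omega
      have h'' : (2:ℝ)^(a+1) < 250 * (a:ℝ)^4 := by exact_mod_cast h'
      have h4 : (a:ℝ)^4 ≤ (d l m k : ℝ) * ((a:ℝ)^4 * Real.sqrt a) := by
        calc (a:ℝ)^4 = 1 * ((a:ℝ)^4 * 1) := by ring
          _ ≤ _ := by gcongr
      linarith
    · have h5 : 5 ≤ Real.sqrt a := by
        apply Real.le_sqrt_of_sq_le
        have : (25:ℝ) ≤ a := by exact_mod_cast (by omega : 25 ≤ a)
        linarith
      have h' : 2^(a+1) < 1250 * a^4 * d l m k := by
        by_cases h30 : 30 ≤ a + 1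
        · exact hst h30
        · have h := allb_spec _ _ small_n (a-1) (by omega)
          rw [show a - 1 + 2 = a + 1 by omega, show a - 1 + 1 = a by omega] at h
          simp only [Bool.and_eq_true, Nat.blt_eq] at h
          calc 2^(a+1) < 1250 * a^4 * 1 := by omega
            _ ≤ _ := Nat.mul_le_mul le_rfl hd1
      have h'' : (2:ℝ)^(a+1) < 1250 * (a:ℝ)^4 * d l m k := by exact_mod_cast h'
      calc (2:ℝ)^(a+1) < 1250 * (a:ℝ)^4 * d l m k := h''
        _ = 250 * ((d l m k : ℝ) * ((a:ℝ)^4 * 5)) := by ring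
        _ ≤ _ := by gcongr
  calc 0.004 * (2:ℝ) ^ Real.sqrt s ≤ 0.004 * 2^(a+1) := by gcongr
    _ < (d l m k : ℝ) * ((a:ℝ)^4 * Real.sqrt a) := by linarith
    _ ≤ _ := by gcongr

end PP

namespace PP
open MvPolynomial Finset

/-- transvectant type sums -/
noncomputable def T (y z : ℕ → S) (n α β : ℕ) : S :=
  ∑ ij ∈ antidiagonal n, ((-1 : ℚ)^ij.1 * (n.choose ij.1 : ℚ)) • (y (ij.1+α) * z (ij.2+β))

lemma T_D (y z : ℕ → S) (n α β M N : ℕ) (hy : ∀ i ≤ M, D (y i) = (i : ℚ) • y (i-1))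
    (hz : ∀ i ≤ N, D (z i) = (i : ℚ) • z (i-1)) (hM : n + α ≤ M) (hN : n + β ≤ N) :
    D (T y z n α β) = (α : ℚ) • T y z n (α-1) β + (β : ℚ) • T y z n α (β-1) := by
  have tele : ∑ ij ∈ antidiagonal n, ((-1 : ℚ)^ij.1 * (n.choose ij.1 : ℚ)) •
      ((ij.1 : ℚ) • (y (ij.1+α-1) * z (ij.2+β)) + (ij.2 : ℚ) • (y (ij.1+α) * z (ij.2+β-1))) = 0 := by
    rcases n with _ | n
    · simp
    · simp only [smul_add, sum_add_distrib]
      rw [Nat.sum_antidiagonal_succ, Nat.sum_antidiagonal_succ']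
      simp only [Nat.cast_zero, zero_smul, smul_zero, zero_add, add_zero]
      rw [← sum_add_distrib]
      apply sum_eq_zero
      rintro ⟨i, j⟩ hij
      rw [HasAntidiagonal.mem_antidiagonal] at hij
      simp only at hij ⊢
      rw [show i + 1 + α - 1 = i + α by omega, show j + 1 + β - 1 = j + β by omega, smul_smul, smul_smul,
        ← add_smul]
      have e1 : ((n+1).choose (i+1) : ℚ) * (i+1 : ℕ) = (n+1 : ℕ) * (n.choose i : ℚ) := by
        exact_mod_cast (Nat.add_one_mul_choose_eq n i).symm
      have e2 : ((n+1).choose i : ℚ) * (j+1 : ℕ) = (n+1 : ℕ) * (n.choose i : ℚ) := by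
        have := Nat.choose_mul_succ_eq n i
        rw [show n + 1 - i = j + 1 by omega] at this
        have h : (n+1).choose i * (j+1) = (n+1) * n.choose i := by rw [← this]; ring
        exact_mod_cast h
      have : ((-1 : ℚ) ^ (i + 1) * ((n + 1).choose (i + 1)) * ((i + 1 : ℕ) : ℚ) +
        (-1) ^ i * ((n + 1).choose i) * ((j + 1 : ℕ) : ℚ)) = 0 := by
        rw [mul_assoc, mul_assoc, e1, e2, pow_succ]; ring
      rw [this, zero_smul]
  have expand : D (T y z n α β) = ∑ ij ∈ antidiagonal n, ((-1 : ℚ)^ij.1 * (n.choose ij.1 : ℚ)) •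
      ((ij.1 : ℚ) • (y (ij.1+α-1) * z (ij.2+β)) + (ij.2 : ℚ) • (y (ij.1+α) * z (ij.2+β-1)))
      + ((α : ℚ) • T y z n (α-1) β + (β : ℚ) • T y z n α (β-1)) := by
    unfold T
    rw [map_sum, smul_sum, smul_sum, ← sum_add_distrib, ← sum_add_distrib]
    apply sum_congr rfl
    rintro ⟨i, j⟩ hij
    rw [HasAntidiagonal.mem_antidiagonal] at hij
    simp only at hij ⊢
    rw [Derivation.map_smul, Derivation.leibniz, hy _ (by omega), hz _ (by omega)]
    have a1 : (α : ℚ) • y (i + (α - 1)) = (α : ℚ) • y (i + α - 1) := by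
      rcases α with _ | α
      · simp
      · rfl
    have b1 : (β : ℚ) • z (j + (β - 1)) = (β : ℚ) • z (j + β - 1) := by
      rcases β with _ | β
      · simp
      · rfl
    rw [smul_comm (α : ℚ), smul_comm (β : ℚ), ← smul_mul_assoc (α : ℚ), a1, ← mul_smul_comm (β : ℚ), b1, ← smul_add, ← smul_add]
    congr 1
    simp only [smul_eq_mul, Algebra.smul_def]
    push_cast
    ring
  rw [expand, tele, zero_add]

lemma T_mem (y z : ℕ → S) (n α β l1 l2 m k1 k2 : ℕ) (hy : ∀ i ≤ n, y (i+α) ∈ R l1 m (k1+i))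
    (hz : ∀ i ≤ n, z (i+β) ∈ R l2 m (k2+i)) : T y z n α β ∈ R (l1+l2) m (k1+k2+n) := by
  apply Submodule.sum_mem
  rintro ⟨i, j⟩ hij
  rw [HasAntidiagonal.mem_antidiagonal] at hij
  simp only at hij
  apply Submodule.smul_mem
  have := R_mul l1 l2 m _ _ _ _ (hy i (by omega)) (hz j (by omega))
  rwa [show k1 + i + (k2 + j) = k1 + k2 + n by omega] at this

lemma X_mem (m i : ℕ) (h : i ≤ m) : (X i : S) ∈ R 1 m i := by
  unfold R
  rw [X, monomial_mem_restrictSupport]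
  left
  refine ⟨by simp, by rw [wt_single]; simp, ?_⟩
  intro j hj
  have := Finsupp.support_single_subset hj
  rw [mem_singleton] at this; omega

/-- unnormalised quadratic string -/
noncomputable def Q0 (a n p : ℕ) : S :=
  ∑ uv ∈ antidiagonal p, ((a.choose uv.1 : ℚ) * (a.choose uv.2 : ℚ)) • T X X n uv.1 uv.2

noncomputable def Q (a n p : ℕ) : S := ((p.factorial : ℚ) * ((2*a-p).factorial : ℚ)) • Q0 a n p

lemma Q0_D (a n p : ℕ) : D (Q0 a n (p+1)) = ((2*a : ℚ) - p) • Q0 a n p := by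
  unfold Q0
  rw [map_sum]
  have : ∀ uv : ℕ × ℕ, D (((a.choose uv.1 : ℚ) * (a.choose uv.2 : ℚ)) • T X X n uv.1 uv.2) =
      ((uv.1 : ℚ) * (a.choose uv.1 : ℚ) * (a.choose uv.2 : ℚ)) • T X X n (uv.1-1) uv.2 +
      ((uv.2 : ℚ) * (a.choose uv.1 : ℚ) * (a.choose uv.2 : ℚ)) • T X X n uv.1 (uv.2-1) := by
    rintro ⟨u, v⟩
    rw [Derivation.map_smul, T_D X X n u v (n+u) (n+v) (fun i _ => D_X i) (fun i _ => D_X i) le_rfl le_rfl,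
      smul_add, smul_smul, smul_smul]
    congr 2 <;> ring
  rw [sum_congr rfl (fun uv _ => this uv), sum_add_distrib, Nat.sum_antidiagonal_succ, Nat.sum_antidiagonal_succ']
  simp only [Nat.cast_zero, zero_mul, zero_smul, zero_add, add_zero, Nat.add_sub_cancel]
  rw [← sum_add_distrib, smul_sum]
  apply sum_congr rfl
  rintro ⟨u, v⟩ huv
  rw [HasAntidiagonal.mem_antidiagonal] at huv
  simp only at huv ⊢
  rw [← add_smul, smul_smul]
  congr 1
  have key : ∀ u : ℕ, ((u+1 : ℕ) : ℚ) * (a.choose (u+1) : ℚ) = ((a : ℚ) - u) * a.choose u := by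
    intro u
    by_cases h : u ≤ a
    · have := Nat.choose_succ_right_eq a u
      rw [mul_comm] at this
      have h2 : (((u+1) * a.choose (u+1) : ℕ) : ℚ) = (a.choose u * (a - u) : ℕ) := by exact_mod_cast this
      push_cast [Nat.cast_sub h] at h2 ⊢
      linarith
    · rw [Nat.choose_eq_zero_of_lt (by omega), Nat.choose_eq_zero_of_lt (by omega)]; simp
  rw [key u, mul_right_comm ((v+1 : ℕ) : ℚ), key v, ← huv]
  push_cast
  ring

lemma Q0_zero (a n : ℕ) : D (Q0 a n 0) = 0 := by
  unfold Q0
  simp only [Nat.antidiagonal_zero, sum_singleton]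
  rw [Derivation.map_smul, T_D X X n 0 0 n n (fun i _ => D_X i) (fun i _ => D_X i) le_rfl le_rfl]
  simp

lemma Q_D (a n p : ℕ) (hp : p ≤ 2 * a) : D (Q a n p) = (p : ℚ) • Q a n (p-1) := by
  unfold Q
  rcases p with _ | p
  · rw [Derivation.map_smul, Q0_zero]; simp
  · rw [Derivation.map_smul, Q0_D, smul_smul, Nat.add_sub_cancel, smul_smul]
    congr 1
    obtain ⟨r, hr⟩ : ∃ r, 2 * a = p + 1 + r := ⟨2*a-(p+1), by omega⟩
    have hr' : (2 * (a : ℚ)) = p + 1 + r := by exact_mod_cast hr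
    rw [show 2*a - (p+1) = r by omega, show 2 * a - p = r + 1 by omega, hr', Nat.factorial_succ, Nat.factorial_succ]
    push_cast; ring

lemma Q_mem (a n p : ℕ) : Q a n p ∈ R 2 (n+a) (n+p) := by
  unfold Q Q0
  apply Submodule.smul_mem
  apply Submodule.sum_mem
  rintro ⟨u, v⟩ huv
  rw [HasAntidiagonal.mem_antidiagonal] at huv
  simp only at huv ⊢
  by_cases hu : a < u
  · rw [Nat.choose_eq_zero_of_lt hu]; simp
  by_cases hv : a < v
  · rw [Nat.choose_eq_zero_of_lt hv]; simp
  apply Submodule.smul_mem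
  have := T_mem X X n u v 1 1 (n+a) u v (fun i hi => by rw [add_comm u i]; exact X_mem _ _ (by omega))
    (fun i hi => by rw [add_comm v i]; exact X_mem _ _ (by omega))
  rwa [show u + v + n = n + p by omega] at this

/-- cubic string -/
noncomputable def H (a n p : ℕ) : S := T (Q a n) X (2*a) 0 p

lemma H_D (a n p : ℕ) : D (H a n p) = (p : ℚ) • H a n (p-1) := by
  unfold H
  rw [T_D (Q a n) X (2*a) 0 p (2*a) (2*a+p) (fun i hi => Q_D a n i hi) (fun i _ => D_X i) le_rfl le_rfl]
  simp

lemma H_mem (a n p : ℕ) (hp : p + 2 * a ≤ n + a) : H a n p ∈ R 3 (n+a) (n+p+2*a) := by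
  apply T_mem (Q a n) X (2*a) 0 p 2 1 (n+a) n p
  · intro i hi; exact Q_mem a n i
  · intro i hi; rw [add_comm p i]; exact X_mem _ _ (by omega)

end PP

namespace PP
open MvPolynomial Finset

noncomputable def om : (ℕ →₀ ℕ) →+ ℕ := Finsupp.weight (fun i : ℕ => i * i)

lemma om_single (i : ℕ) : om (Finsupp.single i 1) = i * i := by
  unfold om; rw [Finsupp.weight_single]; simp

def Lead (f : S) (μ : ℕ →₀ ℕ) : Prop :=
  0 < coeff μ f ∧ ∀ x, coeff x f ≠ 0 → x ≠ μ → om x < om μ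

lemma Lead_one : Lead 1 0 := by
  refine ⟨by simp, ?_⟩
  intro x hx hne
  rw [coeff_one] at hx
  simp [hne.symm] at hx

lemma Lead_mul (f g : S) (μ ν : ℕ →₀ ℕ) (hf : Lead f μ) (hg : Lead g ν) : Lead (f * g) (μ + ν) := by
  classical
  constructor
  · rw [coeff_mul, sum_eq_single (μ, ν)]
    · exact mul_pos hf.1 hg.1
    · rintro ⟨x, y⟩ hxy hne
      rw [HasAntidiagonal.mem_antidiagonal] at hxy
      simp only at hxy ⊢
      by_contra hc
      have h1 := left_ne_zero_of_mul hc
      have h2 := right_ne_zero_of_mul hc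
      have e := congrArg om hxy
      rw [map_add, map_add] at e
      by_cases hx : x = μ
      · subst hx
        have hy : y = ν := add_left_cancel hxy
        exact hne (by rw [hy])
      · have h3 := hf.2 x h1 hx
        by_cases hy : y = ν
        · subst hy; omega
        · have h4 := hg.2 y h2 hy
          omega
    · intro h; exfalso; apply h; rw [HasAntidiagonal.mem_antidiagonal]
  · intro z hz hne
    rw [coeff_mul] at hz
    obtain ⟨⟨x, y⟩, hxy, hc⟩ := exists_ne_zero_of_sum_ne_zero hz
    rw [HasAntidiagonal.mem_antidiagonal] at hxy
    simp only at hxy hc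
    have h1 := left_ne_zero_of_mul hc
    have h2 := right_ne_zero_of_mul hc
    subst hxy
    rw [map_add, map_add]
    by_cases hx : x = μ
    · subst hx
      have hy : y ≠ ν := fun h => hne (by rw [h])
      have := hg.2 y h2 hy
      omega
    · have h3 := hf.2 x h1 hx
      by_cases hy : y = ν
      · subst hy; omega
      · have h4 := hg.2 y h2 hy
        omega

lemma Lead_pow (f : S) (μ : ℕ →₀ ℕ) (hf : Lead f μ) (n : ℕ) : Lead (f ^ n) (n • μ) := by
  induction n with
  | zero => rw [pow_zero, zero_smul]; exact Lead_one
  | succ n ih => rw [pow_succ, succ_nsmul]; exact Lead_mul _ _ _ _ ih hf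

lemma Lead_prod {ι : Type*} (s : Finset ι) (f : ι → S) (μ : ι → ℕ →₀ ℕ) (h : ∀ i ∈ s, Lead (f i) (μ i)) :
    Lead (∏ i ∈ s, f i) (∑ i ∈ s, μ i) := by
  classical
  induction s using Finset.induction_on with
  | empty => simpa using Lead_one
  | insert a s ha ih =>
    rw [prod_insert ha, sum_insert ha]
    exact Lead_mul _ _ _ _ (h a (mem_insert_self _ _)) (ih fun i hi => h i (mem_insert_of_mem hi))

lemma Lead_li {ι : Type*} (f : ι → S) (μ : ι → ℕ →₀ ℕ) (h : ∀ i, Lead (f i) (μ i)) (hi : Function.Injective μ) :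
    LinearIndependent ℚ f := by
  classical
  rw [linearIndependent_iff']
  intro s g hg i his
  by_contra hne
  obtain ⟨j, hj, hmax⟩ := exists_max_image (s.filter (fun i => g i ≠ 0)) (fun i => om (μ i))
    ⟨i, mem_filter.2 ⟨his, hne⟩⟩
  rw [mem_filter] at hj
  have hc := congrArg (coeff (μ j)) hg
  rw [coeff_sum, sum_eq_single j, coeff_smul, coeff_zero, smul_eq_mul] at hc
  · exact mul_ne_zero hj.2 (h j).1.ne' hc
  · intro b hb hbj
    rw [coeff_smul, smul_eq_mul]
    by_contra hc
    have h1 := left_ne_zero_of_mul hc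
    have h2 := right_ne_zero_of_mul hc
    have h3 := (h b).2 _ h2 (fun e => hbj (hi e).symm)
    have h4 := hmax b (mem_filter.2 ⟨hb, h1⟩)
    omega
  · intro h; exact absurd hj.1 h

lemma Ms_peel (l m k : ℕ) (x : ℕ →₀ ℕ) (hx : x ∈ Ms (l+1) m k) :
    ∃ a y, x = y + Finsupp.single a 1 ∧ a ≤ m ∧ a ≤ k ∧ y ∈ Ms l m (k - a) := by
  obtain ⟨h1, h2, h3⟩ := hx
  have hne : x ≠ 0 := by rintro rfl; simp at h1
  obtain ⟨a, ha⟩ := Finsupp.support_nonempty_iff.2 hne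
  have hle : Finsupp.single a 1 ≤ x := by
    rw [Finsupp.single_le_iff]; have := Finsupp.mem_support_iff.1 ha; omega
  have e := tsub_add_cancel_of_le hle
  have e1 := congrArg Finsupp.degree e
  have e2 := congrArg wt e
  rw [map_add, Finsupp.degree_single] at e1
  rw [map_add, wt_single] at e2
  refine ⟨a, x - Finsupp.single a 1, e.symm, h3 a ha, by omega, by omega, by omega, ?_⟩
  intro i hi
  apply h3
  rw [Finsupp.mem_support_iff] at hi ⊢
  intro h0
  apply hi
  simp [h0]

lemma Ms_zero (m k : ℕ) (x : ℕ →₀ ℕ) (hx : x ∈ Ms 0 m k) : x = 0 ∧ k = 0 := by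
  obtain ⟨h1, h2, h3⟩ := hx
  rw [Finsupp.degree_eq_zero_iff] at h1
  subst h1
  simp at h2; exact ⟨rfl, h2.symm⟩

lemma Ms_two (m k : ℕ) (x : ℕ →₀ ℕ) (hx : x ∈ Ms 2 m k) :
    ∃ a b, x = Finsupp.single a 1 + Finsupp.single b 1 ∧ a ≤ m ∧ b ≤ m ∧ a + b = k := by
  obtain ⟨a, y, rfl, h1, h2, hy⟩ := Ms_peel _ _ _ _ hx
  obtain ⟨b, z, rfl, h3, h4, hz⟩ := Ms_peel _ _ _ _ hy
  obtain ⟨rfl, h0⟩ := Ms_zero _ _ _ hz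
  exact ⟨b, a, by rw [zero_add], h3, h1, by omega⟩

lemma Ms_three (m k : ℕ) (x : ℕ →₀ ℕ) (hx : x ∈ Ms 3 m k) :
    ∃ a b c, x = Finsupp.single a 1 + Finsupp.single b 1 + Finsupp.single c 1 ∧
      a ≤ m ∧ b ≤ m ∧ c ≤ m ∧ a + b + c = k := by
  obtain ⟨a, y, rfl, h1, h2, hy⟩ := Ms_peel _ _ _ _ hx
  obtain ⟨b, c, rfl, h3, h4, h5⟩ := Ms_two _ _ _ hy
  exact ⟨b, c, a, rfl, h3, h4, h1, by omega⟩

noncomputable def qlam (a n p : ℕ) : ℕ →₀ ℕ := Finsupp.single (p-a) 1 + Finsupp.single (n + min p a) 1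

lemma coeff_mem (f : S) (l m k : ℕ) (hf : f ∈ R l m k) (x : ℕ →₀ ℕ) (hx : coeff x f ≠ 0) : x ∈ Ms l m k := by
  unfold R at hf
  rw [mem_restrictSupport_iff] at hf
  exact hf (mem_support_iff.2 hx)

lemma pair_dom (a n p i j : ℕ) (hp : p ≤ 2 * a) (hi : i ≤ n + a) (hj : j ≤ n + a) (h : i + j = n + p) :
    i * i + j * j < (p-a)*(p-a) + (n + min p a) * (n + min p a) ∨
    (i = p - a ∧ j = n + min p a) ∨ (i = n + min p a ∧ j = p - a) := by
  rcases le_total p a with hpa | hpa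
  · rw [min_eq_left hpa, Nat.sub_eq_zero_of_le hpa, ← h]
    rcases Nat.eq_zero_or_pos i with rfl | h1
    · right; left; constructor <;> omega
    rcases Nat.eq_zero_or_pos j with rfl | h2
    · right; right; constructor <;> omega
    left; nlinarith [Nat.mul_pos h1 h2]
  · rw [min_eq_right hpa]
    obtain ⟨q, rfl⟩ : ∃ q, p = a + q := ⟨p - a, by omega⟩
    rw [Nat.add_sub_cancel_left]
    rcases Nat.eq_or_lt_of_le hi with h1 | h1
    · right; right; constructor <;> omega
    rcases Nat.eq_or_lt_of_le hj with h2 | h2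
    · right; left; constructor <;> omega
    left
    obtain ⟨r, hr⟩ : ∃ r, n + a = i + r := ⟨n + a - i, by omega⟩
    have hj' : j = q + r := by omega
    have hrp : 0 < r := by omega
    have : q < i := by omega
    rw [hr, hj']
    nlinarith [Nat.mul_pos hrp (by omega : 0 < i - q), Nat.mul_lt_mul_of_pos_left this hrp]

lemma Q_dom (a n p : ℕ) (hp : p ≤ 2 * a) (x : ℕ →₀ ℕ) (hx : coeff x (Q a n p) ≠ 0) (hne : x ≠ qlam a n p) :
    om x < om (qlam a n p) := by
  obtain ⟨i, j, rfl, hi, hj, h⟩ := Ms_two _ _ _ (coeff_mem _ _ _ _ (Q_mem a n p) x hx)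
  unfold qlam at hne ⊢
  rw [map_add, map_add, om_single, om_single, om_single, om_single]
  rcases pair_dom a n p i j hp hi hj h with h | ⟨rfl, rfl⟩ | ⟨rfl, rfl⟩
  · exact h
  · exact absurd rfl hne
  · exact absurd (add_comm _ _) hne

lemma coeff_XX (i j : ℕ) (x : ℕ →₀ ℕ) : coeff x (X i * X j : S) =
    if Finsupp.single i 1 + Finsupp.single j 1 = x then 1 else 0 := by
  classical
  rw [X, X, monomial_mul, coeff_monomial, one_mul]

lemma Q_pos (a n p : ℕ) (hn : Even n) (hp : p ≤ 2 * a) : 0 < coeff (qlam a n p) (Q a n p) := by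
  unfold Q Q0
  rw [coeff_smul, smul_eq_mul]
  apply mul_pos (by positivity)
  rw [coeff_sum]
  simp only [coeff_smul, smul_eq_mul, T, coeff_sum, coeff_XX]
  have main : ∀ u v i j : ℕ, u ≤ a → v ≤ a → u + v = p → i + j = n →
      0 ≤ ((-1 : ℚ)^i * (n.choose i : ℚ)) *
        (if Finsupp.single (i+u) 1 + Finsupp.single (j+v) 1 = qlam a n p then 1 else 0) := by
    intro u v i j hu hv huv hij
    split_ifs with h
    · have hc : (0 : ℚ) ≤ n.choose i := by positivity
      suffices Even i by rw [this.neg_one_pow]; simpa using hc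
      unfold qlam at h
      rw [Finsupp.single_add_single_eq_single_add_single one_ne_zero one_ne_zero] at h
      have : i = 0 ∨ i = n := by
        rcases h with h | h | h
        · rcases le_total p a with hpa | hpa
          · omega
          · rw [min_eq_right hpa] at h; omega
        · rcases le_total p a with hpa | hpa
          · omega
          · rw [min_eq_right hpa] at h; omega
        · omega
      rcases this with rfl | rfl
      · exact Even.zero
      · exact hn
    · simp
  have main2 : ∀ u v : ℕ, u + v = p → 0 ≤ (a.choose u : ℚ) * (a.choose v : ℚ) *
      ∑ ij ∈ antidiagonal n, ((-1 : ℚ)^ij.1 * (n.choose ij.1 : ℚ)) *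
        (if Finsupp.single (ij.1+u) 1 + Finsupp.single (ij.2+v) 1 = qlam a n p then 1 else 0) := by
    intro u v huv
    by_cases hu : a < u
    · rw [Nat.choose_eq_zero_of_lt hu]; simp
    by_cases hv : a < v
    · rw [Nat.choose_eq_zero_of_lt hv]; simp
    apply mul_nonneg (by positivity)
    apply sum_nonneg
    rintro ⟨i, j⟩ hij
    rw [HasAntidiagonal.mem_antidiagonal] at hij
    exact main u v i j (by omega) (by omega) huv hij
  apply sum_pos'
  · rintro ⟨u, v⟩ huv
    rw [HasAntidiagonal.mem_antidiagonal] at huv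
    exact main2 u v huv
  · refine ⟨(p - a, min p a), ?_, ?_⟩
    · rw [HasAntidiagonal.mem_antidiagonal]
      simp only
      omega
    · simp only
      have c1 : 0 < a.choose (p-a) := Nat.choose_pos (by omega)
      have c2 : 0 < a.choose (min p a) := Nat.choose_pos (by omega)
      apply mul_pos (by positivity)
      apply sum_pos'
      · rintro ⟨i, j⟩ hij
        rw [HasAntidiagonal.mem_antidiagonal] at hij
        exact main _ _ i j (by omega) (by omega) (by omega) hij
      · refine ⟨(0, n), by simp, ?_⟩
        simp [qlam]

lemma Q_lead (a n p : ℕ) (hn : Even n) (hp : p ≤ 2 * a) : Lead (Q a n p) (qlam a n p) :=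
  ⟨Q_pos a n p hn hp, Q_dom a n p hp⟩

end PP

namespace PP
open MvPolynomial Finset

noncomputable def hlam (a n p : ℕ) : ℕ →₀ ℕ :=
  Finsupp.single 0 1 + Finsupp.single (p+a) 1 + Finsupp.single (n+a) 1

lemma triple_dom (m i x y z : ℕ) (hx : x ≤ m) (hy : y ≤ m) (hz : z ≤ m) (him : i ≤ m) (h : x + y + z = m + i) :
    x * x + y * y + z * z < i * i + m * m ∨
    (x = 0 ∧ y = i ∧ z = m) ∨ (x = 0 ∧ y = m ∧ z = i) ∨ (x = i ∧ y = 0 ∧ z = m) ∨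
    (x = i ∧ y = m ∧ z = 0) ∨ (x = m ∧ y = 0 ∧ z = i) ∨ (x = m ∧ y = i ∧ z = 0) := by
  rw [or_iff_not_imp_right]
  intro hn
  zify at hx hy hz him h ⊢
  have hx0 : (0 : ℤ) ≤ x := by positivity
  have hy0 : (0 : ℤ) ≤ y := by positivity
  have hz0 : (0 : ℤ) ≤ z := by positivity
  have hi : (i : ℤ) = x + y + z - m := by linarith
  rcases le_total (x + y) m with hs | hs
  · have hs' : (x : ℤ) + y ≤ m := by exact_mod_cast hs
    have e : (i : ℤ) * i + m * m - (x * x + y * y + z * z) = 2 * (x * y) + 2 * ((m - z) * (m - (x + y))) := by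
      rw [hi]; ring
    have p1 : (0 : ℤ) ≤ x * y := by positivity
    have p2 : (0 : ℤ) ≤ (m - z) * (m - (x + y)) := mul_nonneg (by linarith) (by linarith)
    by_contra hc
    have q1 : (x : ℤ) * y = 0 := by linarith
    have q2 : ((m : ℤ) - z) * (m - (x + y)) = 0 := by linarith
    rw [mul_eq_zero] at q1 q2
    omega
  · have hs' : (m : ℤ) ≤ x + y := by exact_mod_cast hs
    have e : (i : ℤ) * i + m * m - (x * x + y * y + z * z) = 2 * ((m - x) * (m - y)) + 2 * (z * (x + y - m)) := by
      rw [hi]; ring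
    have p1 : (0 : ℤ) ≤ (m - x) * (m - y) := mul_nonneg (by linarith) (by linarith)
    have p2 : (0 : ℤ) ≤ z * (x + y - m) := mul_nonneg (by linarith) (by linarith)
    by_contra hc
    have q1 : ((m : ℤ) - x) * (m - y) = 0 := by linarith
    have q2 : (z : ℤ) * (x + y - m) = 0 := by linarith
    rw [mul_eq_zero] at q1 q2
    omega

lemma H_dom (a n p : ℕ) (hp : p + 2 * a ≤ n + a) (x : ℕ →₀ ℕ) (hx : coeff x (H a n p) ≠ 0)
    (hne : x ≠ hlam a n p) : om x < om (hlam a n p) := by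
  obtain ⟨i, j, k, rfl, hi, hj, hk, h⟩ := Ms_three _ _ _ (coeff_mem _ _ _ _ (H_mem a n p hp) x hx)
  unfold hlam at hne ⊢
  simp only [map_add, om_single]
  rcases triple_dom (n+a) (p+a) i j k hi hj hk (by omega) (by omega) with
    h | ⟨rfl, rfl, rfl⟩ | ⟨rfl, rfl, rfl⟩ | ⟨rfl, rfl, rfl⟩ | ⟨rfl, rfl, rfl⟩ | ⟨rfl, rfl, rfl⟩ | ⟨rfl, rfl, rfl⟩
  · omega
  all_goals exact absurd (by abel) hne

lemma H_pos (a n p : ℕ) (ha : Even a) (hn : n + 4 = 3 * a) (hp : p + 4 ≤ 2 * a) :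
    0 < coeff (hlam a n p) (H a n p) := by
  classical
  have hne : Even n := by
    obtain ⟨r, hr⟩ := ha
    exact ⟨3 * r - 2, by omega⟩
  unfold H T
  simp only [coeff_sum, coeff_smul, smul_eq_mul, coeff_mul_X']
  have key : ∀ k i : ℕ, i ≤ 2 * a → hlam a n p = qlam a n i + Finsupp.single k 1 →
      0 < coeff (hlam a n p - Finsupp.single k 1) (Q a n i) := by
    intro k i hi h
    rw [h, add_tsub_cancel_right]
    exact Q_pos a n i hne hi
  have keya : 0 < coeff (hlam a n p - Finsupp.single (a+p) 1) (Q a n a) := by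
    apply key _ _ (by omega)
    unfold hlam qlam
    rw [Nat.sub_self, min_self, add_comm a p]
    abel
  have supp : ∀ k, k ∈ (hlam a n p).support ↔ k = 0 ∨ k = p + a ∨ k = n + a := by
    intro k
    unfold hlam
    rw [Finsupp.mem_support_iff]
    simp only [Finsupp.add_apply, Finsupp.single_apply]
    split_ifs <;> omega
  apply sum_pos'
  · rintro ⟨i, j⟩ hij
    rw [HasAntidiagonal.mem_antidiagonal] at hij
    simp only at hij ⊢
    split_ifs with hs
    · rw [supp] at hs
      have hc : (0 : ℚ) ≤ (2*a).choose i := by positivity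
      suffices hh : Even i ∧ 0 < coeff (hlam a n p - Finsupp.single (j+p) 1) (Q a n i) by
        rw [hh.1.neg_one_pow, one_mul]; exact mul_nonneg hc hh.2.le
      rcases hs with hs | hs | hs
      · have h1 : j = 0 := by omega
        have h2 : p = 0 := by omega
        have h3 : i = 2 * a := by omega
        subst h1 h2 h3
        refine ⟨even_two_mul a, ?_⟩
        apply key _ _ le_rfl
        unfold hlam qlam
        rw [min_eq_right (by omega), show 2 * a - a = a by omega, zero_add, zero_add]
        abel
      · have h1 : j = a := by omega
        have h2 : i = a := by omega
        rw [h1, h2]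
        exact ⟨ha, keya⟩
      · have h1 : i = 0 := by omega
        subst h1
        refine ⟨Even.zero, ?_⟩
        apply key _ _ (by omega)
        unfold hlam qlam
        rw [hs, Nat.zero_sub, Nat.zero_min, show p + a = n + 0 by omega]
    · simp
  · refine ⟨(a, a), by rw [HasAntidiagonal.mem_antidiagonal]; simp only; omega, ?_⟩
    simp only
    rw [if_pos ((supp _).2 (by omega)), ha.neg_one_pow, one_mul]
    have : 0 < (2*a).choose a := Nat.choose_pos (by omega)
    exact mul_pos (by exact_mod_cast this) keya

lemma H_lead (a n p : ℕ) (ha : Even a) (hn : n + 4 = 3 * a) (hp : p + 4 ≤ 2 * a) :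
    Lead (H a n p) (hlam a n p) :=
  ⟨H_pos a n p ha hn hp, H_dom a n p (by omega)⟩

end PP

namespace PP
open MvPolynomial Finset

lemma phi_mono (y : ℕ → S) (s : ℕ →₀ ℕ) : aeval y (monomial s (1 : ℚ)) = ∏ i ∈ s.support, y i ^ s i := by
  rw [aeval_monomial, map_one, one_mul]; rfl

lemma phi_lead (y : ℕ → S) (μ : ℕ → ℕ →₀ ℕ) (e : ℕ) (h : ∀ i ≤ e, Lead (y i) (μ i)) (s : ℕ →₀ ℕ)
    (hs : ∀ i ∈ s.support, i ≤ e) : Lead (aeval y (monomial s (1 : ℚ))) (∑ i ∈ s.support, s i • μ i) := by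
  rw [phi_mono]
  exact Lead_prod _ _ _ fun i hi => Lead_pow _ _ (h i (hs i hi)) _

lemma phi_D (y : ℕ → S) (e : ℕ) (h : ∀ i ≤ e, D (y i) = (i : ℚ) • y (i-1)) (s : ℕ →₀ ℕ)
    (hs : ∀ i ∈ s.support, i ≤ e) :
    D (aeval y (monomial s (1 : ℚ))) = aeval y (D (monomial s (1 : ℚ))) := by
  have e1 : (monomial s (1 : ℚ) : S) = ∏ i ∈ s.support, (X i : S) ^ s i := by
    rw [monomial_eq]; simp [Finsupp.prod]
  have hm : ∀ f g : S, D (aeval y f) = aeval y (D f) → D (aeval y g) = aeval y (D g) →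
      D (aeval y (f * g)) = aeval y (D (f * g)) := by
    intro f g hf hg
    rw [map_mul, Derivation.leibniz, Derivation.leibniz, hf, hg]
    simp only [smul_eq_mul, map_add, map_mul]
  have h1 : D (aeval y (1 : S)) = aeval y (D (1 : S)) := by simp
  rw [e1]
  apply Finset.prod_induction _ (fun f : S => D (aeval y f) = aeval y (D f)) hm h1
  intro i hi
  have hX : D (aeval y (X i : S)) = aeval y (D (X i : S)) := by
    rw [aeval_X, D_X, map_smul, aeval_X, h i (hs i hi)]
  generalize s i = n
  induction n with
  | zero => simpa using h1
  | succ n ih => rw [pow_succ]; exact hm _ _ ih hX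

lemma one_mem_R (m : ℕ) : (1 : S) ∈ R 0 m 0 := by
  unfold R
  rw [mem_restrictSupport_iff]
  intro x hx
  have : x = 0 := by
    rw [mem_coe, mem_support_iff, coeff_one] at hx
    by_contra h
    exact hx (if_neg (Ne.symm h))
  subst this
  exact ⟨by simp, by simp, by simp⟩

lemma phi_mem (y : ℕ → S) (e r m k0 : ℕ) (h : ∀ i ≤ e, y i ∈ R r m (k0 + i)) :
    ∀ (b w : ℕ) (s : ℕ →₀ ℕ), s ∈ Ms b e w → aeval y (monomial s (1 : ℚ)) ∈ R (r * b) m (k0 * b + w) := by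
  intro b
  induction b with
  | zero =>
    intro w s hs
    obtain ⟨rfl, rfl⟩ := Ms_zero _ _ _ hs
    rw [phi_mono]
    simpa using one_mem_R m
  | succ b ih =>
    intro w s hs
    obtain ⟨a, t, rfl, h1, h2, ht⟩ := Ms_peel _ _ _ _ hs
    have e1 : (monomial (t + Finsupp.single a 1) (1 : ℚ) : S) = monomial t 1 * X a := by
      rw [X, monomial_mul, one_mul]
    rw [e1, map_mul, aeval_X]
    have := R_mul _ _ _ _ _ _ _ (ih _ _ ht) (h a h1)
    rwa [show k0 * b + (w - a) + (k0 + a) = k0 * (b+1) + w by rw [mul_add]; omega,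
      show r * b + r = r * (b+1) by ring] at this

lemma ev_one (s : ℕ →₀ ℕ) (μ : ℕ → ℕ →₀ ℕ) (k i0 : ℕ) (h : ∀ i ∈ s.support, μ i k = if i = i0 then 1 else 0) :
    (∑ i ∈ s.support, s i • μ i) k = s i0 := by
  rw [Finsupp.finsetSum_apply]
  have : ∀ i ∈ s.support, (s i • μ i) k = if i = i0 then s i else 0 := by
    intro i hi
    rw [Finsupp.smul_apply, h i hi]; split_ifs <;> simp
  rw [sum_congr rfl this, sum_ite_eq']
  split_ifs with h0
  · rfl
  · rw [Finsupp.mem_support_iff, not_not] at h0; exact h0.symm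

lemma ev_zero (s : ℕ →₀ ℕ) (μ : ℕ → ℕ →₀ ℕ) (k : ℕ) (h : ∀ i ∈ s.support, μ i k = 0) :
    (∑ i ∈ s.support, s i • μ i) k = 0 := by
  rw [Finsupp.finsetSum_apply]
  apply sum_eq_zero
  intro i hi
  rw [Finsupp.smul_apply, h i hi]; simp

noncomputable def LL (c : ℕ) (st : (ℕ →₀ ℕ) × (ℕ →₀ ℕ)) : ℕ →₀ ℕ :=
  ∑ i ∈ st.1.support, st.1 i • qlam (2*c) (6*c+4) i + ∑ i ∈ st.2.support, st.2 i • hlam (2*c+2) (6*c+2) i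

lemma LL_low (c : ℕ) (s t : ℕ →₀ ℕ) (hs : ∀ i ∈ s.support, i ≤ 4*c) (ht : ∀ i ∈ t.support, i ≤ 4*c)
    (i : ℕ) (hi : i < 2 * c) : LL c (s, t) (6*c+4+i) = s i := by
  unfold LL
  rw [Finsupp.add_apply, ev_one _ _ _ i, ev_zero, add_zero]
  · intro j hj
    have := ht j hj
    unfold hlam
    simp only [Finsupp.add_apply, Finsupp.single_apply]
    split_ifs <;> omega
  · intro j hj
    have := hs j hj
    unfold qlam
    simp only [Finsupp.add_apply, Finsupp.single_apply]
    split_ifs <;> omega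

lemma LL_high (c : ℕ) (s t : ℕ →₀ ℕ) (hs : ∀ i ∈ s.support, i ≤ 4*c) (ht : ∀ i ∈ t.support, i ≤ 4*c)
    (i : ℕ) (hi : 1 ≤ i) (hi2 : i ≤ 2 * c) : LL c (s, t) i = s (i + 2*c) := by
  unfold LL
  rw [Finsupp.add_apply, ev_one _ _ _ (i+2*c), ev_zero, add_zero]
  · intro j hj
    have := ht j hj
    unfold hlam
    simp only [Finsupp.add_apply, Finsupp.single_apply]
    split_ifs <;> omega
  · intro j hj
    have := hs j hj
    unfold qlam
    simp only [Finsupp.add_apply, Finsupp.single_apply]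
    split_ifs <;> omega

lemma LL_t (c : ℕ) (s t : ℕ →₀ ℕ) (hs : ∀ i ∈ s.support, i ≤ 4*c) (ht : ∀ i ∈ t.support, i ≤ 4*c)
    (i : ℕ) (hi2 : i ≤ 4 * c) : LL c (s, t) (i+2*c+2) = t i := by
  unfold LL
  rw [Finsupp.add_apply, ev_zero, ev_one _ _ _ i, zero_add]
  · intro j hj
    have := ht j hj
    unfold hlam
    simp only [Finsupp.add_apply, Finsupp.single_apply]
    split_ifs <;> first | omega | contradiction
  · intro j hj
    have := hs j hj
    unfold qlam
    simp only [Finsupp.add_apply, Finsupp.single_apply]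
    split_ifs <;> omega

lemma LL_inj (c b : ℕ) (s t s' t' : ℕ →₀ ℕ) (hs : ∀ i ∈ s.support, i ≤ 4*c) (ht : ∀ i ∈ t.support, i ≤ 4*c)
    (hs' : ∀ i ∈ s'.support, i ≤ 4*c) (ht' : ∀ i ∈ t'.support, i ≤ 4*c)
    (hb : s.degree = b) (hb' : s'.degree = b) (h : LL c (s, t) = LL c (s', t')) : s = s' ∧ t = t' := by
  have z : ∀ u : ℕ →₀ ℕ, (∀ i ∈ u.support, i ≤ 4*c) → ∀ i, 4 * c < i → u i = 0 := by
    intro u hu i hi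
    by_contra hne
    have := hu i (Finsupp.mem_support_iff.2 hne)
    omega
  have hoff : ∀ i, i ≠ 2 * c → s i = s' i := by
    intro i hne
    by_cases h4 : 4 * c < i
    · rw [z s hs i h4, z s' hs' i h4]
    by_cases h2 : i < 2 * c
    · rw [← LL_low c s t hs ht i h2, ← LL_low c s' t' hs' ht' i h2, h]
    · obtain ⟨j, rfl⟩ : ∃ j, i = j + 2 * c := ⟨i - 2*c, by omega⟩
      rw [← LL_high c s t hs ht j (by omega) (by omega), ← LL_high c s' t' hs' ht' j (by omega) (by omega), h]
  have hadd : s + Finsupp.single (2*c) (s' (2*c)) = s' + Finsupp.single (2*c) (s (2*c)) := by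
    ext i
    by_cases hi : i = 2 * c
    · subst hi; simp [add_comm]
    · simp [Finsupp.single_apply, Ne.symm hi, hoff i hi]
  have hdeg := congrArg Finsupp.degree hadd
  rw [map_add, map_add, Finsupp.degree_single, Finsupp.degree_single, hb, hb'] at hdeg
  constructor
  · ext i
    by_cases hi : i = 2 * c
    · subst hi; omega
    · exact hoff i hi
  · ext i
    by_cases h4 : 4 * c < i
    · rw [z t ht i h4, z t' ht' i h4]
    rw [← LL_t c s t hs ht i (by omega), ← LL_t c s' t' hs' ht' i (by omega), h]

noncomputable def yQ (c : ℕ) : ℕ → S := Q (2*c) (6*c+4)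
noncomputable def yH (c : ℕ) : ℕ → S := H (2*c+2) (6*c+2)

noncomputable def Ph (c : ℕ) (st : (ℕ →₀ ℕ) × (ℕ →₀ ℕ)) : S :=
  aeval (yQ c) (monomial st.1 (1 : ℚ)) * aeval (yH c) (monomial st.2 (1 : ℚ))

lemma Ph_lead (c : ℕ) (s t : ℕ →₀ ℕ) (hs : ∀ i ∈ s.support, i ≤ 4*c) (ht : ∀ i ∈ t.support, i ≤ 4*c) :
    Lead (Ph c (s, t)) (LL c (s, t)) := by
  apply Lead_mul
  · exact phi_lead _ _ (4*c) (fun i hi => Q_lead (2*c) (6*c+4) i ⟨3*c+2, by ring⟩ (by omega)) s hs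
  · exact phi_lead _ _ (4*c) (fun i hi => H_lead (2*c+2) (6*c+2) i ⟨c+1, by ring⟩ (by omega) (by omega)) t ht

def Pset (b e w : ℕ) : Set ((ℕ →₀ ℕ) × (ℕ →₀ ℕ)) :=
  ⋃ ij ∈ antidiagonal w, Ms b e ij.1 ×ˢ Ms b e ij.2

lemma mem_Pset (b e w : ℕ) (st : (ℕ →₀ ℕ) × (ℕ →₀ ℕ)) :
    st ∈ Pset b e w ↔ ∃ i j, i + j = w ∧ st.1 ∈ Ms b e i ∧ st.2 ∈ Ms b e j := by
  unfold Pset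
  simp only [Set.mem_iUnion, Set.mem_prod, exists_prop, Prod.exists, HasAntidiagonal.mem_antidiagonal]

lemma Pset_finite (b e w : ℕ) : (Pset b e w).Finite :=
  Set.Finite.biUnion (finite_toSet _) fun ij _ => (Ms_finite _ _ _).prod (Ms_finite _ _ _)

lemma Pset_ncard (b e w : ℕ) : (Pset b e w).ncard = ∑ ij ∈ antidiagonal w, cnt b e ij.1 * cnt b e ij.2 := by
  classical
  have h1 : Pset b e w = ((antidiagonal w).biUnion fun ij =>
    (Ms_finite b e ij.1).toFinset ×ˢ (Ms_finite b e ij.2).toFinset : Finset _) := by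
    ext st
    rw [mem_Pset, mem_coe, mem_biUnion]
    simp [mem_product]
  rw [h1, Set.ncard_coe_finset, card_biUnion]
  · apply sum_congr rfl
    intro ij _
    rw [card_product, ← Set.ncard_eq_toFinset_card _ (Ms_finite b (e) ij.1), ← Set.ncard_eq_toFinset_card _ (Ms_finite b e ij.2), Ms_ncard, Ms_ncard]
  · rintro ⟨i, j⟩ _ ⟨i', j'⟩ _ hne
    rw [Function.onFun, disjoint_left]
    rintro ⟨s, t⟩ h h'
    simp only [mem_product, Set.Finite.mem_toFinset] at h h'
    apply hne
    rw [← h.1.2.1, ← h'.1.2.1, ← h.2.2.1, ← h'.2.2.1]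

noncomputable def V (b c w : ℕ) : Submodule ℚ S := Submodule.span ℚ (Ph c '' Pset b (4*c) w)

instance fd_V (b c w : ℕ) : FiniteDimensional ℚ (V b c w) :=
  FiniteDimensional.span_of_finite ℚ ((Pset_finite b (4*c) w).image _)

lemma finrank_V (b c w : ℕ) : Module.finrank ℚ (V b c w) =
    ∑ ij ∈ antidiagonal w, cnt b (4*c) ij.1 * cnt b (4*c) ij.2 := by
  have hli : LinearIndependent ℚ (fun x : Pset b (4*c) w => Ph c x.1) := by
    apply Lead_li _ (fun x => LL c x.1)
    · rintro ⟨⟨s, t⟩, hst⟩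
      rw [mem_Pset] at hst
      obtain ⟨i, j, _, h1, h2⟩ := hst
      exact Ph_lead c s t h1.2.2 h2.2.2
    · rintro ⟨⟨s, t⟩, hst⟩ ⟨⟨s', t'⟩, hst'⟩ h
      rw [mem_Pset] at hst hst'
      obtain ⟨i, j, _, h1, h2⟩ := hst
      obtain ⟨i', j', _, h1', h2'⟩ := hst'
      obtain ⟨rfl, rfl⟩ := LL_inj c b s t s' t' h1.2.2 h2.2.2 h1'.2.2 h2'.2.2 h1.1 h1'.1 h
      rfl
  have : Fintype (Pset b (4*c) w) := (Pset_finite b (4*c) w).fintype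
  have := finrank_span_eq_card hli
  rw [← Pset_ncard, ← Nat.card_coe_set_eq, Nat.card_eq_fintype_card, ← this]
  unfold V
  rw [Set.image_eq_range]

lemma R_span (l m k : ℕ) : R l m k = Submodule.span ℚ ((fun s => (monomial s (1 : ℚ) : S)) '' Ms l m k) := by
  unfold R
  exact restrictSupport_eq_span ℚ _

lemma V_mul (b c w1 w2 : ℕ) (f g : S) (hf : f ∈ R b (4*c) w1) (hg : g ∈ R b (4*c) w2) :
    aeval (yQ c) f * aeval (yH c) g ∈ V b c (w1 + w2) := by
  rw [R_span] at hf hg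
  induction hf using Submodule.span_induction with
  | mem x hx =>
    obtain ⟨s, hs, rfl⟩ := hx
    induction hg using Submodule.span_induction with
    | mem x hx =>
      obtain ⟨t, ht, rfl⟩ := hx
      apply Submodule.subset_span
      exact ⟨(s, t), (mem_Pset _ _ _ _).2 ⟨w1, w2, rfl, hs, ht⟩, rfl⟩
    | zero => simp
    | add x y _ _ hx hy => rw [map_add, mul_add]; exact Submodule.add_mem _ hx hy
    | smul a x _ hx => rw [map_smul, mul_smul_comm]; exact Submodule.smul_mem _ _ hx
  | zero => simp
  | add x y _ _ hx hy => rw [map_add, add_mul]; exact Submodule.add_mem _ hx hy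
  | smul a x _ hx => rw [map_smul, smul_mul_assoc]; exact Submodule.smul_mem _ _ hx

lemma mono_mem (l m k : ℕ) (s : ℕ →₀ ℕ) (hs : s ∈ Ms l m k) : (monomial s (1 : ℚ) : S) ∈ R l m k := by
  rw [R_span]; exact Submodule.subset_span ⟨s, hs, rfl⟩

lemma V_D (b c w : ℕ) : (V b c (w+1)).map (D : S →ₗ[ℚ] S) ≤ V b c w := by
  unfold V
  rw [Submodule.map_span, Submodule.span_le]
  rintro _ ⟨_, ⟨⟨s, t⟩, hst, rfl⟩, rfl⟩
  rw [mem_Pset] at hst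
  obtain ⟨i, j, hij, hs, ht⟩ := hst
  simp only at hs ht
  have hs' := mono_mem _ _ _ _ hs
  have ht' := mono_mem _ _ _ _ ht
  change D (Ph c (s, t)) ∈ V b c w
  unfold Ph
  rw [Derivation.leibniz, phi_D (yQ c) (4*c) (fun i hi => Q_D _ _ _ (by omega)) s hs.2.2,
    phi_D (yH c) (4*c) (fun i hi => H_D _ _ _) t ht.2.2, smul_eq_mul, smul_eq_mul]
  apply Submodule.add_mem
  · rcases j with _ | j
    · rw [D_zero _ _ _ ht']; simp
    · have := V_mul b c i j _ _ hs' (D_mem _ _ _ _ ht')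
      rwa [show i + j = w by omega] at this
  · rw [mul_comm]
    rcases i with _ | i
    · rw [D_zero _ _ _ hs']; simp
    · have := V_mul b c i j _ _ (D_mem _ _ _ _ hs') ht'
      rwa [show i + j = w by omega] at this

lemma V_le (b c w : ℕ) : V b c w ≤ R (5*b) (8*c+4) ((16*c+10) * b + w) := by
  unfold V
  rw [Submodule.span_le]
  rintro _ ⟨⟨s, t⟩, hst, rfl⟩
  rw [mem_Pset] at hst
  obtain ⟨i, j, hij, hs, ht⟩ := hst
  have h1 := phi_mem (yQ c) (4*c) 2 (8*c+4) (6*c+4) (fun p hp => by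
    have := Q_mem (2*c) (6*c+4) p
    rwa [show 6*c+4+2*c = 8*c+4 by ring] at this) b i s hs
  have h2 := phi_mem (yH c) (4*c) 3 (8*c+4) (10*c+6) (fun p hp => by
    have := H_mem (2*c+2) (6*c+2) p (by omega)
    rwa [show 6*c+2+(2*c+2) = 8*c+4 by ring, show 6*c+2+p+2*(2*c+2) = 10*c+6+p by ring] at this) b j t ht
  have := R_mul _ _ _ _ _ _ _ h1 h2
  rwa [show 2*b+3*b = 5*b by ring, show (6*c+4)*b + i + ((10*c+6)*b+j) = (16*c+10)*b + w by rw [← hij]; ring] at this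

lemma d_ge (b c w : ℕ) : (∑ ij ∈ antidiagonal (w+1), cnt b (4*c) ij.1 * cnt b (4*c) ij.2) ≤
    (∑ ij ∈ antidiagonal w, cnt b (4*c) ij.1 * cnt b (4*c) ij.2) + d (5*b) (8*c+4) ((16*c+10)*b+(w+1)) := by
  rw [← finrank_V, ← finrank_V, ← rank_nullity (D : S →ₗ[ℚ] S) (V b c (w+1))]
  apply Nat.add_le_add
  · exact Submodule.finrank_mono (V_D b c w)
  · unfold d K
    have := fd_K (5*b) (8*c+4) ((16*c+10)*b+(w+1))
    unfold K at this
    exact Submodule.finrank_mono (inf_le_inf_right _ (V_le b c (w+1)))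

end PP

namespace PP
open Finset

lemma sq_bound (P : ℕ → ℤ) (j : ℕ) :
    P j ^ 2 ≤ (j + 1) * (P 0 ^ 2 + ∑ i ∈ range j, (P i - P (i+1))^2) := by
  have h := sq_sum_le_card_mul_sum_sq (s := range (j+1)) (f := fun i => if i = 0 then P 0 else P i - P (i-1))
  rw [sum_range_succ', sum_range_succ'] at h
  simp only [card_range, Nat.add_sub_cancel, if_true, Nat.add_one_ne_zero, if_false] at h
  rw [sum_range_sub] at h
  push_cast at h
  have e : ∑ i ∈ range j, (P i - P (i+1))^2 = ∑ i ∈ range j, (P (i+1) - P i)^2 :=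
    sum_congr rfl fun i _ => by ring
  rw [e]
  have e2 : P j - P 0 + P 0 = P j := by ring
  rw [e2] at h
  linarith

lemma conv_id (P : ℕ → ℤ) (w : ℕ) (hs : ∀ i ≤ w + 1, P i = P (w + 1 - i)) :
    2 * (∑ ij ∈ antidiagonal (w+1), P ij.1 * P ij.2) - 2 * (∑ ij ∈ antidiagonal w, P ij.1 * P ij.2)
      = P 0 ^ 2 + P (w+1) ^ 2 + ∑ i ∈ range (w+1), (P i - P (i+1))^2 := by
  rw [Nat.sum_antidiagonal_eq_sum_range_succ (fun i j => P i * P j),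
    Nat.sum_antidiagonal_eq_sum_range_succ (fun i j => P i * P j)]
  have e1 : ∑ i ∈ range (w+1).succ, P i * P (w+1-i) = ∑ i ∈ range (w+2), P i ^ 2 := by
    apply sum_congr rfl
    intro i hi
    rw [mem_range] at hi
    rw [← hs i (by omega)]; ring
  have e2 : ∑ i ∈ range w.succ, P i * P (w-i) = ∑ i ∈ range (w+1), P i * P (i+1) := by
    apply sum_congr rfl
    intro i hi
    rw [mem_range] at hi
    rw [hs (i+1) (by omega), show w + 1 - (i+1) = w - i by omega]
  rw [e1, e2]
  have e3 : ∑ i ∈ range (w+1), (P i - P (i+1))^2 = ∑ i ∈ range (w+1), P i ^ 2 + ∑ i ∈ range (w+1), P (i+1) ^ 2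
     - 2 * ∑ i ∈ range (w+1), P i * P (i+1) := by
    rw [mul_sum, ← sum_add_distrib, ← sum_sub_distrib]
    exact sum_congr rfl fun i _ => by ring
  have f1 := sum_range_succ (fun i => P i ^ 2) (w+1)
  have f2 := sum_range_succ' (fun i => P i ^ 2) (w+1)
  rw [e3]
  linarith

lemma partE : PartE := by
  intro b c hb hc
  obtain ⟨w, hw⟩ : ∃ w, b * (4*c) = w + 1 := ⟨b * (4*c) - 1, by
    have : 0 < b * (4*c) := by positivity
    omega⟩
  have hd := d_ge b c w
  rw [show (16*c+10)*b + (w+1) = 5*b*(4*c+2) by rw [← hw]; ring] at hd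
  set dd := d (5*b) (8*c+4) (5*b*(4*c+2)) with hdd
  set P : ℕ → ℤ := fun i => (cnt b (4*c) i : ℤ) with hP
  have hid := conv_id P w (by
    intro i hi
    simp only [hP]
    rw [cnt_symm b (4*c) i (by omega), hw])
  have hd' : (∑ ij ∈ antidiagonal (w+1), P ij.1 * P ij.2) ≤ (∑ ij ∈ antidiagonal w, P ij.1 * P ij.2) + dd := by
    simp only [hP]
    exact_mod_cast hd
  obtain ⟨j, hj, hmax⟩ := exists_max_image (range (w+2)) (fun i => cnt b (4*c) i) ⟨0, by simp⟩
  have hsum := cnt_sum b (4*c)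
  rw [hw] at hsum
  have hle : (b + 4*c).choose b ≤ (w+2) * cnt b (4*c) j := by
    rw [← hsum]
    have := sum_le_card_nsmul (range (w+2)) (fun i => cnt b (4*c) i) _ hmax
    simpa using this
  rw [mem_range] at hj
  have hsq := sq_bound P j
  have hmono : ∑ i ∈ range j, (P i - P (i+1))^2 ≤ ∑ i ∈ range (w+1), (P i - P (i+1))^2 := by
    apply sum_le_sum_of_subset_of_nonneg
    · intro i hi; rw [mem_range] at hi ⊢; omega
    · intros; positivity
  have hM : P j ^ 2 ≤ (w + 2) * (2 * dd) := by
    have hj' : (j : ℤ) + 1 ≤ w + 2 := by exact_mod_cast hj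
    have t1 : P 0 ^ 2 + ∑ i ∈ range j, (P i - P (i+1))^2 ≤ 2 * dd := by
      have := sq_nonneg (P (w+1))
      linarith
    have t0 : 0 ≤ P 0 ^ 2 + ∑ i ∈ range j, (P i - P (i+1))^2 := by positivity
    calc P j ^ 2 ≤ _ := hsq
      _ ≤ (w+2) * (2 * dd) := by
        apply mul_le_mul hj' t1 t0 (by positivity)
  have hle' : ((b + 4*c).choose b : ℤ) ≤ (w+2) * P j := by
    simp only [hP]; exact_mod_cast hle
  rw [hw]
  have : (((b + 4*c).choose b : ℤ))^2 ≤ 2 * (w+1+1)^3 * dd := by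
    calc (((b + 4*c).choose b : ℤ))^2 ≤ ((w+2) * P j)^2 := by
          apply pow_le_pow_left₀ (by positivity) hle'
      _ = (w+2)^2 * P j ^ 2 := by ring
      _ ≤ (w+2)^2 * ((w+2) * (2*dd)) := by
          apply mul_le_mul_of_nonneg_left hM (by positivity)
      _ = _ := by ring
  exact_mod_cast this

end PP

theorem stmt_0 (l m k : ℕ) (hl : 8 ≤ l) (hlm : l ≤ m) (hk2 : 2 ≤ k) (hk : 2 * k ≤ l * m) :
    (p k l m : ℝ) - p (k - 1) l m >
      0.004 * 2 ^ Real.sqrt (min (2 * (k : ℝ)) ((l : ℝ) ^ 2)) /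
        (min (2 * (k : ℝ)) ((l : ℝ) ^ 2)) ^ ((9 : ℝ) / 4) := by
  exact PP.final PP.partE l m k hl hlm hk2 hk
end

section
/- (Sylvester's unimodality theorem.) For all positive integers ℓ, m, the sequence p_0(ℓ,m), p_1(ℓ,m), …, p_{ℓm}(ℓ,m) is symmetric and unimodal: p_k(ℓ,m) = p_{ℓm−k}(ℓ,m) for all 0 ≤ k ≤ ℓm, and p_{k−1}(ℓ,m) ≤ p_k(ℓ,m) for all 1 ≤ k ≤ ⌊ℓm/2⌋. -/
open MvPolynomial in
/-- raising derivation -/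
noncomputable def sylE (m : ℕ) : Derivation ℚ (MvPolynomial ℕ ℚ) (MvPolynomial ℕ ℚ) :=
  mkDerivation ℚ (fun i => ((m : ℚ) - i) • X (i + 1))

open MvPolynomial in
/-- lowering derivation -/
noncomputable def sylF : Derivation ℚ (MvPolynomial ℕ ℚ) (MvPolynomial ℕ ℚ) :=
  mkDerivation ℚ (fun i => (i : ℚ) • X (i - 1))

open MvPolynomial in
/-- weight derivation -/
noncomputable def sylH (m : ℕ) : Derivation ℚ (MvPolynomial ℕ ℚ) (MvPolynomial ℕ ℚ) :=
  mkDerivation ℚ (fun i => ((m : ℚ) - 2 * i) • X i)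

/-- multisets -/
def sylT (k l m : ℕ) : Set (Multiset ℕ) :=
  {s | s.card = l ∧ s.sum = k ∧ ∀ x ∈ s, x ≤ m}

/-- exponents -/
def sylS (k l m : ℕ) : Set (ℕ →₀ ℕ) := {a | Finsupp.toMultiset a ∈ sylT k l m}

theorem syl_comm (m : ℕ) : ⁅sylF, sylE m⁆ = sylH m := by
  apply MvPolynomial.derivation_ext
  intro i
  rw [Derivation.commutator_apply]
  simp only [sylE, sylF, sylH, MvPolynomial.mkDerivation_X, Derivation.map_smul]
  rcases i with _ | i
  · simp
  · simp only [Nat.add_sub_cancel, smul_smul, ← sub_smul]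
    congr 1
    push_cast
    ring

theorem syl_H_monomial (m : ℕ) (a : ℕ →₀ ℕ) :
    sylH m (MvPolynomial.monomial a 1) =
      (((Finsupp.toMultiset a).card : ℚ) * m - 2 * (Finsupp.toMultiset a).sum) •
        MvPolynomial.monomial a 1 := by
  obtain ⟨s, rfl⟩ := (Multiset.toFinsupp (α := ℕ)).surjective a
  induction s using Multiset.induction with
  | empty => simp [MvPolynomial.monomial_zero']
  | cons i s ih =>
    have h : MvPolynomial.monomial (Multiset.toFinsupp (i ::ₘ s)) (1 : ℚ) =
        MvPolynomial.monomial (Multiset.toFinsupp s) 1 * MvPolynomial.X i := by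
      rw [← Multiset.singleton_add, Multiset.toFinsupp_add, MvPolynomial.X,
        MvPolynomial.monomial_mul, add_comm, Multiset.toFinsupp_singleton, one_mul]
    rw [h, Derivation.leibniz, ih]
    simp only [Multiset.toFinsupp_toMultiset, sylH, MvPolynomial.mkDerivation_X, smul_eq_mul,
      Multiset.card_cons, Multiset.sum_cons, mul_smul_comm]
    rw [mul_comm (MvPolynomial.X i), ← add_smul]
    congr 1
    push_cast
    ring

theorem syl_der_mem (f : ℕ → MvPolynomial ℕ ℚ) (A : Set (ℕ →₀ ℕ))
    (V : Submodule ℚ (MvPolynomial ℕ ℚ))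
    (h : ∀ b i, b + Finsupp.single i 1 ∈ A → MvPolynomial.monomial b 1 * f i ∈ V)
    (q : MvPolynomial ℕ ℚ) (hq : q ∈ MvPolynomial.restrictSupport ℚ A) :
    MvPolynomial.mkDerivation ℚ f q ∈ V := by
  rw [MvPolynomial.restrictSupport_eq_span] at hq
  induction hq using Submodule.span_induction with
  | zero => simp
  | add x y _ _ hx hy => rw [map_add]; exact V.add_mem hx hy
  | smul c x _ hx => rw [Derivation.map_smul]; exact V.smul_mem _ hx
  | mem x hx =>
    obtain ⟨a, ha, rfl⟩ := hx
    simp only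
    rw [MvPolynomial.mkDerivation_monomial, one_smul]
    refine V.sum_mem fun i hi => ?_
    have hi' : a i ≠ 0 := by simpa using hi
    have hle : Finsupp.single i 1 ≤ a := by
      rw [Finsupp.single_le_iff]; omega
    have := h (a - Finsupp.single i 1) i (by rwa [tsub_add_cancel_of_le hle])
    have h2 := V.smul_mem (a i : ℚ) this
    simpa [← smul_mul_assoc, MvPolynomial.smul_monomial] using h2

theorem syl_E_mem (k l m : ℕ) (q : MvPolynomial ℕ ℚ)
    (hq : q ∈ MvPolynomial.restrictSupport ℚ (sylS k l m)) :
    sylE m q ∈ MvPolynomial.restrictSupport ℚ (sylS (k + 1) l m) := by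
  refine syl_der_mem _ _ _ ?_ q hq
  intro b i hb
  rw [mul_smul_comm, MvPolynomial.X, MvPolynomial.monomial_mul, MvPolynomial.smul_monomial,
    MvPolynomial.monomial_mem_restrictSupport]
  simp only [sylS, sylT, Set.mem_ofPred_eq, Finsupp.toMultiset_add, Finsupp.toMultiset_single,
    one_smul, Multiset.card_add, Multiset.card_singleton, Multiset.sum_add,
    Multiset.sum_singleton, Multiset.mem_add, Multiset.mem_singleton] at hb ⊢
  obtain ⟨h1, h2, h3⟩ := hb
  by_cases him : i = m
  · right; simp [him]
  · left
    refine ⟨h1, by omega, ?_⟩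
    rintro x (hx | rfl)
    · exact h3 x (Or.inl hx)
    · have := h3 i (Or.inr rfl); omega

theorem syl_F_mem (k l m : ℕ) (q : MvPolynomial ℕ ℚ)
    (hq : q ∈ MvPolynomial.restrictSupport ℚ (sylS (k + 1) l m)) :
    sylF q ∈ MvPolynomial.restrictSupport ℚ (sylS k l m) := by
  refine syl_der_mem _ _ _ ?_ q hq
  intro b i hb
  rw [mul_smul_comm, MvPolynomial.X, MvPolynomial.monomial_mul, MvPolynomial.smul_monomial,
    MvPolynomial.monomial_mem_restrictSupport]
  simp only [sylS, sylT, Set.mem_ofPred_eq, Finsupp.toMultiset_add, Finsupp.toMultiset_single,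
    one_smul, Multiset.card_add, Multiset.card_singleton, Multiset.sum_add,
    Multiset.sum_singleton, Multiset.mem_add, Multiset.mem_singleton] at hb ⊢
  obtain ⟨h1, h2, h3⟩ := hb
  by_cases him : i = 0
  · right; simp [him]
  · left
    refine ⟨h1, by omega, ?_⟩
    rintro x (hx | rfl)
    · exact h3 x (Or.inl hx)
    · have := h3 i (Or.inr rfl); omega

theorem syl_F_zero (l m : ℕ) (q : MvPolynomial ℕ ℚ)
    (hq : q ∈ MvPolynomial.restrictSupport ℚ (sylS 0 l m)) :
    sylF q = 0 := by
  rw [← Submodule.mem_bot ℚ]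
  refine syl_der_mem _ _ _ ?_ q hq
  intro b i hb
  simp only [sylS, sylT, Set.mem_ofPred_eq, Finsupp.toMultiset_add, Finsupp.toMultiset_single,
    one_smul, Multiset.card_add, Multiset.card_singleton, Multiset.sum_add,
    Multiset.sum_singleton, Multiset.mem_add, Multiset.mem_singleton] at hb
  have : i = 0 := by omega
  simp [this]

theorem syl_H_mem (k l m : ℕ) (q : MvPolynomial ℕ ℚ)
    (hq : q ∈ MvPolynomial.restrictSupport ℚ (sylS k l m)) :
    sylH m q = ((l : ℚ) * m - 2 * k) • q := by
  rw [MvPolynomial.restrictSupport_eq_span] at hq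
  induction hq using Submodule.span_induction with
  | zero => simp
  | add x y _ _ hx hy => rw [map_add, hx, hy, smul_add]
  | smul c x _ hx => rw [Derivation.map_smul, hx, smul_comm]
  | mem x hx =>
    obtain ⟨a, ha, rfl⟩ := hx
    simp only
    rw [syl_H_monomial, ha.1, ha.2.1]

/-- Key: if `E q = c F-something` -/
theorem syl_inj_aux (l m : ℕ) : ∀ (k : ℕ), 2 * k < l * m → ∀ (q r : MvPolynomial ℕ ℚ) (c : ℚ),
    0 ≤ c →
    q ∈ MvPolynomial.restrictSupport ℚ (sylS k l m) →
    sylE m q = -(c • r) → sylF r = q → q = 0 := by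
  intro k
  induction k with
  | zero =>
    intro hk q r c hc hq hE hF
    have h1 : sylF (sylE m q) - sylE m (sylF q) = sylH m q := by
      rw [← syl_comm m, Derivation.commutator_apply]
    rw [hE, syl_F_zero l m q hq, syl_H_mem 0 l m q hq, map_neg, Derivation.map_smul, hF,
      map_zero] at h1
    have h2 : ((l : ℚ) * m + c) • q = 0 := by
      rw [add_smul]
      have : ((l : ℚ) * m - 2 * (0 : ℕ)) = (l : ℚ) * m := by simp
      rw [this] at h1
      rw [← h1]; abel
    have hp : (0 : ℚ) < (l : ℚ) * m := by exact_mod_cast (by omega : 0 < l * m)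
    exact (smul_eq_zero.1 h2).resolve_left (by positivity)
  | succ k ih =>
    intro hk q r c hc hq hE hF
    have h1 : sylF (sylE m q) - sylE m (sylF q) = sylH m q := by
      rw [← syl_comm m, Derivation.commutator_apply]
    rw [hE, syl_H_mem _ l m q hq, map_neg, Derivation.map_smul, hF] at h1
    have hp : (0 : ℚ) < (l : ℚ) * m - 2 * (k + 1 : ℕ) := by
      have : (2 : ℚ) * (k + 1 : ℕ) < (l : ℚ) * m := by exact_mod_cast hk
      linarith
    have h2 : sylE m (sylF q) = -((((l : ℚ) * m - 2 * (k + 1 : ℕ)) + c) • q) := by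
      rw [add_smul, ← h1]; abel
    have h3 := ih (by omega) (sylF q) q _ (by positivity) (syl_F_mem k l m q hq) h2 rfl
    rw [h3, map_zero, eq_comm, neg_eq_zero] at h2
    exact (smul_eq_zero.1 h2).resolve_left (by positivity)

theorem syl_inj (k l m : ℕ) (hk : 2 * k < l * m) (q : MvPolynomial ℕ ℚ)
    (hq : q ∈ MvPolynomial.restrictSupport ℚ (sylS k l m)) (hE : sylE m q = 0) : q = 0 := by
  have h1 : sylF (sylE m q) - sylE m (sylF q) = sylH m q := by
    rw [← syl_comm m, Derivation.commutator_apply]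
  rw [hE, syl_H_mem _ l m q hq, map_zero, zero_sub] at h1
  have hp : (0 : ℚ) < (l : ℚ) * m - 2 * k := by
    have : (2 : ℚ) * k < (l : ℚ) * m := by exact_mod_cast hk
    linarith
  have h2 : sylE m (sylF q) = -(((l : ℚ) * m - 2 * k) • q) := by
    rw [← h1, neg_neg]
  have h3 : sylF q = 0 := by
    rcases k with _ | k
    · exact syl_F_zero l m q hq
    · exact syl_inj_aux l m k (by omega) (sylF q) q _ hp.le (syl_F_mem k l m q hq) h2 rfl
  rw [h3, map_zero, eq_comm, neg_eq_zero] at h2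
  exact (smul_eq_zero.1 h2).resolve_left hp.ne'

/-- partitions vs multisets -/
def sylEquiv (k l m : ℕ) :
    {π : Nat.Partition k // π.parts.card ≤ l ∧ ∀ x ∈ π.parts, x ≤ m} ≃ sylT k l m where
  toFun π := ⟨π.1.parts + Multiset.replicate (l - π.1.parts.card) 0, by
    obtain ⟨π, h1, h2⟩ := π
    refine ⟨by simp; omega, by simp [π.parts_sum], ?_⟩
    intro x hx
    rcases Multiset.mem_add.1 hx with hx | hx
    · exact h2 x hx
    · rw [Multiset.eq_of_mem_replicate hx]; omega⟩
  invFun s := ⟨Nat.Partition.ofSums k s.1 s.2.2.1, by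
    refine ⟨?_, ?_⟩
    · exact (Multiset.card_le_card (Multiset.filter_le _ _)).trans s.2.1.le
    · intro x hx
      exact s.2.2.2 x (Multiset.mem_of_mem_filter hx)⟩
  left_inv π := by
    apply Subtype.ext
    apply Nat.Partition.ext
    simp only [Nat.Partition.ofSums, Multiset.filter_add]
    rw [Multiset.filter_eq_self.2 (fun a ha => (π.1.parts_pos ha).ne'),
      Multiset.filter_eq_nil.2 (fun a ha => by simp [Multiset.eq_of_mem_replicate ha]), add_zero]
  right_inv s := by
    have h1 := s.2.1
    apply Subtype.ext
    simp only [Nat.Partition.ofSums]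
    generalize s.1 = s at h1 ⊢
    have h4 := Multiset.filter_add_not (fun x => x ≠ 0) s
    have h5 := congrArg Multiset.card h4
    rw [Multiset.card_add, h1] at h5
    have h6 : Multiset.filter (fun x => ¬ x ≠ 0) s =
        Multiset.replicate (Multiset.filter (fun x => ¬ x ≠ 0) s).card 0 := by
      apply Multiset.eq_replicate_card.2
      intro b hb
      simpa using (Multiset.mem_filter.1 hb).2
    conv_rhs => rw [← h4, h6]
    congr 2
    omega

theorem syl_p_eq (k l m : ℕ) : p k l m = Nat.card (sylT k l m) := by
  rw [p, ← Nat.card_eq_fintype_card]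
  exact Nat.card_congr (sylEquiv k l m)

instance syl_finT (k l m : ℕ) : Finite (sylT k l m) := Finite.of_equiv _ (sylEquiv k l m)

/-- exponents vs multisets -/
noncomputable def sylEquiv2 (k l m : ℕ) : sylS k l m ≃ sylT k l m :=
  (Multiset.toFinsupp (α := ℕ)).symm.toEquiv.subtypeEquiv (fun _ => Iff.rfl)

instance syl_finS (k l m : ℕ) : Finite (sylS k l m) := Finite.of_equiv _ (sylEquiv2 k l m).symm

theorem syl_finrank (k l m : ℕ) :
    Module.finrank ℚ (MvPolynomial.restrictSupport ℚ (sylS k l m)) = p k l m := by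
  rw [Module.finrank_eq_nat_card_basis (MvPolynomial.basisRestrictSupport ℚ (sylS k l m)),
    syl_p_eq, Nat.card_congr (sylEquiv2 k l m)]

theorem syl_compl_sum (m : ℕ) (s : Multiset ℕ) (h : ∀ x ∈ s, x ≤ m) :
    (s.map (m - ·)).sum + s.sum = s.card * m := by
  induction s using Multiset.induction with
  | empty => simp
  | cons a s ih =>
    have h1 := ih (fun x hx => h x (Multiset.mem_cons_of_mem hx))
    have h2 := h a (Multiset.mem_cons_self a s)
    simp only [Multiset.map_cons, Multiset.sum_cons, Multiset.card_cons, add_mul, one_mul]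
    omega

theorem syl_compl_mem (k l m : ℕ) (s : Multiset ℕ) (h : s ∈ sylT k l m) :
    s.map (m - ·) ∈ sylT (l * m - k) l m := by
  obtain ⟨h1, h2, h3⟩ := h
  refine ⟨by simpa using h1, ?_, ?_⟩
  · have := syl_compl_sum m s h3
    rw [h1, h2] at this
    omega
  · intro x hx
    obtain ⟨y, -, rfl⟩ := Multiset.mem_map.1 hx
    omega

theorem syl_compl_compl (m : ℕ) (s : Multiset ℕ) (h : ∀ x ∈ s, x ≤ m) :
    (s.map (m - ·)).map (m - ·) = s := by
  rw [Multiset.map_map]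
  conv_rhs => rw [← Multiset.map_id s]
  apply Multiset.map_congr rfl
  intro x hx
  have := h x hx
  simp only [Function.comp, id]
  omega

theorem syl_symm_le (k l m : ℕ) : p k l m ≤ p (l * m - k) l m := by
  rw [syl_p_eq, syl_p_eq]
  refine Nat.card_le_card_of_injective
    (fun s : sylT k l m => (⟨s.1.map (m - ·), syl_compl_mem k l m s.1 s.2⟩ :
      sylT (l * m - k) l m)) ?_
  intro s t hst
  have h := congrArg (fun u : sylT (l * m - k) l m => u.1.map (m - ·)) hst
  simp only at h
  rw [syl_compl_compl m _ s.2.2.2, syl_compl_compl m _ t.2.2.2] at h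
  exact Subtype.ext h

theorem stmt_1 (l m : ℕ) (hl : 0 < l) (hm : 0 < m) :
    (∀ k : ℕ, k ≤ l * m → p k l m = p (l * m - k) l m) ∧
    (∀ k : ℕ, 1 ≤ k → 2 * k ≤ l * m → p (k - 1) l m ≤ p k l m) := by
  constructor
  · intro k hk
    refine le_antisymm (syl_symm_le k l m) ?_
    have := syl_symm_le (l * m - k) l m
    rwa [Nat.sub_sub_self hk] at this
  · intro k hk1 hk2
    obtain ⟨k, rfl⟩ : ∃ j, k = j + 1 := ⟨k - 1, by omega⟩
    rw [Nat.add_sub_cancel, ← syl_finrank, ← syl_finrank]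
    haveI : Module.Finite ℚ (MvPolynomial.restrictSupport ℚ (sylS (k + 1) l m)) :=
      Module.Finite.of_basis (MvPolynomial.basisRestrictSupport ℚ (sylS (k + 1) l m))
    refine LinearMap.finrank_le_finrank_of_injective
      (f := (sylE m : MvPolynomial ℕ ℚ →ₗ[ℚ] MvPolynomial ℕ ℚ).restrict
        (p := MvPolynomial.restrictSupport ℚ (sylS k l m))
        (q := MvPolynomial.restrictSupport ℚ (sylS (k + 1) l m))
        (fun q hq => syl_E_mem k l m q hq)) ?_
    rw [injective_iff_map_eq_zero]
    intro q hq
    apply Subtype.ext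
    exact syl_inj k l m (by omega) q.1 q.2 (congrArg Subtype.val hq)
end

section
/- (Strict unimodality of Gaussian binomial coefficients.) For all integers ℓ, m ≥ 8 and all integers k with 2 ≤ k ≤ ℓm/2, we have p_k(ℓ,m) − p_{k−1}(ℓ,m) ≥ 1. -/
namespace GB
open MvPolynomial

noncomputable section

def wt (n : ℕ) (i : Fin (n+1)) : ℤ × ℤ := (1, (i : ℕ))

abbrev A (n : ℕ) (d k : ℤ) : Submodule ℚ (MvPolynomial (Fin (n+1)) ℚ) :=
  weightedHomogeneousSubmodule ℚ (wt n) (d, k)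

def dX (n : ℕ) (i : Fin (n+1)) : MvPolynomial (Fin (n+1)) ℚ :=
  C ((i : ℕ) : ℚ) * X ⟨(i : ℕ) - 1, by omega⟩

def uX (n : ℕ) (i : Fin (n+1)) : MvPolynomial (Fin (n+1)) ℚ :=
  C ((n : ℚ) - (i : ℕ)) * X ⟨min ((i : ℕ) + 1) n, by omega⟩

def D (n : ℕ) := mkDerivation ℚ (dX n)
def U (n : ℕ) := mkDerivation ℚ (uX n)
def H (n : ℕ) := mkDerivation ℚ (fun i : Fin (n+1) => C ((n : ℚ) - 2 * (i : ℕ)) * X i)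

lemma comm (n : ℕ) : ⁅D n, U n⁆ = H n := by
  apply derivation_ext
  intro i
  rw [Derivation.commutator_apply]
  simp only [D, U, H, mkDerivation_X, dX, uX, C_mul', Derivation.map_smul, smul_smul]
  obtain ⟨i, hi⟩ := i
  rcases Nat.eq_zero_or_pos i with rfl | h0
  · rcases Nat.eq_zero_or_pos n with rfl | hn
    · simp
    · have h1 : min (0 + 1) n = 1 := by omega
      simp [h1]
  · have e1 : min (i - 1 + 1) n = i := by omega
    rcases Nat.lt_or_ge i n with h | h
    · have e2 : min (i + 1) n - 1 = i := by omega
      have e3 : min (i + 1) n = i + 1 := by omega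
      have e4 : (⟨min (i + 1) n - 1, by omega⟩ : Fin (n+1)) = ⟨i, hi⟩ := Fin.ext e2
      rw [e4]
      simp only [e1, e3]
      rw [← sub_smul]
      congr 1
      rw [Nat.cast_sub h0]
      push_cast
      ring
    · have : i = n := by omega
      subst this
      simp only [e1, sub_self, zero_mul, zero_smul, zero_sub, ← neg_smul]
      congr 1
      rw [Nat.cast_sub h0]
      push_cast
      ring

lemma comm_apply (n : ℕ) (v) : D n (U n v) = U n (D n v) + H n v := by
  rw [← comm, Derivation.commutator_apply]; abel

lemma dsum {n : ℕ} (F : Fin (n+1) → Derivation ℚ (MvPolynomial (Fin (n+1)) ℚ)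
    (MvPolynomial (Fin (n+1)) ℚ)) (v) : (∑ i, F i) v = ∑ i, F i v := by
  rw [← Derivation.coeFnAddMonoidHom_apply, map_sum, Finset.sum_apply]
  rfl

lemma mk_mem {n : ℕ} (f : Fin (n+1) → MvPolynomial (Fin (n+1)) ℚ) (e : ℤ)
    (hf : ∀ i, (f i).IsWeightedHomogeneous (wt n) (wt n i + (0, e))) {d k : ℤ} {v}
    (hv : v ∈ A n d k) : mkDerivation ℚ f v ∈ A n d (k + e) := by
  have : mkDerivation ℚ f v = ∑ i, pderiv i v * f i := by
    have h : mkDerivation ℚ f = ∑ i, f i • pderiv i := by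
      apply derivation_ext
      intro j
      rw [dsum, Finset.sum_eq_single j]
      · simp [mkDerivation_X]
      · intro b _ hb
        simp [pderiv_X_of_ne hb.symm]
      · simp
    rw [h, dsum]
    simp [mul_comm]
  rw [this]
  refine Submodule.sum_mem _ fun i _ => ?_
  have h1 := IsWeightedHomogeneous.pderiv (i := i) (n' := (d, k) - wt n i) hv (by simp)
  have := h1.mul (hf i)
  have e : (d, k) - wt n i + (wt n i + (0, e)) = (d, k + e) := by
    rw [← add_assoc, sub_add_cancel]; simp
  rw [e] at this
  exact this

lemma D_mem {n : ℕ} {d k : ℤ} {v} (hv : v ∈ A n d k) : D n v ∈ A n d (k - 1) := by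
  refine mk_mem _ (-1) (fun i => ?_) hv
  rcases Nat.eq_zero_or_pos (i : ℕ) with h | h
  · simp only [dX, h, Nat.cast_zero, C_0, zero_mul]
    exact isWeightedHomogeneous_zero _ _ _
  · have := (isWeightedHomogeneous_X ℚ (wt n) ⟨(i : ℕ) - 1, by omega⟩).C_mul ((i : ℕ) : ℚ)
    have e : wt n i + (0, -1) = wt n ⟨(i : ℕ) - 1, by omega⟩ := by
      ext <;> simp [wt]; omega
    rw [e]; exact this

lemma U_mem {n : ℕ} {d k : ℤ} {v} (hv : v ∈ A n d k) : U n v ∈ A n d (k + 1) := by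
  refine mk_mem _ 1 (fun i => ?_) hv
  rcases Nat.lt_or_ge (i : ℕ) n with h | h
  · have := (isWeightedHomogeneous_X ℚ (wt n) ⟨min ((i : ℕ) + 1) n, by omega⟩).C_mul
      ((n : ℚ) - (i : ℕ))
    have e : wt n i + (0, 1) = wt n ⟨min ((i : ℕ) + 1) n, by omega⟩ := by
      ext <;> simp [wt]; omega
    rw [e]; exact this
  · have : (i : ℕ) = n := by omega
    simp only [uX, this, sub_self, C_0, zero_mul]
    exact isWeightedHomogeneous_zero _ _ _

lemma weight_eq {n : ℕ} (s : Fin (n+1) →₀ ℕ) :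
    Finsupp.weight (wt n) s = (((∑ i, s i : ℕ) : ℤ), ((∑ i, s i * (i : ℕ) : ℕ) : ℤ)) := by
  rw [Finsupp.weight_apply, Finsupp.sum_fintype _ _ (by simp)]
  ext <;> simp [wt, Prod.fst_sum, Prod.snd_sum]

lemma H_apply {n : ℕ} {d k : ℤ} {v} (hv : v ∈ A n d k) :
    H n v = ((n : ℚ) * d - 2 * k) • v := by
  rw [A, weightedHomogeneousSubmodule_eq_finsupp_supported,
    AddMonoidAlgebra.supported_eq_span_single] at hv
  refine Submodule.span_induction ?_ ?_ (fun p q _ _ hp hq ↦ ?_) (fun r p _ h ↦ ?_) hv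
  · rintro _ ⟨m, hm, rfl⟩
    rw [Set.mem_ofPred_eq, weight_eq, Prod.mk.injEq] at hm
    simp only [single_eq_monomial]
    rw [H, mkDerivation_monomial, one_smul,
      Finsupp.sum_fintype _ _ (by simp)]
    rw [← hm.1, ← hm.2]
    push_cast
    rw [Finset.mul_sum, Finset.mul_sum, ← Finset.sum_sub_distrib, Finset.sum_smul]
    refine Finset.sum_congr rfl fun i _ => ?_
    rcases Nat.eq_zero_or_pos (m i) with h | h
    · simp [h]
    · have : m - Finsupp.single i 1 + Finsupp.single i 1 = m := by
        apply tsub_add_cancel_of_le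
        rw [Finsupp.single_le_iff]; omega
      rw [smul_eq_mul, X, C_mul_monomial, monomial_mul, this, smul_monomial]
      congr 1
      simp
      ring
  · simp
  · rw [map_add, hp, hq, smul_add]
  · rw [(H n).map_smul, h, smul_comm]

lemma A_neg {n : ℕ} {d k : ℤ} (hk : k < 0) {v} (hv : v ∈ A n d k) : v = 0 := by
  refine IsWeightedHomogeneous.eq_zero_of_no_monomials hv fun s hs => ?_
  rw [weight_eq, Prod.mk.injEq] at hs
  have := hs.2
  omega

lemma inj_aux (n : ℕ) (d : ℤ) (t : ℕ) : ∀ (k : ℤ), k < t → 2 * k < n * d → ∀ c : ℚ, 0 ≤ c →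
    ∀ v ∈ A n d k, D n (U n v) = (-c) • v → v = 0 := by
  induction t with
  | zero => intro k hk _ c _ v hv _; exact A_neg (by simpa using hk) hv
  | succ t ih =>
    intro k hk h2 c hc v hv hDU
    have h2' : (2 * k : ℚ) < n * d := by exact_mod_cast h2
    have h1 : U n (D n v) = (-(c + (n * d - 2 * k))) • v := by
      have := comm_apply n v
      rw [hDU, H_apply hv] at this
      rw [neg_add, add_smul, this, neg_smul _ v]
      abel
    have h3 : D n v = 0 := by
      refine ih (k - 1) (by push_cast at hk; omega) (by omega) (c + (n * d - 2 * k))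
        (by linarith) _ (D_mem hv) ?_
      rw [h1, Derivation.map_smul]
    rw [h3, map_zero] at h1
    rcases smul_eq_zero.1 h1.symm with h | h
    · exfalso; linarith
    · exact h

def expSet (n : ℕ) (d k : ℤ) : Set (Fin (n+1) →₀ ℕ) := {s | Finsupp.weight (wt n) s = (d, k)}

lemma expSet_finite (n : ℕ) (d k : ℤ) : (expSet n d k).Finite := by
  have : (expSet n d k) ⊆ Set.Iic (Finsupp.equivFunOnFinite.symm fun _ => d.toNat) := by
    intro s hs
    rw [expSet, Set.mem_ofPred_eq, weight_eq, Prod.mk.injEq] at hs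
    intro i
    have h1 : s i ≤ ∑ i, s i := Finset.single_le_sum (fun _ _ => Nat.zero_le _) (Finset.mem_univ i)
    simp only [Finsupp.equivFunOnFinite_symm_apply_apply]
    omega
  exact (Set.finite_Iic _).subset this

def eqv (n : ℕ) (d k : ℤ) : A n d k ≃ₗ[ℚ] (expSet n d k →₀ ℚ) :=
  (LinearEquiv.ofEq _ _ (weightedHomogeneousSubmodule_eq_finsupp_supported ℚ (wt n) (d, k))).trans
    (AddMonoidAlgebra.supportedEquivFinsupp _)

instance (n : ℕ) (d k : ℤ) : FiniteDimensional ℚ (A n d k) := by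
  have := (expSet_finite n d k).to_subtype
  exact Module.Finite.equiv (eqv n d k).symm

lemma finrank_A (n : ℕ) (d k : ℤ) : Module.finrank ℚ (A n d k) = (expSet n d k).ncard := by
  have := (expSet_finite n d k).fintype
  rw [(eqv n d k).finrank_eq, Module.finrank_finsupp_self, Set.ncard_eq_toFinset_card',
    Set.toFinset_card]

def Dk (n : ℕ) (d k : ℤ) : A n d k →ₗ[ℚ] A n d (k - 1) :=
  (D n).toLinearMap.restrict fun _ => D_mem

lemma Dk_surj {n : ℕ} {d k : ℤ} (h : 2 * k ≤ n * d) : Function.Surjective (Dk n d k) := by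
  let f : A n d (k - 1) →ₗ[ℚ] A n d (k - 1) :=
    ((D n).toLinearMap ∘ₗ (U n).toLinearMap).restrict fun v hv => by
      have := D_mem (U_mem hv)
      simpa using this
  have hf : Function.Injective f := by
    rw [← LinearMap.ker_eq_bot, LinearMap.ker_eq_bot']
    rintro ⟨v, hv⟩ h0
    have h1 : D n (U n v) = 0 := congrArg Subtype.val h0
    have := inj_aux n d k.toNat (k - 1) (by omega) (by omega) 0 le_rfl v hv (by simpa using h1)
    exact Subtype.ext this
  intro y
  obtain ⟨x, hx⟩ := LinearMap.injective_iff_surjective.1 hf y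
  refine ⟨⟨U n x.1, by simpa using U_mem x.2⟩, ?_⟩
  rw [← hx]
  rfl

def Cov (n : ℕ) (d k : ℤ) : Prop := ∃ v ∈ A n d k, D n v = 0 ∧ v ≠ 0

lemma Cov.mul {n : ℕ} {d k d' k' : ℤ} : Cov n d k → Cov n d' k' → Cov n (d + d') (k + k') := by
  rintro ⟨v, h1, h2, h3⟩ ⟨v', h1', h2', h3'⟩
  refine ⟨v * v', ?_, ?_, mul_ne_zero h3 h3'⟩
  · exact IsWeightedHomogeneous.mul h1 h1'
  · simp [Derivation.leibniz, h2, h2']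

lemma Cov_zero (n d : ℕ) : Cov n d 0 := by
  refine ⟨X 0 ^ d, ?_, ?_, pow_ne_zero _ (X_ne_zero _)⟩
  · have := (isWeightedHomogeneous_X ℚ (wt n) 0).pow d
    simpa [wt] using this
  · simp [Derivation.leibniz_pow, D, mkDerivation_X, dX]

lemma Cov_of_lt {n : ℕ} {d k : ℤ} (h : (expSet n d (k-1)).ncard < (expSet n d k).ncard) :
    Cov n d k := by
  rw [← finrank_A, ← finrank_A] at h
  have := LinearMap.ker_ne_bot_of_finrank_lt (f := Dk n d k) h
  obtain ⟨x, h0, hx⟩ := (Submodule.ne_bot_iff _).1 this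
  exact ⟨x.1, x.2, congrArg Subtype.val h0, fun h => hx (Subtype.ext h)⟩

lemma lt_of_Cov {n : ℕ} {d k : ℤ} (h2 : 2 * k ≤ n * d) (h : Cov n d k) :
    (expSet n d (k-1)).ncard < (expSet n d k).ncard := by
  rw [← finrank_A, ← finrank_A]
  have h3 := LinearMap.finrank_range_add_finrank_ker (Dk n d k)
  rw [LinearMap.range_eq_top.2 (Dk_surj h2), finrank_top] at h3
  have : 0 < Module.finrank ℚ (LinearMap.ker (Dk n d k)) := by
    obtain ⟨v, h1, h2, h3⟩ := h
    have hv : (⟨v, h1⟩ : A n d k) ∈ LinearMap.ker (Dk n d k) := by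
      rw [LinearMap.mem_ker]; exact Subtype.ext h2
    refine (Module.finrank_pos_iff_exists_ne_zero (R := ℚ) (M := LinearMap.ker (Dk n d k))).2
      ⟨(⟨_, hv⟩ : LinearMap.ker (Dk n d k)), ?_⟩
    intro h; apply h3
    exact congrArg (fun x => x.1.1) h
  omega

end
end GB
namespace GB
/-! lists -/
def addL : List ℕ → List ℕ → List ℕ
  | [], b => b
  | a :: as, [] => a :: as
  | a :: as, b :: bs => (a + b) :: addL as bs
def shL : ℕ → List ℕ → List ℕ
  | 0, L => L
  | n+1, L => 0 :: shL n L
def aux : List ℕ → ℕ → List (List ℕ) → List (List ℕ)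
  | _, _, [] => []
  | cur, n, h :: t => addL cur (shL n h) :: aux (addL cur (shL n h)) (n+1) t
def nextRow : List (List ℕ) → List (List ℕ)
  | [] => []
  | _ :: t => [1] :: aux [1] 1 t
def row : ℕ → List (List ℕ)
  | 0 => List.replicate 16 [1]
  | d+1 => nextRow (row d)
def inc : ℕ → List ℕ → Bool
  | 0, _ => true
  | c+1, a :: b :: t => Nat.blt a b && inc c (b :: t)
  | _, _ => false
def chkL (d n : ℕ) (L : List ℕ) : Bool := inc (d * n / 2 - 1) L.tail
def chkRow (d : ℕ) : ℕ → List (List ℕ) → Bool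
  | _, [] => true
  | n, h :: t => (Nat.blt n 8 || chkL d n h) && chkRow d (n+1) t
def chkAll : ℕ → ℕ → List (List ℕ) → Bool
  | 0, _, _ => true
  | c+1, d, r => (Nat.blt d 8 || chkRow d 0 r) && chkAll c (d+1) (nextRow r)
theorem T : chkAll 16 0 (row 0) = true := by decide +kernel
end GB
namespace GB
open Polynomial in
/-- padded multisets -/
def R (d n k : ℕ) : Set (Multiset ℕ) := {M | M.card = d ∧ M.sum = k ∧ ∀ x ∈ M, x ≤ n}

lemma R_zero (n k : ℕ) : R 0 n k = if k = 0 then {0} else ∅ := by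
  ext M
  split_ifs with h
  · subst h
    simp only [R, Set.mem_ofPred_eq, Multiset.card_eq_zero, Set.mem_singleton_iff]
    constructor
    · exact fun h => h.1
    · rintro rfl; simp
  · simp only [R, Set.mem_ofPred_eq, Multiset.card_eq_zero, Set.mem_empty_iff_false, iff_false]
    rintro ⟨rfl, h1, _⟩
    simp at h1; omega

lemma R_z (d k : ℕ) : R d 0 k = if k = 0 then {Multiset.replicate d 0} else ∅ := by
  have key : ∀ M : Multiset ℕ, M.card = d → (∀ x ∈ M, x ≤ 0) → M = Multiset.replicate d 0 := by
    intro M h1 h2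
    exact Multiset.eq_replicate.2 ⟨h1, fun b hb => Nat.le_zero.1 (h2 b hb)⟩
  ext M
  split_ifs with h
  · subst h
    simp only [R, Set.mem_ofPred_eq, Set.mem_singleton_iff]
    constructor
    · exact fun h => key M h.1 h.2.2
    · rintro rfl
      refine ⟨by simp, by simp, fun x hx => (Multiset.eq_of_mem_replicate hx).le⟩
  · simp only [R, Set.mem_ofPred_eq, Set.mem_empty_iff_false, iff_false]
    rintro ⟨h1, h2, h3⟩
    rw [key M h1 h3] at h2
    simp at h2; omega

lemma R_succ (d n k : ℕ) : R (d+1) (n+1) k = R (d+1) n k ∪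
    (if n + 1 ≤ k then (fun M => (n+1) ::ₘ M) '' R d (n+1) (k - (n+1)) else ∅) := by
  ext M
  simp only [Set.mem_union]
  constructor
  · rintro ⟨h1, h2, h3⟩
    by_cases h : n + 1 ∈ M
    · right
      obtain ⟨M', rfl⟩ := Multiset.exists_cons_of_mem h
      simp only [Multiset.card_cons, Multiset.sum_cons] at h1 h2
      rw [if_pos (by omega)]
      exact ⟨M', ⟨by omega, by omega, fun x hx => h3 x (Multiset.mem_cons_of_mem hx)⟩, rfl⟩
    · left
      refine ⟨h1, h2, fun x hx => ?_⟩
      have := h3 x hx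
      have : x ≠ n + 1 := fun e => h (e ▸ hx)
      omega
  · rintro (⟨h1, h2, h3⟩ | h)
    · exact ⟨h1, h2, fun x hx => (h3 x hx).trans (by omega)⟩
    · split_ifs at h with hk
      · obtain ⟨M', ⟨h1, h2, h3⟩, rfl⟩ := h
        refine ⟨by simp [h1], by simp [h2]; omega, ?_⟩
        intro x hx
        rcases Multiset.mem_cons.1 hx with rfl | hx
        · exact le_rfl
        · exact h3 x hx
      · exact h.elim

lemma R_finite (d n k : ℕ) : (R d n k).Finite := by
  induction d generalizing n k with
  | zero => rw [R_zero]; split_ifs <;> simp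
  | succ d ih =>
    induction n generalizing k with
    | zero => rw [R_z]; split_ifs <;> simp
    | succ n ih2 =>
      rw [R_succ]
      refine (ih2 k).union ?_
      split_ifs
      · exact (ih _ _).image _
      · exact Set.finite_empty

noncomputable def N (d n k : ℕ) : ℕ := (R d n k).ncard

lemma N_zero (n k : ℕ) : N 0 n k = if k = 0 then 1 else 0 := by
  rw [N, R_zero]; split_ifs <;> simp
lemma N_z (d k : ℕ) : N d 0 k = if k = 0 then 1 else 0 := by
  rw [N, R_z]; split_ifs <;> simp
lemma N_succ (d n k : ℕ) : N (d+1) (n+1) k = N (d+1) n k +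
    (if n + 1 ≤ k then N d (n+1) (k - (n+1)) else 0) := by
  rw [N, R_succ]
  split_ifs with h
  · rw [Set.ncard_union_eq _ (R_finite _ _ _) ((R_finite _ _ _).image _),
      Set.ncard_image_of_injective]
    · rfl
    · intro a b hab; simpa using hab
    · rw [Set.disjoint_left]
      rintro M ⟨_, _, h3⟩ ⟨M', _, rfl⟩
      have := h3 (n+1) (Multiset.mem_cons_self _ _)
      omega
  · simp [N]

open Polynomial in
noncomputable def G : ℕ → ℕ → ℤ[X]
  | 0, _ => 1
  | _+1, 0 => 1
  | d+1, n+1 => G (d+1) n + G d (n+1) * X ^ (n+1)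

lemma G_coeff (d n k : ℕ) : (G d n).coeff k = N d n k := by
  induction d generalizing n k with
  | zero => rw [N_zero, G, Polynomial.coeff_one]; split_ifs <;> simp
  | succ d ih =>
    induction n generalizing k with
    | zero => rw [N_z, G, Polynomial.coeff_one]; split_ifs <;> simp
    | succ n ih2 =>
      rw [N_succ, G, Polynomial.coeff_add, ih2, Polynomial.coeff_mul_X_pow']
      split_ifs <;> simp [ih]

open Polynomial in
noncomputable def F : ℕ → ℤ[X]
  | 0 => 1
  | n+1 => F n * (1 - X ^ (n+1))

open Polynomial in
lemma F_ne (n : ℕ) : F n ≠ 0 := by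
  induction n with
  | zero => simp [F]
  | succ n ih =>
    rw [F]
    refine mul_ne_zero ih ?_
    intro h
    have := congrArg (fun P : ℤ[X] => P.coeff 0) h
    simp at this

open Polynomial in
lemma G_F (d n : ℕ) : G d n * (F d * F n) = F (d + n) := by
  induction d generalizing n with
  | zero => simp [G, F]
  | succ d ih =>
    induction n with
    | zero => simp [G, F]
    | succ n ih2 =>
      have h1 := ih (n+1)
      have e1 : d + 1 + (n + 1) = (d + 1 + n) + 1 := by omega
      have e2 : d + (n + 1) = d + 1 + n := by omega
      rw [e2] at h1
      rw [e1, G]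
      have hF : F (d + 1 + n + 1) = F (d+1+n) * (1 - X ^ (d+1+n+1)) := rfl
      have hF1 : F (d + 1) = F d * (1 - X ^ (d+1)) := rfl
      have hF2 : F (n + 1) = F n * (1 - X ^ (n+1)) := rfl
      calc _ = (G (d+1) n * (F (d+1) * F n)) * (1 - X^(n+1)) +
            (G d (n+1) * (F d * F (n+1))) * (X ^ (n+1) * (1 - X ^ (d+1))) := by
              rw [hF1, hF2]; ring
        _ = _ := by rw [ih2, h1, hF]; ring

lemma N_symm (d n k : ℕ) : N d n k = N n d k := by
  have : G d n = G n d := by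
    apply mul_right_cancel₀ (mul_ne_zero (F_ne d) (F_ne n))
    rw [G_F, mul_comm (F d), G_F, add_comm]
  have h := G_coeff d n k
  rw [this, G_coeff] at h
  exact_mod_cast h.symm

lemma expSet_ncard (n d k : ℕ) : (expSet n d k).ncard = N d n k := by
  let f : (Fin (n+1) →₀ ℕ) → Multiset ℕ := fun s => (Finsupp.toMultiset s).map Fin.val
  have hf : Function.Injective f := fun a b h =>
    (Multiset.toFinsupp (α := Fin (n+1))).symm.injective (Multiset.map_injective Fin.val_injective h)
  rw [← Set.ncard_image_of_injective _ hf, N]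
  congr 1
  have hc : ∀ s, (f s).card = ∑ i, s i := by
    intro s
    simp only [f, Multiset.card_map, Finsupp.card_toMultiset]
    rw [Finsupp.sum_fintype _ _ (by simp)]
    rfl
  have hs : ∀ s, (f s).sum = ∑ i, s i * (i : ℕ) := by
    intro s
    simp only [f, Finsupp.toMultiset_map, Finsupp.sum_toMultiset]
    rw [Finsupp.sum_mapDomain_index (by simp) (by intros; ring)]
    rw [Finsupp.sum_fintype _ _ (by simp)]
    simp
  ext M
  constructor
  · rintro ⟨s, h, rfl⟩
    rw [expSet, Set.mem_ofPred_eq, weight_eq, Prod.mk.injEq] at h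
    refine ⟨?_, ?_, ?_⟩
    · rw [hc]; exact_mod_cast h.1
    · rw [hs]; exact_mod_cast h.2
    · intro x hx
      obtain ⟨i, _, rfl⟩ := Multiset.mem_map.1 hx
      omega
  · rintro ⟨h1, h2, h3⟩
    have : ∃ s, f s = M := by
      refine ⟨Multiset.toFinsupp (M.map (Fin.ofNat (n+1))), ?_⟩
      simp only [f, Multiset.toFinsupp_toMultiset, Multiset.map_map]
      conv_rhs => rw [← Multiset.map_id M]
      refine Multiset.map_congr rfl fun x hx => ?_
      simp only [Function.comp, Fin.val_ofNat, id]
      exact Nat.mod_eq_of_lt (by have := h3 x hx; omega)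
    obtain ⟨s, rfl⟩ := this
    refine ⟨s, ?_, rfl⟩
    rw [expSet, Set.mem_ofPred_eq, weight_eq, ← hc, ← hs, h1, h2]

lemma p_eq (k d n : ℕ) : p k d n = N d n k := by
  rw [p, N, ← Nat.card_coe_set_eq, ← Nat.card_eq_fintype_card]
  have hfil : ∀ M : Multiset ℕ, M.filter (· ≠ 0) + Multiset.replicate (M.card -
      (M.filter (· ≠ 0)).card) 0 = M := by
    intro M
    have h1 := Multiset.filter_add_not (· ≠ 0) M
    have h2 := congrArg Multiset.card h1
    rw [Multiset.card_add] at h2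
    conv_rhs => rw [← h1]
    congr 1
    symm
    rw [Multiset.eq_replicate]
    refine ⟨by omega, fun b hb => ?_⟩
    have := Multiset.of_mem_filter hb
    omega
  refine Nat.card_congr ⟨fun π => ⟨π.1.parts + Multiset.replicate (d - π.1.parts.card) 0, ?_⟩,
    fun M => ⟨Nat.Partition.ofSums k M.1 M.2.2.1, ?_⟩, ?_, ?_⟩
  · obtain ⟨π, h1, h2⟩ := π
    refine ⟨by simp; omega, by simp [π.parts_sum], fun x hx => ?_⟩
    rcases Multiset.mem_add.1 hx with h | h
    · exact h2 x h
    · rw [Multiset.eq_of_mem_replicate h]; omega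
  · obtain ⟨M, h1, h2, h3⟩ := M
    refine ⟨?_, ?_⟩
    · exact (Multiset.card_le_card (Multiset.filter_le _ _)).trans h1.le
    · intro x hx; exact h3 x (Multiset.mem_of_mem_filter hx)
  · rintro ⟨π, h1, h2⟩
    apply Subtype.ext
    apply Nat.Partition.ext
    change Multiset.filter (· ≠ 0) _ = _
    rw [Multiset.filter_add, Multiset.filter_eq_self.2, Multiset.filter_eq_nil.2, add_zero]
    · intro a ha
      simp [Multiset.eq_of_mem_replicate ha]
    · intro a ha; exact (π.parts_pos ha).ne'
  · rintro ⟨M, h1, h2, h3⟩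
    apply Subtype.ext
    change Multiset.filter (· ≠ 0) M + Multiset.replicate (d -
      (M.filter (· ≠ 0)).card) 0 = M
    rw [← h1]
    exact hfil M

/-! correctness of lists -/
lemma addL_getD (a b : List ℕ) (k : ℕ) : (addL a b).getD k 0 = a.getD k 0 + b.getD k 0 := by
  induction a generalizing b k with
  | nil => simp [addL]
  | cons x xs ih =>
    cases b with
    | nil => simp [addL]
    | cons y ys =>
      cases k with
      | zero => simp [addL]
      | succ k =>
        simp only [addL, List.getD_cons_succ]
        exact ih ys k

lemma shL_getD (n : ℕ) (L : List ℕ) (k : ℕ) :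
    (shL n L).getD k 0 = if n ≤ k then L.getD (k - n) 0 else 0 := by
  induction n generalizing k with
  | zero => simp [shL]
  | succ n ih =>
    cases k with
    | zero => simp [shL]
    | succ k =>
      simp only [shL, List.getD_cons_succ]
      rw [ih]
      simp

def RowOK (d : ℕ) : ℕ → List (List ℕ) → Prop
  | _, [] => True
  | n, h :: t => (∀ k, h.getD k 0 = N d n k) ∧ RowOK d (n+1) t

lemma aux_ok (d n : ℕ) (t : List (List ℕ)) (cur : List ℕ)
    (hc : ∀ k, cur.getD k 0 = N (d+1) n k) (ht : RowOK d (n+1) t) :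
    RowOK (d+1) (n+1) (aux cur (n+1) t) := by
  induction t generalizing n cur with
  | nil => trivial
  | cons h t ih =>
    obtain ⟨h1, h2⟩ := ht
    have : ∀ k, (addL cur (shL (n+1) h)).getD k 0 = N (d+1) (n+1) k := by
      intro k
      rw [addL_getD, shL_getD, N_succ, hc, h1]
    exact ⟨this, ih (n+1) _ this h2⟩

lemma one_getD (k : ℕ) : [1].getD k 0 = if k = 0 then 1 else 0 := by
  cases k <;> simp

lemma nextRow_ok (d : ℕ) (r : List (List ℕ)) (h : RowOK d 0 r) : RowOK (d+1) 0 (nextRow r) := by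
  cases r with
  | nil => trivial
  | cons x t =>
    have : ∀ k, [1].getD k 0 = N (d+1) 0 k := fun k => by rw [one_getD, N_z]
    exact ⟨this, aux_ok d 0 t _ this h.2⟩

lemma row0_ok (c n : ℕ) : RowOK 0 n (List.replicate c [1]) := by
  induction c generalizing n with
  | zero => trivial
  | succ c ih => exact ⟨fun k => by rw [one_getD, N_zero], ih _⟩

lemma inc_ok (c : ℕ) (L : List ℕ) (h : inc c L = true) (i : ℕ) (hi : i < c) :
    L.getD i 0 < L.getD (i+1) 0 := by
  induction c generalizing L i with
  | zero => omega
  | succ c ih =>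
    match L, h with
    | a :: b :: t, h =>
      simp only [inc, Bool.and_eq_true, Nat.blt_eq] at h
      cases i with
      | zero => simpa using h.1
      | succ i =>
        have := ih (b :: t) h.2 i (by omega)
        simpa only [List.getD_cons_succ] using this

def Strict (d n : ℕ) : Prop := ∀ k, 2 ≤ k → 2 * k ≤ d * n → N d n (k - 1) < N d n k

lemma chkL_ok (d n : ℕ) (L : List ℕ) (h : chkL d n L = true) (hL : ∀ k, L.getD k 0 = N d n k) :
    Strict d n := by
  intro k h2 hk
  obtain ⟨k, rfl⟩ : ∃ j, k = j + 2 := ⟨k - 2, by omega⟩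
  have := inc_ok _ _ h k (by omega)
  rw [show k + 2 - 1 = k + 1 by omega, ← hL, ← hL]
  cases L with
  | nil => simp at this
  | cons a t => simpa only [List.getD_cons_succ, List.tail_cons] using this

lemma chkRow_ok (d n : ℕ) (r : List (List ℕ)) (h : chkRow d n r = true) (hr : RowOK d n r)
    (m : ℕ) (h1 : n ≤ m) (h2 : m < n + r.length) (h8 : 8 ≤ m) : Strict d m := by
  induction r generalizing n with
  | nil => simp at h2; omega
  | cons x t ih =>
    simp only [chkRow, Bool.and_eq_true, Bool.or_eq_true, Nat.blt_eq] at h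
    obtain ⟨ha, hb⟩ := h
    rcases Nat.eq_or_lt_of_le h1 with rfl | h1
    · exact chkL_ok _ _ x (ha.resolve_left (by omega)) hr.1
    · exact ih (n+1) hb hr.2 h1 (by simp at h2; omega)

lemma aux_length (t : List (List ℕ)) (cur : List ℕ) (n : ℕ) : (aux cur n t).length = t.length := by
  induction t generalizing cur n with
  | nil => rfl
  | cons h t ih => simp [aux, ih]

lemma nextRow_length (r : List (List ℕ)) : (nextRow r).length = r.length := by
  cases r <;> simp [nextRow, aux_length]

lemma chkAll_ok (c d : ℕ) (r : List (List ℕ)) (h : chkAll c d r = true) (hr : RowOK d 0 r)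
    (hl : r.length = 16) (l m : ℕ) (h1 : d ≤ l) (h2 : l < d + c) (hl8 : 8 ≤ l) (hm8 : 8 ≤ m)
    (hm : m < 16) : Strict l m := by
  induction c generalizing d r with
  | zero => omega
  | succ c ih =>
    simp only [chkAll, Bool.and_eq_true, Bool.or_eq_true, Nat.blt_eq] at h
    obtain ⟨ha, hb⟩ := h
    rcases Nat.eq_or_lt_of_le h1 with rfl | h1
    · exact chkRow_ok _ 0 r (ha.resolve_left (by omega)) hr m (by omega) (by omega) hm8
    · exact ih (d+1) _ hb (nextRow_ok d r hr) (by rw [nextRow_length, hl]) h1 (by omega)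

lemma base (l m : ℕ) (h1 : 8 ≤ l) (h2 : l < 16) (h3 : 8 ≤ m) (h4 : m < 16) : Strict l m :=
  chkAll_ok 16 0 _ T (row0_ok 16 0) (by simp [row]) l m (by omega) (by omega) h1 h3 h4

lemma Strict.cov {d n : ℕ} (h : Strict d n) (k : ℕ) (hk : k ≠ 1) (h2 : 2 * k ≤ d * n) :
    Cov n d k := by
  rcases Nat.eq_zero_or_pos k with rfl | h0
  · exact_mod_cast Cov_zero n d
  · apply Cov_of_lt
    have : (k : ℤ) - 1 = ((k - 1 : ℕ) : ℤ) := by omega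
    rw [this, expSet_ncard, expSet_ncard]
    exact h k (by omega) h2

lemma Strict.add8 {d n : ℕ} (hn : 8 ≤ n) (hd : 8 ≤ d) (h : Strict d n) (h8 : Strict 8 n) :
    Strict (8 + d) n := by
  intro k h2 hk
  have hc : Cov n ((8 + d : ℕ) : ℤ) k := by
    obtain ⟨a, b, rfl, ha, hb, ha2, hb2⟩ : ∃ a b : ℕ, k = a + b ∧ a ≠ 1 ∧ b ≠ 1 ∧
        2 * a ≤ 8 * n ∧ 2 * b ≤ d * n := by
      rw [add_mul] at hk
      have : 8 * 8 ≤ d * n := Nat.mul_le_mul hd hn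
      by_cases hA : k ≤ 4 * n
      · exact ⟨k, 0, by omega, by omega, by omega, by omega, by omega⟩
      · by_cases hB : k = 4 * n + 1
        · exact ⟨k - 2, 2, by omega, by omega, by omega, by omega, by omega⟩
        · exact ⟨4 * n, k - 4 * n, by omega, by omega, by omega, by omega, by omega⟩
    have := (h8.cov a ha ha2).mul (h.cov b hb hb2)
    exact_mod_cast this
  have := lt_of_Cov (by rw [mul_comm (n : ℤ)]; exact_mod_cast hk) hc
  have e : (k : ℤ) - 1 = ((k - 1 : ℕ) : ℤ) := by omega
  rwa [e, expSet_ncard, expSet_ncard] at this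

lemma Strict.symm {d n : ℕ} (h : Strict d n) : Strict n d := by
  intro k h2 hk
  rw [N_symm n d, N_symm n d]
  exact h k h2 (by rwa [mul_comm d])

lemma ext8 (n : ℕ) (hn : 8 ≤ n) (h : ∀ d, 8 ≤ d → d < 16 → Strict d n) (d : ℕ) (hd : 8 ≤ d) :
    Strict d n := by
  induction d using Nat.strong_induction_on with
  | _ d ih =>
    by_cases h16 : d < 16
    · exact h d hd h16
    · have := (ih (d - 8) (by omega) (by omega)).add8 hn (by omega) (h 8 le_rfl (by omega))
      rwa [show 8 + (d - 8) = d by omega] at this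

lemma main (l m : ℕ) (hl : 8 ≤ l) (hm : 8 ≤ m) : Strict l m :=
  ext8 m hm (fun d h1 h2 => (ext8 d h1 (fun e h3 h4 => base e d h3 h4 h1 h2) m hm).symm) l hl

end GB

theorem stmt_2 (l m k : ℕ) (hl : 8 ≤ l) (hm : 8 ≤ m) (hk2 : 2 ≤ k) (hk : 2 * k ≤ l * m) :
    (p k l m : ℤ) - p (k - 1) l m ≥ 1 := by
  have := GB.main l m hl hm k hk2 hk
  rw [GB.p_eq, GB.p_eq]
  omega
end

section
/- (Unimodality part of Stanley's theorem.) For every positive integer n and every integer k with 1 ≤ k ≤ ⌊n²/2⌋, we have p_k(n,n) − b_k(n) ≥ p_{k−1}(n,n) − b_{k−1}(n), where the differences are taken in ℤ. -/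
/-- `b k n`: the coefficient of `q^k` in `∏_{i=1}^{n} (1 + q^(2i-1))`, i.e. the number of
partitions of `k` into distinct odd parts each at most `2n-1`. -/
noncomputable def b (k n : ℕ) : ℕ :=
  (∏ i ∈ Finset.range n, (1 + (Polynomial.X : Polynomial ℕ) ^ (2 * i + 1))).coeff k

namespace St
open Finset

def sg (i : ℕ) (T : Finset ℕ) : Finset ℕ := T.map (Equiv.swap i (i+1)).toEmbedding

lemma mem_sg (i j : ℕ) (T : Finset ℕ) : j ∈ sg i T ↔ Equiv.swap i (i+1) j ∈ T := by
  unfold sg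
  rw [Finset.mem_map_equiv, Equiv.symm_swap]

lemma sg_sg (i : ℕ) (T : Finset ℕ) : sg i (sg i T) = T := by
  ext j; simp [mem_sg]

lemma sg_comm {i j : ℕ} (h : i + 1 < j ∨ j + 1 < i) (T : Finset ℕ) :
    sg i (sg j T) = sg j (sg i T) := by
  ext x; simp only [mem_sg, Equiv.swap_apply_def]
  grind

def Om (n M : ℕ) : Finset (Finset ℕ) := powersetCard n (range (M+1))

lemma sg_mem {n M i : ℕ} (hi : i < M) {T : Finset ℕ} (hT : T ∈ Om n M) : sg i T ∈ Om n M := by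
  unfold Om at *
  rw [mem_powersetCard] at *
  refine ⟨?_, by simpa [sg] using hT.2⟩
  intro x hx
  rw [mem_sg] at hx
  have := hT.1 hx
  simp only [mem_range, Equiv.swap_apply_def] at *
  grind

noncomputable def aw (M i : ℕ) : ℝ := Real.sqrt (((i:ℝ)+1) * ((M:ℝ)-i))

noncomputable def UU (M : ℕ) (f : Finset ℕ → ℝ) (T : Finset ℕ) : ℝ :=
  ∑ i ∈ range M, aw M i * (if i + 1 ∈ T ∧ i ∉ T then f (sg i T) else 0)

noncomputable def DD (M : ℕ) (f : Finset ℕ → ℝ) (T : Finset ℕ) : ℝ :=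
  ∑ i ∈ range M, aw M i * (if i ∈ T ∧ i + 1 ∉ T then f (sg i T) else 0)

noncomputable def ind (i : ℕ) (T : Finset ℕ) : ℝ := if i ∈ T then 1 else 0

lemma pair_eq (n M i j : ℕ) (hi : i < M) (hj : j < M) (hij : i ≠ j) (f : Finset ℕ → ℝ) :
    ∑ T ∈ Om n M, (aw M i * (if i + 1 ∈ T ∧ i ∉ T then f (sg i T) else 0)) *
      (aw M j * (if j + 1 ∈ T ∧ j ∉ T then f (sg j T) else 0)) =
    ∑ T ∈ Om n M, (aw M i * (if i ∈ T ∧ i + 1 ∉ T then f (sg i T) else 0)) *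
      (aw M j * (if j ∈ T ∧ j + 1 ∉ T then f (sg j T) else 0)) := by
  by_cases h : i + 1 < j ∨ j + 1 < i
  · refine Finset.sum_nbij' (fun T => sg i (sg j T)) (fun T => sg i (sg j T)) ?_ ?_ ?_ ?_ ?_
    · intro T hT; exact sg_mem hi (sg_mem hj hT)
    · intro T hT; exact sg_mem hi (sg_mem hj hT)
    · intro T hT; simp only [sg_comm h, sg_sg]
    · intro T hT; simp only [sg_comm h, sg_sg]
    · intro T hT
      have e1 : sg i (sg i (sg j T)) = sg j T := sg_sg _ _
      have e2 : sg j (sg i (sg j T)) = sg i T := by rw [sg_comm h, sg_sg]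
      simp only [e1, e2]
      have m1 : i ∈ sg i (sg j T) ↔ i + 1 ∈ T := by
        simp only [mem_sg, Equiv.swap_apply_def]; grind
      have m2 : i + 1 ∈ sg i (sg j T) ↔ i ∈ T := by
        simp only [mem_sg, Equiv.swap_apply_def]; grind
      have m3 : j ∈ sg i (sg j T) ↔ j + 1 ∈ T := by
        simp only [mem_sg, Equiv.swap_apply_def]; grind
      have m4 : j + 1 ∈ sg i (sg j T) ↔ j ∈ T := by
        simp only [mem_sg, Equiv.swap_apply_def]; grind
      simp only [m1, m2, m3, m4]
      split_ifs <;> ring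
  · have : i = j + 1 ∨ j = i + 1 := by omega
    apply Finset.sum_congr rfl
    intro T _
    rcases this with rfl | rfl
    · by_cases h1 : j + 1 ∈ T <;> simp [h1]
    · by_cases h1 : i + 1 ∈ T <;> simp [h1]

lemma diag_eq (n M i : ℕ) (hi : i < M) (f : Finset ℕ → ℝ) :
    ∑ T ∈ Om n M, (aw M i * (if i + 1 ∈ T ∧ i ∉ T then f (sg i T) else 0)) *
      (aw M i * (if i + 1 ∈ T ∧ i ∉ T then f (sg i T) else 0)) =
    ∑ T ∈ Om n M, (aw M i * (if i ∈ T ∧ i + 1 ∉ T then f (sg i T) else 0)) *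
      (aw M i * (if i ∈ T ∧ i + 1 ∉ T then f (sg i T) else 0)) +
    ∑ T ∈ Om n M, (((i:ℝ)+1) * ((M:ℝ)-i)) * (ind i T - ind (i+1) T) * (f T)^2 := by
  have haw : aw M i * aw M i = ((i:ℝ)+1) * ((M:ℝ)-i) := by
    apply Real.mul_self_sqrt
    have : (i:ℝ) ≤ M := by exact_mod_cast hi.le
    have : (0:ℝ) ≤ M - i := by linarith
    positivity
  have key : ∀ (P Q : Finset ℕ → Prop) [DecidablePred P] [DecidablePred Q],
      (∀ T, P (sg i T) ↔ Q T) → ∑ T ∈ Om n M, (aw M i * (if P T then f (sg i T) else 0)) *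
      (aw M i * (if P T then f (sg i T) else 0)) =
      ∑ T ∈ Om n M, (((i:ℝ)+1) * ((M:ℝ)-i)) * (if Q T then 1 else 0) * (f T)^2 := by
    intro P Q _ _ hPQ
    refine Finset.sum_nbij' (fun T => sg i T) (fun T => sg i T) ?_ ?_ ?_ ?_ ?_
    · intro T hT; exact sg_mem hi hT
    · intro T hT; exact sg_mem hi hT
    · intro T hT; exact sg_sg _ _
    · intro T hT; exact sg_sg _ _
    · intro T hT
      have := hPQ (sg i T)
      rw [sg_sg] at this
      simp only [← this]
      rw [← haw]
      split_ifs <;> ring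
  rw [key (fun T => i + 1 ∈ T ∧ i ∉ T) (fun T => i ∈ T ∧ i + 1 ∉ T) (by intro T; simp [mem_sg]),
    key (fun T => i ∈ T ∧ i + 1 ∉ T) (fun T => i + 1 ∈ T ∧ i ∉ T) (by intro T; simp [mem_sg]),
    ← Finset.sum_add_distrib]
  apply Finset.sum_congr rfl
  intro T _
  unfold ind
  by_cases h1 : i ∈ T <;> by_cases h2 : i + 1 ∈ T <;> simp [h1, h2]

lemma norm_eq (n M : ℕ) (f : Finset ℕ → ℝ) :
    ∑ T ∈ Om n M, (UU M f T)^2 = ∑ T ∈ Om n M, (DD M f T)^2 +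
      ∑ T ∈ Om n M, (∑ i ∈ range M, (((i:ℝ)+1) * ((M:ℝ)-i)) * (ind i T - ind (i+1) T)) * (f T)^2 := by
  simp only [UU, DD, pow_two (Finset.sum _ _), Finset.sum_mul_sum]
  rw [Finset.sum_comm, Finset.sum_comm (s := Om n M) (t := range M)]
  simp only [Finset.sum_mul]
  rw [Finset.sum_comm (s := Om n M) (t := range M), ← Finset.sum_add_distrib]
  apply Finset.sum_congr rfl
  intro i hi
  rw [Finset.sum_comm, Finset.sum_comm (s := Om n M) (t := range M)]
  rw [← Finset.add_sum_erase _ _ hi, ← Finset.add_sum_erase (range M) _ hi]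
  rw [diag_eq n M i (mem_range.1 hi)]
  rw [Finset.sum_congr rfl (fun j hj => pair_eq n M i j (mem_range.1 hi)
    (mem_range.1 (Finset.mem_of_mem_erase hj)) (Finset.ne_of_mem_erase hj).symm f)]
  ring

lemma abel (M : ℕ) (T : Finset ℕ) (x : ℝ) (m : ℕ) :
    ∑ i ∈ range m, (((i:ℝ)+1) * (x-i)) * (ind i T - ind (i+1) T) =
    ∑ i ∈ range (m+1), (x - 2 * i) * ind i T - (m+1)*(x-m) * ind m T := by
  induction m with
  | zero => simp
  | succ m ih =>
    rw [Finset.sum_range_succ, ih, Finset.sum_range_succ _ (m+1)]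
    push_cast
    ring

lemma wt_eq (n M : ℕ) (T : Finset ℕ) (hT : T ∈ Om n M) :
    ∑ i ∈ range M, (((i:ℝ)+1) * ((M:ℝ)-i)) * (ind i T - ind (i+1) T) =
     n * M - 2 * ((∑ i ∈ T, i : ℕ) : ℝ) := by
  rw [abel M]
  simp only [sub_self, mul_zero, zero_mul, sub_zero]
  unfold Om at hT
  rw [mem_powersetCard] at hT
  simp only [ind, mul_ite, mul_one, mul_zero]
  rw [← Finset.sum_filter, Finset.filter_mem_eq_inter, Finset.inter_eq_right.2 hT.1,
    Finset.sum_sub_distrib, ← Finset.mul_sum, Finset.sum_const, hT.2]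
  push_cast
  simp

lemma inj (n M s : ℕ) (hs : 2 * s < n * M) (f : Finset ℕ → ℝ)
    (hf : ∀ T ∈ Om n M, ∑ i ∈ T, i ≠ s → f T = 0)
    (hU : ∀ T ∈ Om n M, UU M f T = 0) : ∀ T ∈ Om n M, f T = 0 := by
  have h := norm_eq n M f
  rw [Finset.sum_eq_zero (fun T hT => by rw [hU T hT]; ring)] at h
  have h1 : 0 ≤ ∑ T ∈ Om n M, (DD M f T)^2 := Finset.sum_nonneg (fun _ _ => sq_nonneg _)
  have hs' : (2 * s : ℝ) < n * M := by exact_mod_cast hs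
  have h2 : ∑ T ∈ Om n M, (∑ i ∈ range M, (((i:ℝ)+1) * ((M:ℝ)-i)) * (ind i T - ind (i+1) T)) * (f T)^2
     = (n * M - 2 * s) * ∑ T ∈ Om n M, (f T)^2 := by
    rw [Finset.mul_sum]
    apply Finset.sum_congr rfl
    intro T hT
    rw [wt_eq n M T hT]
    by_cases hh : ∑ i ∈ T, i = s
    · rw [hh]
    · rw [hf T hT hh]; ring
  have h3 : 0 ≤ ∑ T ∈ Om n M, (f T)^2 := Finset.sum_nonneg (fun _ _ => sq_nonneg _)
  have h4 : ∑ T ∈ Om n M, (f T)^2 = 0 := by nlinarith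
  rw [Finset.sum_eq_zero_iff_of_nonneg (fun _ _ => sq_nonneg _)] at h4
  intro T hT
  exact pow_eq_zero_iff (two_ne_zero) |>.1 (h4 T hT)

def tau (M : ℕ) (T : Finset ℕ) : Finset ℕ := (range (M+1)).filter (fun i => M - i ∉ T)

lemma mem_tau (M : ℕ) (T : Finset ℕ) (i : ℕ) : i ∈ tau M T ↔ i ≤ M ∧ M - i ∉ T := by
  simp [tau, Nat.lt_succ_iff]

lemma tau_tau (M : ℕ) (T : Finset ℕ) (hT : T ⊆ range (M+1)) : tau M (tau M T) = T := by
  ext i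
  have := @hT i
  simp only [mem_tau, mem_range] at *
  by_cases h : i ≤ M
  · have : M - (M - i) = i := by omega
    simp [h, this]
  · grind

lemma card_filt (n M : ℕ) (T : Finset ℕ) (hT : T ⊆ range (M+1)) (g : ℕ → ℤ) :
   ∑ i ∈ tau M T, g i = ∑ i ∈ range (M+1), g i - ∑ i ∈ T, g (M - i) := by
  unfold tau
  have e : ∑ i ∈ T, g (M - i) = ∑ i ∈ range (M+1), if i ∈ T then g (M - i) else 0 := by
    rw [← Finset.sum_filter, Finset.filter_mem_eq_inter, Finset.inter_eq_right.2 hT]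
  rw [e, ← Finset.sum_range_reflect (fun i => if i ∈ T then g (M - i) else 0),
    Finset.sum_filter, ← Finset.sum_sub_distrib]
  apply Finset.sum_congr rfl
  intro i hi
  rw [mem_range] at hi
  have e1 : M + 1 - 1 - i = M - i := by omega
  have e2 : M - (M - i) = i := by omega
  simp only [e1, e2]
  split_ifs <;> simp

lemma tau_mem (n M : ℕ) (hM : M + 1 = 2 * n) (T : Finset ℕ) (hT : T ∈ Om n M) :
    tau M T ∈ Om n M := by
  unfold Om at *
  rw [mem_powersetCard] at *
  refine ⟨by unfold tau; exact Finset.filter_subset _ _, ?_⟩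
  have := card_filt n M T hT.1 (fun _ => 1)
  simp [hT.2] at this
  omega

lemma tau_sum (n M : ℕ) (hM : M + 1 = 2 * n) (T : Finset ℕ) (hT : T ∈ Om n M) :
    ∑ i ∈ tau M T, i = ∑ i ∈ T, i := by
  unfold Om at *
  rw [mem_powersetCard] at *
  have := card_filt n M T hT.1 (fun i => i)
  have e : ∑ i ∈ T, ((M - i : ℕ) : ℤ) = n * M - ∑ i ∈ T, (i:ℤ) := by
    rw [← hT.2, Finset.cast_card, Finset.sum_mul, ← Finset.sum_sub_distrib]
    apply Finset.sum_congr rfl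
    intro i hi
    have := hT.1 hi
    rw [mem_range] at this
    push_cast [Nat.lt_succ_iff.1 this]
    ring
  rw [e] at this
  have g := Finset.sum_range_id_mul_two (M+1)
  zify at g
  rw [hM] at g
  have hM' : (M:ℤ) = 2 * n - 1 := by omega
  zify
  rw [hM] at this
  have e3 : ((2 * n - 1 : ℕ):ℤ) = M := by omega
  rw [e3] at g
  push_cast at g
  have g2 : ((M:ℤ)+1)*M = 2*(n*M) := by
    rw [show (M:ℤ)+1 = 2*n by omega]; ring
  linarith

lemma UU_tau (n M : ℕ) (f : Finset ℕ → ℝ)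
    (hf : ∀ T ∈ Om n M, f (tau M T) = - f T) (T : Finset ℕ) (hT : T ∈ Om n M) :
    UU M f (tau M T) = - UU M f T := by
  unfold UU
  rw [← Finset.sum_range_reflect, ← Finset.sum_neg_distrib]
  apply Finset.sum_congr rfl
  intro i hi
  rw [mem_range] at hi
  have ea : aw M (M - 1 - i) = aw M i := by
    unfold aw
    congr 1
    have : ((M - 1 - i : ℕ):ℝ) = M - 1 - i := by
      rw [Nat.cast_sub (by omega), Nat.cast_sub (by omega)]; simp
    rw [this]; ring
  have e1 : M - 1 - i + 1 ∈ tau M T ↔ i ∉ T := by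
    rw [mem_tau, show M - (M - 1 - i + 1) = i by omega]
    simp; omega
  have e2 : M - 1 - i ∉ tau M T ↔ i + 1 ∈ T := by
    rw [mem_tau, show M - (M - 1 - i) = i + 1 by omega]
    simp; left; omega
  have e3 : sg (M - 1 - i) (tau M T) = tau M (sg i T) := by
    ext x
    simp only [mem_sg, mem_tau, Equiv.swap_apply_def]
    grind
  rw [ea]
  simp only [e1, e2, e3, hf _ (sg_mem hi hT)]
  by_cases h1 : i ∈ T <;> by_cases h2 : i + 1 ∈ T <;> simp [h1, h2]

def Os (n M s : ℕ) : Finset (Finset ℕ) := (Om n M).filter (fun T => ∑ i ∈ T, i = s)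
def Fx (n M s : ℕ) : Finset (Finset ℕ) := (Os n M s).filter (fun T => tau M T = T)
def Op (n M s : ℕ) : Finset (Finset ℕ) :=
  (Os n M s).filter (fun T => Encodable.encode T < Encodable.encode (tau M T))

lemma tau_Os (n M s : ℕ) (hM : M + 1 = 2 * n) (T : Finset ℕ) (hT : T ∈ Os n M s) :
    tau M T ∈ Os n M s := by
  simp only [Os, mem_filter] at *
  exact ⟨tau_mem n M hM T hT.1, by rw [tau_sum n M hM T hT.1, hT.2]⟩

lemma tt {n M : ℕ} {T : Finset ℕ} (hT : T ∈ Om n M) : tau M (tau M T) = T :=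
  tau_tau M T (mem_powersetCard.1 hT).1

lemma Os_card (n M s : ℕ) (hM : M + 1 = 2 * n) :
    (Os n M s).card = (Fx n M s).card + 2 * (Op n M s).card := by
  have h1 : ((Os n M s).filter (fun T => Encodable.encode (tau M T) < Encodable.encode T)).card
      = (Op n M s).card := by
    have ho : ∀ T ∈ Os n M s, tau M (tau M T) = T := fun T hT => tt (Finset.mem_filter.1 hT).1
    refine Finset.card_nbij' (tau M) (tau M) ?_ ?_ ?_ ?_
    · intro T hT
      simp only [Op, mem_coe, mem_filter] at *
      exact ⟨tau_Os n M s hM T hT.1, by rw [ho T hT.1]; exact hT.2⟩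
    · intro T hT
      simp only [Op, mem_coe, mem_filter] at *
      exact ⟨tau_Os n M s hM T hT.1, by rw [ho T hT.1]; exact hT.2⟩
    · intro T hT
      exact ho T (Finset.mem_filter.1 hT).1
    · intro T hT
      exact ho T (Finset.mem_filter.1 hT).1
  have h2 := Finset.card_filter_add_card_filter_not (s := Os n M s) (fun T => tau M T = T)
  have h3 := Finset.card_filter_add_card_filter_not (s := (Os n M s).filter (fun T => ¬ tau M T = T))
    (fun T => Encodable.encode T < Encodable.encode (tau M T))
  rw [Finset.filter_filter, Finset.filter_filter] at h3
  have e1 : (Os n M s).filter (fun T => ¬ tau M T = T ∧ Encodable.encode T < Encodable.encode (tau M T)) = Op n M s := by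
    unfold Op
    apply Finset.filter_congr
    intro T _
    constructor
    · exact fun h => h.2
    · intro h; refine ⟨fun h' => ?_, h⟩
      rw [h'] at h; exact lt_irrefl _ h
  have e2 : (Os n M s).filter (fun T => ¬ tau M T = T ∧ ¬ Encodable.encode T < Encodable.encode (tau M T)) =
     (Os n M s).filter (fun T => Encodable.encode (tau M T) < Encodable.encode T) := by
    apply Finset.filter_congr
    intro T _
    constructor
    · intro h
      refine lt_of_le_of_ne (not_lt.1 h.2) (fun h' => h.1 (Encodable.encode_injective h'))
    · intro h; refine ⟨fun h' => ?_, not_lt.2 h.le⟩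
      rw [h'] at h; exact lt_irrefl _ h
  rw [e1, e2, h1] at h3
  unfold Fx
  omega

noncomputable def ext (n M s : ℕ) (g : Op n M s → ℝ) (T : Finset ℕ) : ℝ :=
  (if h : T ∈ Op n M s then g ⟨T, h⟩ else 0) -
    (if h : tau M T ∈ Op n M s then g ⟨tau M T, h⟩ else 0)

noncomputable def L (n M s : ℕ) : (Op n M s → ℝ) →ₗ[ℝ] (Op n M (s+1) → ℝ) where
  toFun g := fun T => UU M (ext n M s g) T.1
  map_add' g g' := by
    funext T
    simp only [UU, Pi.add_apply, ← Finset.sum_add_distrib]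
    apply Finset.sum_congr rfl
    intro i _
    simp only [ext, Pi.add_apply]
    split_ifs <;> ring
  map_smul' c g := by
    funext T
    simp only [UU, Pi.smul_apply, smul_eq_mul, Finset.mul_sum, RingHom.id_apply]
    apply Finset.sum_congr rfl
    intro i _
    simp only [ext, Pi.smul_apply, smul_eq_mul]
    split_ifs <;> ring

lemma sg_sum (i : ℕ) (T : Finset ℕ) (h : i + 1 ∈ T) (h' : i ∉ T) :
    ∑ x ∈ T, x = ∑ x ∈ sg i T, x + 1 := by
  unfold sg
  rw [Finset.sum_map, ← Finset.add_sum_erase _ _ h,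
    ← Finset.add_sum_erase _ (fun x => (Equiv.swap i (i+1)).toEmbedding x) h]
  have : ∑ x ∈ T.erase (i+1), (Equiv.swap i (i+1)).toEmbedding x = ∑ x ∈ T.erase (i+1), x := by
    apply Finset.sum_congr rfl
    intro x hx
    simp only [Equiv.coe_toEmbedding]
    apply Equiv.swap_apply_of_ne_of_ne
    · rintro rfl; exact h' (Finset.mem_of_mem_erase hx)
    · exact Finset.ne_of_mem_erase hx
  rw [this]
  simp
  omega

lemma L_inj (n M s : ℕ) (hM : M + 1 = 2 * n) (hs : 2 * s < n * M) :
    Function.Injective (L n M s) := by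
  rw [← LinearMap.ker_eq_bot, LinearMap.ker_eq_bot']
  intro g hg
  have hanti : ∀ T ∈ Om n M, ext n M s g (tau M T) = - ext n M s g T := by
    intro T hT
    simp only [ext, tt hT]
    ring
  have hsupp : ∀ T ∈ Om n M, ∑ i ∈ T, i ≠ s → ext n M s g T = 0 := by
    intro T hT hne
    have h1 : T ∉ Op n M s := by simp [Op, Os, hne]
    have h2 : tau M T ∉ Op n M s := by simp [Op, Os, tau_sum n M hM T hT, hne]
    simp [ext, h1, h2]
  have h0 : ∀ T ∈ Op n M (s+1), UU M (ext n M s g) T = 0 := by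
    intro T hT
    exact congrFun hg ⟨T, hT⟩
  have hU : ∀ T ∈ Om n M, UU M (ext n M s g) T = 0 := by
    intro T hT
    by_cases hsum : ∑ i ∈ T, i = s + 1
    · have hTs : T ∈ Os n M (s+1) := Finset.mem_filter.2 ⟨hT, hsum⟩
      have hneg := UU_tau n M _ hanti T hT
      rcases lt_trichotomy (Encodable.encode T) (Encodable.encode (tau M T)) with h | h | h
      · exact h0 T (Finset.mem_filter.2 ⟨hTs, h⟩)
      · have := Encodable.encode_injective h
        rw [← this] at hneg
        linarith
      · have := h0 (tau M T) (Finset.mem_filter.2 ⟨tau_Os n M _ hM T hTs, by rw [tt hT]; exact h⟩)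
        linarith
    · unfold UU
      apply Finset.sum_eq_zero
      intro i hi
      split_ifs with hc
      · rw [hsupp _ (sg_mem (mem_range.1 hi) hT), mul_zero]
        have := sg_sum i T hc.1 hc.2
        omega
      · simp
  have hz := inj n M s hs _ hsupp hU
  funext ⟨T, hT⟩
  have hT' := hT
  simp only [Op, Os, mem_filter] at hT'
  have := hz T hT'.1.1
  have h2 : tau M T ∉ Op n M s := by
    intro h
    have := (Finset.mem_filter.1 h).2
    rw [tt hT'.1.1] at this
    exact lt_asymm this hT'.2
  simpa [ext, hT, h2] using this

lemma Op_le (n M s : ℕ) (hM : M + 1 = 2 * n) (hs : 2 * s < n * M) :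
    (Op n M s).card ≤ (Op n M (s+1)).card := by
  have := LinearMap.finrank_le_finrank_of_injective (L_inj n M s hM hs)
  simpa using this


lemma b_eq (n k : ℕ) : b k n =
    ((range n).powerset.filter (fun A => ∑ j ∈ A, (2 * j + 1) = k)).card := by
  unfold b
  rw [Finset.prod_one_add, Polynomial.finsetSum_coeff, Finset.card_filter]
  apply Finset.sum_congr rfl
  intro A _
  rw [Finset.prod_pow_eq_pow_sum, Polynomial.coeff_X_pow]
  simp [eq_comm]

def tA (n : ℕ) (A : Finset ℕ) : Finset ℕ :=
  (range (2*n)).filter (fun i => if i < n then n - 1 - i ∉ A else i - n ∈ A)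

lemma fix_mem (n M : ℕ) (hM : M + 1 = 2 * n) (T : Finset ℕ) (hf : tau M T = T) (j : ℕ) (hj : j < n) :
    n - 1 - j ∈ T ↔ n + j ∉ T := by
  have h : n - 1 - j ∈ tau M T ↔ n + j ∉ T := by
    rw [mem_tau, show M - (n - 1 - j) = n + j by omega]
    simp; omega
  rwa [hf] at h

lemma fix_sum (n M : ℕ) (hM : M + 1 = 2 * n) (T : Finset ℕ) (hT : T ⊆ range (M+1))
    (hf : tau M T = T) (g : ℕ → ℤ) :
    ∑ i ∈ T, g i = ∑ j ∈ range n, g j +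
      ∑ j ∈ (range n).filter (fun j => n + j ∈ T), (g (n + j) - g (n - 1 - j)) := by
  have e : ∑ i ∈ T, g i = ∑ i ∈ range (M+1), if i ∈ T then g i else 0 := by
    rw [← Finset.sum_filter, Finset.filter_mem_eq_inter, Finset.inter_eq_right.2 hT]
  rw [e, hM, two_mul, Finset.sum_range_add,
    ← Finset.sum_range_reflect, ← Finset.sum_range_reflect (fun j => g j), Finset.sum_filter,
    ← Finset.sum_add_distrib, ← Finset.sum_add_distrib]
  apply Finset.sum_congr rfl
  intro j hj
  have := fix_mem n M hM T hf j (mem_range.1 hj)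
  by_cases h : n + j ∈ T <;> simp [this, h]

lemma Fx_card (n M k : ℕ) (hM : M + 1 = 2 * n) :
    (Fx n M (k + ∑ i ∈ range n, i)).card = b k n := by
  rw [b_eq]
  have hsum : ∀ T : Finset ℕ, T ⊆ range (M+1) → tau M T = T →
      (∑ i ∈ T, i = ∑ j ∈ range n, j +
        ∑ j ∈ (range n).filter (fun j => n + j ∈ T), (2 * j + 1)) := by
    intro T h1 h2
    have := fix_sum n M hM T h1 h2 (fun i => i)
    zify
    rw [this]
    congr 1
    apply Finset.sum_congr rfl
    intro j hj
    have := mem_range.1 (Finset.mem_filter.1 hj).1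
    omega
  have hcard : ∀ T : Finset ℕ, T ⊆ range (M+1) → tau M T = T → T.card = n := by
    intro T h1 h2
    have := fix_sum n M hM T h1 h2 (fun i => 1)
    simp at this
    exact this
  have htA : ∀ A : Finset ℕ, A ⊆ range n → tA n A ⊆ range (M+1) ∧ tau M (tA n A) = tA n A ∧
      (range n).filter (fun j => n + j ∈ tA n A) = A := by
    intro A hA
    refine ⟨?_, ?_, ?_⟩
    · rw [hM]; exact Finset.filter_subset _ _
    · ext i
      simp only [mem_tau, tA, mem_filter, mem_range]
      by_cases hi : i < n
      · have e : M - i - n = n - 1 - i := by omega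
        have e' : ¬ (M - i < n) := by omega
        simp only [hi, e, e', if_true, if_false]
        grind
      · by_cases hi' : i ≤ M
        · have e : n - 1 - (M - i) = i - n := by omega
          have e' : M - i < n := by omega
          simp only [hi, e, e', if_true, if_false]
          grind
        · grind
    · ext j
      have := @hA j
      simp only [tA, mem_filter, mem_range] at *
      simp
      grind
  refine Finset.card_nbij' (fun T => (range n).filter (fun j => n + j ∈ T)) (tA n) ?_ ?_ ?_ ?_
  · intro T hT
    simp only [Fx, Os, Om, mem_coe, mem_filter, mem_powersetCard, mem_powerset] at *
    refine ⟨Finset.filter_subset _ _, ?_⟩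
    have := hsum T hT.1.1.1 hT.2
    omega
  · intro A hA
    simp only [Fx, Os, Om, mem_coe, mem_filter, mem_powersetCard, mem_powerset] at *
    obtain ⟨h1, h2, h3⟩ := htA A hA.1
    refine ⟨⟨⟨h1, hcard _ h1 h2⟩, ?_⟩, h2⟩
    have := hsum _ h1 h2
    rw [h3] at this
    omega
  · intro T hT
    simp only [Fx, Os, Om, mem_coe, mem_filter, mem_powersetCard, mem_powerset] at *
    ext i
    have h1 : i ∈ T → i ∈ range (M+1) := fun h => hT.1.1.1 h
    have h2 := fix_mem n M hM T hT.2 (n - 1 - i)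
    simp only [tA, mem_filter, mem_range] at *
    by_cases hi : i < n
    · rw [show n - 1 - (n - 1 - i) = i by omega] at h2
      clear htA hsum hcard hT
      grind
    · clear htA hsum hcard hT h2
      by_cases hi2 : i < 2 * n
      · rw [show n + (i - n) = i by omega]
        simp only [hi, hi2, if_false, true_and]
        exact ⟨fun h => h.2, fun h => ⟨by omega, h⟩⟩
      · exact ⟨fun h => absurd h.1 hi2, fun h => absurd (h1 h) (by omega)⟩
  · intro A hA
    simp only [mem_coe, mem_filter, mem_powerset] at hA
    exact (htA A hA.1).2.2

def QQ (k l m : ℕ) : Set (Multiset ℕ) :=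
  {s | s.card ≤ l ∧ (∀ x ∈ s, 0 < x ∧ x ≤ m) ∧ s.sum = k}

def pe (k l m : ℕ) : {π : Nat.Partition k // π.parts.card ≤ l ∧ ∀ x ∈ π.parts, x ≤ m} ≃ QQ k l m where
  toFun π := ⟨π.1.parts, π.2.1, fun x hx => ⟨π.1.parts_pos hx, π.2.2 x hx⟩, π.1.parts_sum⟩
  invFun s := ⟨⟨s.1, fun hx => (s.2.2.1 _ hx).1, s.2.2.2⟩, s.2.1, fun x hx => (s.2.2.1 x hx).2⟩
  left_inv π := rfl
  right_inv s := rfl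

lemma QQ_fin (k l m : ℕ) : (QQ k l m).Finite := by
  have : Finite (QQ k l m) := Finite.of_equiv _ (pe k l m)
  exact Set.toFinite _

lemma p_eq (k l m : ℕ) : p k l m = (QQ k l m).ncard := by
  unfold p
  rw [← Nat.card_eq_fintype_card, Nat.card_congr (pe k l m)]
  rfl

lemma QQ_succ (k l m : ℕ) : (QQ k (l+1) (m+1)).ncard = (QQ k (l+1) m).ncard +
    (if m + 1 ≤ k then (QQ (k - (m+1)) l (m+1)).ncard else 0) := by
  split_ifs with h
  · have e : QQ k (l+1) (m+1) = QQ k (l+1) m ∪ (fun s => (m+1) ::ₘ s) '' QQ (k - (m+1)) l (m+1) := by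
      ext s
      simp only [QQ, Set.mem_ofPred_eq, Set.mem_union, Set.mem_image]
      constructor
      · rintro ⟨h1, h2, h3⟩
        by_cases hs : m + 1 ∈ s
        · right
          obtain ⟨t, rfl⟩ := Multiset.exists_cons_of_mem hs
          refine ⟨t, ⟨by simpa using h1, fun x hx => h2 x (Multiset.mem_cons_of_mem hx), ?_⟩, rfl⟩
          simp at h3
          omega
        · left
          refine ⟨h1, fun x hx => ⟨(h2 x hx).1, ?_⟩, h3⟩
          have := (h2 x hx).2
          have : x ≠ m + 1 := by rintro rfl; exact hs hx
          omega
      · rintro (⟨h1, h2, h3⟩ | ⟨t, ⟨h1, h2, h3⟩, rfl⟩)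
        · exact ⟨h1, fun x hx => ⟨(h2 x hx).1, by have := (h2 x hx).2; omega⟩, h3⟩
        · refine ⟨by simpa using h1, ?_, by simp; omega⟩
          intro x hx
          rcases Multiset.mem_cons.1 hx with rfl | hx
          · simp
          · exact h2 x hx
    rw [e, Set.ncard_union_eq _ (QQ_fin _ _ _) ((QQ_fin _ _ _).image _),
      Set.ncard_image_of_injective _ (fun a b hab => (Multiset.cons_inj_right _).1 hab)]
    rw [Set.disjoint_left]
    rintro s hs ⟨t, ht, rfl⟩
    have := (hs.2.1 (m+1) (Multiset.mem_cons_self _ _)).2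
    omega
  · rw [add_zero]
    congr 1
    ext s
    simp only [QQ, Set.mem_ofPred_eq]
    constructor
    · rintro ⟨h1, h2, h3⟩
      refine ⟨h1, fun x hx => ⟨(h2 x hx).1, ?_⟩, h3⟩
      have := Multiset.le_sum_of_mem hx
      omega
    · rintro ⟨h1, h2, h3⟩
      exact ⟨h1, fun x hx => ⟨(h2 x hx).1, by have := (h2 x hx).2; omega⟩, h3⟩

lemma QQ_zero (k l m : ℕ) (h : l = 0 ∨ m = 0) : (QQ k l m).ncard = if k = 0 then 1 else 0 := by
  have key : ∀ s ∈ QQ k l m, s = 0 := by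
    rintro s ⟨h1, h2, h3⟩
    rcases h with rfl | rfl
    · simpa using h1
    · apply Multiset.eq_zero_of_forall_notMem
      intro x hx
      have := h2 x hx
      omega
  split_ifs with hk
  · rw [Set.ncard_eq_one]
    refine ⟨0, ?_⟩
    ext s
    refine ⟨fun hs => key s hs, ?_⟩
    rintro rfl
    simp [QQ, hk]
  · have : QQ k l m = ∅ := by
      ext s
      simp only [Set.mem_empty_iff_false, iff_false]
      intro hs
      have h0 := key s hs
      have := hs.2.2
      rw [h0] at this
      simp at this
      omega
    rw [this]; simp

def cc (N l s : ℕ) : ℕ := ((powersetCard l (range N)).filter (fun T => ∑ i ∈ T, i = s)).card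

lemma cc_succ (N l s : ℕ) : cc (N+1) (l+1) s = cc N (l+1) s + if N ≤ s then cc N l (s - N) else 0 := by
  unfold cc
  rw [Finset.range_add_one, Finset.powersetCard_succ_insert (by simp), Finset.filter_union,
    Finset.card_union_of_disjoint]
  · congr 1
    rw [Finset.filter_image, Finset.card_image_of_injOn]
    · split_ifs with h
      · congr 1
        apply Finset.filter_congr
        intro T hT
        have : N ∉ T := fun h => by simpa using (mem_powersetCard.1 hT).1 h
        rw [Finset.sum_insert this]
        omega
      · rw [Finset.card_eq_zero, Finset.filter_eq_empty_iff]
        intro T hT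
        have : N ∉ T := fun h => by simpa using (mem_powersetCard.1 hT).1 h
        rw [Finset.sum_insert this]
        omega
    · intro T hT T' hT' he
      simp only [mem_coe, mem_filter, mem_powersetCard] at hT hT'
      have h1 : N ∉ T := fun h => by simpa using hT.1.1 h
      have h2 : N ∉ T' := fun h => by simpa using hT'.1.1 h
      rw [← Finset.erase_insert h1, ← Finset.erase_insert h2]
      rw [he]
  · rw [Finset.disjoint_left]
    intro T hT hT'
    simp only [mem_filter, mem_powersetCard, mem_image] at hT hT'
    obtain ⟨⟨T', _, rfl⟩, _⟩ := hT'
    have := hT.1.1 (Finset.mem_insert_self _ _)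
    simp at this

lemma min_sum (T : Finset ℕ) : ∑ i ∈ range T.card, i ≤ ∑ i ∈ T, i := by
  have := Finset.sum_range_le_sum (s := T.map Nat.castEmbedding) (c := (0:ℤ))
    (by intro x hx; simp at hx; obtain ⟨y, _, rfl⟩ := hx; positivity)
  simp only [Finset.card_map, zero_add, Finset.sum_map, Nat.castEmbedding_apply] at this
  rw [← Nat.cast_sum, ← Nat.cast_sum] at this
  exact Int.ofNat_le.1 this

lemma QQ_cc (l m k : ℕ) : (QQ k l m).ncard = cc (l+m) l (k + ∑ i ∈ range l, i) := by
  induction l generalizing m k with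
  | zero =>
    rw [QQ_zero _ _ _ (Or.inl rfl)]
    simp only [cc, Finset.powersetCard_zero, Finset.filter_singleton]
    by_cases hk : k = 0
    · simp [hk]
    · simp [hk, Ne.symm hk]
  | succ l ihl =>
    induction m generalizing k with
    | zero =>
      rw [QQ_zero _ _ _ (Or.inr rfl)]
      have : powersetCard (l+1) (range (l+1)) = {range (l+1)} := by
        conv_lhs => rw [← Finset.card_range (l+1), Finset.card_range (l+1)]
        have := Finset.powersetCard_self (range (l+1))
        rwa [Finset.card_range] at this
      simp only [cc, add_zero, this, Finset.filter_singleton]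
      by_cases hk : k = 0
      · simp [hk]
      · simp [hk]
    | succ m ihm =>
      rw [QQ_succ, ihm, show l + 1 + (m + 1) = (l + 1 + m) + 1 by ring, cc_succ]
      congr 1
      rw [Finset.sum_range_succ]
      by_cases h : m + 1 ≤ k
      · rw [if_pos h, if_pos (by omega), ihl]
        congr 1
        · ring
        · omega
      · rw [if_neg h]
        split_ifs with h'
        · symm
          unfold cc
          rw [Finset.card_eq_zero, Finset.filter_eq_empty_iff]
          intro T hT hs
          have hc := (mem_powersetCard.1 hT).2
          have := min_sum T
          rw [hc] at this
          omega
        · rfl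
end St

theorem stmt_3 (n k : ℕ) (hn : 0 < n) (hk1 : 1 ≤ k) (hk : 2 * k ≤ n ^ 2) :
    (p k n n : ℤ) - b k n ≥ (p (k - 1) n n : ℤ) - b (k - 1) n := by
  obtain ⟨j, rfl⟩ : ∃ j, k = j + 1 := ⟨k - 1, by omega⟩
  obtain ⟨M, hM⟩ : ∃ M, M + 1 = 2 * n := ⟨2 * n - 1, by omega⟩
  rw [Nat.add_sub_cancel]
  have hp : ∀ k, p k n n = (St.Os n M (k + ∑ i ∈ Finset.range n, i)).card := by
    intro k
    rw [St.p_eq, St.QQ_cc, ← two_mul, ← hM]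
    rfl
  have hs : 2 * (j + ∑ i ∈ Finset.range n, i) < n * M := by
    have g := Finset.sum_range_id_mul_two n
    obtain ⟨r, rfl⟩ : ∃ r, n = r + 1 := ⟨n - 1, by omega⟩
    have hM2 : M = 2 * r + 1 := by omega
    subst hM2
    rw [Nat.add_sub_cancel] at g
    nlinarith
  have h1 := St.Os_card n M (j + ∑ i ∈ Finset.range n, i) hM
  have h2 := St.Os_card n M (j + 1 + ∑ i ∈ Finset.range n, i) hM
  have h3 := St.Op_le n M _ hM hs
  rw [St.Fx_card n M _ hM, ← hp] at h1 h2
  rw [show j + ∑ i ∈ Finset.range n, i + 1 = j + 1 + ∑ i ∈ Finset.range n, i by ring] at h3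
  omega
end
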